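/- Let f ∈ Diff^∞_+([0,1]) have no ITI fixed point in the open interval (0,1) and vanishing asymptotic variation: Var(log Dfⁿ)/n → 0 as n → ∞. Then for every r ∈ ℕ and every ε > 0 there exists φ ∈ Diff^∞_+([0,1]) such that d_r(φ∘f∘φ⁻¹, id) < ε and such that, on a neighborhood of each endpoint at which f is ITI, φ coincides with an integer power of f. -/

import Mathlib

open Filter Set

noncomputable section

/-- An element of `Diff^n_+([0,1])`. -/
structure DiffIcc (n : ℕ∞) where
  toFun : ℝ → ℝ
  invFun : ℝ → ℝ
  smooth : ContDiffOn ℝ n toFun (Set.Icc 0 1)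
  smooth_inv : ContDiffOn ℝ n invFun (Set.Icc 0 1)
  maps : Set.MapsTo toFun (Set.Icc 0 1) (Set.Icc 0 1)
  maps_inv : Set.MapsTo invFun (Set.Icc 0 1) (Set.Icc 0 1)
  left_inv : ∀ x ∈ Set.Icc (0:ℝ) 1, invFun (toFun x) = x
  right_inv : ∀ x ∈ Set.Icc (0:ℝ) 1, toFun (invFun x) = x
  fix0 : toFun 0 = 0
  fix1 : toFun 1 = 1
  deriv_pos : ∀ x ∈ Set.Icc (0:ℝ) 1, 0 < derivWithin toFun (Set.Icc 0 1) x

/-- `d_r(f, g) < ε` for maps of `[0,1]`. -/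
def IDistLt (r : ℕ) (ε : ℝ) (f g : ℝ → ℝ) : Prop :=
  ∀ k ≤ r, ∀ x ∈ Set.Icc (0:ℝ) 1,
    |iteratedDerivWithin k f (Set.Icc 0 1) x - iteratedDerivWithin k g (Set.Icc 0 1) x| < ε

/-- `f` is infinitely tangent to the identity (ITI) at `a`. -/
def ITIat (f : ℝ → ℝ) (a : ℝ) : Prop :=
  derivWithin f (Set.Icc 0 1) a = 1 ∧
    ∀ k : ℕ, 2 ≤ k → iteratedDerivWithin k f (Set.Icc 0 1) a = 0

/-- The asymptotic variation of `f` vanishes. -/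
def IAsympVarVanishes (f : ℝ → ℝ) : Prop :=
  Tendsto (fun n : ℕ =>
      (eVariationOn (fun x => Real.log (derivWithin f^[n] (Set.Icc 0 1) x))
          (Set.Icc 0 1)).toReal / n)
    atTop (nhds 0)

/-- The `m`-th (integer) power of `f`, as a map. -/
def zpowFun (f : DiffIcc ⊤) (m : ℤ) : ℝ → ℝ :=
  if 0 ≤ m then f.toFun^[m.toNat] else f.invFun^[(-m).toNat]

open Real (smoothTransition)
open scoped ContDiff

lemma ContDiffAt.deriv_nat {h : ℝ → ℝ} {t : ℝ} {k : ℕ} (hd : ContDiffAt ℝ (k + 1 : ℕ) h t) :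
    ContDiffAt ℝ k (deriv h) t := by
  have h1 : ContDiffAt ℝ k (fderiv ℝ h) t := hd.fderiv_right (by norm_cast)
  have : deriv h = fun x => fderiv ℝ h x 1 := by ext x; simp
  rw [this]
  exact h1.clm_apply contDiffAt_const

/-- The derivatives of `h` at `t` up to order `k` are bounded at scale `θ`:
`|h⁽ʲ⁾(t)| ≤ C θʲ`. -/
def JetBound (k : ℕ) (θ C : ℝ) (h : ℝ → ℝ) (t : ℝ) : Prop :=
  ∀ j ≤ k, |iteratedDeriv j h t| ≤ C * θ ^ j

namespace JetBound

variable {k : ℕ} {θ C C₁ C₂ : ℝ} {h h₁ h₂ : ℝ → ℝ} {t : ℝ}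

lemma zero_le (H : JetBound k θ C h t) : |h t| ≤ C := by
  simpa using H 0 (Nat.zero_le _)

lemma const_nonneg (H : JetBound k θ C h t) : 0 ≤ C := (abs_nonneg _).trans H.zero_le

lemma mono_order {l : ℕ} (H : JetBound k θ C h t) (hl : l ≤ k) : JetBound l θ C h t :=
  fun j hj => H j (hj.trans hl)

lemma mono (H : JetBound k θ C₁ h t) (hθ : 0 ≤ θ) (hC : C₁ ≤ C₂) : JetBound k θ C₂ h t :=
  fun j hj => (H j hj).trans (by gcongr)

lemma congr (H : JetBound k θ C h₁ t) (he : h₁ =ᶠ[nhds t] h₂) : JetBound k θ C h₂ t := by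
  intro j hj
  rw [← he.iteratedDeriv_eq j]
  exact H j hj

lemma succ_iff : JetBound (k + 1) θ C h t ↔ |h t| ≤ C ∧ JetBound k θ (C * θ) (deriv h) t := by
  constructor
  · intro H
    refine ⟨H.zero_le, fun j hj => ?_⟩
    have := H (j + 1) (by omega)
    rw [iteratedDeriv_succ'] at this
    calc _ ≤ _ := this
      _ = _ := by ring
  · rintro ⟨h0, H⟩ j hj
    rcases j with _ | j
    · simpa using h0
    · rw [iteratedDeriv_succ']
      calc _ ≤ _ := H j (by omega)
        _ = _ := by ring

lemma zero_iff : JetBound 0 θ C h t ↔ |h t| ≤ C := by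
  simp [JetBound]

lemma mul (hθ : 0 ≤ θ) (h1 : ContDiffAt ℝ k h₁ t) (h2 : ContDiffAt ℝ k h₂ t)
    (H1 : JetBound k θ C₁ h₁ t) (H2 : JetBound k θ C₂ h₂ t) :
    JetBound k θ (2 ^ k * (C₁ * C₂)) (fun x => h₁ x * h₂ x) t := by
  intro j hj
  have hle : ((j : ℕ) : WithTop ℕ∞) ≤ k := by exact_mod_cast hj
  have := iteratedDeriv_mul (h1.of_le hle) (h2.of_le hle)
  change |iteratedDeriv j (h₁ * h₂) t| ≤ _
  rw [this]
  have hC1 := H1.const_nonneg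
  have hC2 := H2.const_nonneg
  calc |∑ i ∈ Finset.range (j + 1), (j.choose i : ℝ) * iteratedDeriv i h₁ t
        * iteratedDeriv (j - i) h₂ t|
      ≤ ∑ i ∈ Finset.range (j + 1), (j.choose i : ℝ) * (C₁ * C₂ * θ ^ j) := by
        refine (Finset.abs_sum_le_sum_abs _ _).trans (Finset.sum_le_sum fun i hi => ?_)
        have hi' : i ≤ j := by simpa [Nat.lt_succ_iff] using hi
        rw [abs_mul, abs_mul, Nat.abs_cast, mul_assoc]
        refine mul_le_mul_of_nonneg_left ?_ (by positivity)
        calc _ ≤ (C₁ * θ ^ i) * (C₂ * θ ^ (j - i)) :=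
              mul_le_mul (H1 i (hi'.trans hj)) (H2 (j - i) (by omega)) (abs_nonneg _)
                (by positivity)
          _ = C₁ * C₂ * (θ ^ i * θ ^ (j - i)) := by ring
          _ = _ := by rw [← pow_add, Nat.add_sub_cancel' hi']
    _ = 2 ^ j * (C₁ * C₂ * θ ^ j) := by
        rw [← Finset.sum_mul]
        congr 1
        exact_mod_cast Nat.sum_range_choose j
    _ ≤ 2 ^ k * (C₁ * C₂ * θ ^ j) := by
        gcongr
        norm_num
    _ = _ := by ring

lemma const_mul (c : ℝ) (H : JetBound k θ C h t) :
    JetBound k θ (|c| * C) (fun x => c * h x) t := by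
  intro j hj
  rw [iteratedDeriv_const_mul_field, abs_mul, mul_assoc]
  exact mul_le_mul_of_nonneg_left (H j hj) (abs_nonneg _)

lemma add (h1 : ContDiffAt ℝ k h₁ t) (h2 : ContDiffAt ℝ k h₂ t)
    (H1 : JetBound k θ C₁ h₁ t) (H2 : JetBound k θ C₂ h₂ t) :
    JetBound k θ (C₁ + C₂) (fun x => h₁ x + h₂ x) t := by
  intro j hj
  have hle : ((j : ℕ) : WithTop ℕ∞) ≤ k := by exact_mod_cast hj
  change |iteratedDeriv j (h₁ + h₂) t| ≤ _
  rw [iteratedDeriv_add (h1.of_le hle) (h2.of_le hle), add_mul]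
  exact (abs_add_le _ _).trans (add_le_add (H1 j hj) (H2 j hj))

lemma const_fun (hθ : 0 ≤ θ) (c : ℝ) : JetBound k θ |c| (fun _ => c) t := by
  intro j hj
  rw [iteratedDeriv_const]
  split_ifs with h0
  · simp [h0]
  · simp only [abs_zero]; positivity

lemma comp_add_const (H : JetBound k θ C h (t + s)) :
    JetBound k θ C (fun x => h (x + s)) t := by
  intro j hj
  rw [iteratedDeriv_comp_add_const]
  exact H j hj

end JetBound

lemma JetBound.inv (k : ℕ) : ∀ K : ℝ, 1 ≤ K → ∃ K' : ℝ, 1 ≤ K' ∧ ∀ (θ v : ℝ) (h : ℝ → ℝ) (t : ℝ),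
    0 ≤ θ → 0 < v → ContDiffAt ℝ k h t → v / K ≤ h t → JetBound k θ (K * v) h t →
    JetBound k θ (K' / v) (fun x => (h x)⁻¹) t := by
  induction k with
  | zero =>
    intro K hK
    refine ⟨K, hK, fun θ v h t hθ hv _ hl _ => ?_⟩
    rw [zero_iff]
    have hp : 0 < v / K := by positivity
    rw [abs_of_pos (inv_pos.2 (hp.trans_le hl))]
    calc (h t)⁻¹ ≤ (v / K)⁻¹ := inv_anti₀ hp hl
      _ = _ := by rw [inv_div]
  | succ k ih =>
    intro K hK
    obtain ⟨K', hK', H⟩ := ih K hK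
    set K'' := max K' (2 ^ k * (K * (2 ^ k * (K' * K')))) with hdef
    refine ⟨K'', hK'.trans (le_max_left _ _), fun θ v h t hθ hv hd hl hJ => ?_⟩
    have hp : 0 < h t := lt_of_lt_of_le (by positivity) hl
    have hd' : ContDiffAt ℝ k h t := hd.of_le (by exact_mod_cast Nat.le_succ k)
    have hi := H θ v h t hθ hv hd' hl (hJ.mono_order (Nat.le_succ k))
    rw [succ_iff] at hJ ⊢
    refine ⟨hi.zero_le.trans (by gcongr; exact le_max_left _ _), ?_⟩
    have hdi : ContDiffAt ℝ k (fun x => (h x)⁻¹) t := hd'.inv hp.ne'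
    have hdd : ContDiffAt ℝ k (deriv h) t := hd.deriv_nat
    have hprod := (JetBound.mul hθ hdd (hdi.mul hdi) hJ.2 (JetBound.mul hθ hdi hdi hi hi)).const_mul (-1)
    have heq : deriv (fun x => (h x)⁻¹) =ᶠ[nhds t]
        fun x => -1 * (deriv h x * ((h x)⁻¹ * (h x)⁻¹)) := by
      have hev : ∀ᶠ x in nhds t, ContDiffAt ℝ 1 h x := by
        have h1 : ContDiffAt ℝ 1 h t := hd.of_le (by exact_mod_cast Nat.succ_le_succ (Nat.zero_le k))
        exact h1.eventually (by simp)
      filter_upwards [hev, hd.continuousAt.eventually_ne hp.ne'] with x hx hne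
      have := (hx.differentiableAt one_ne_zero).hasDerivAt.inv hne
      rw [show (fun x => (h x)⁻¹) = h⁻¹ from rfl, this.deriv]
      field_simp
    refine (hprod.congr heq.symm).mono hθ ?_
    calc |(-1 : ℝ)| * (2 ^ k * (K * v * θ * (2 ^ k * (K' / v * (K' / v)))))
        = (2 ^ k * (K * (2 ^ k * (K' * K')))) / v * θ := by
          rw [abs_neg, abs_one]; field_simp
      _ ≤ K'' / v * θ := by gcongr; exact le_max_right _ _

lemma JetBound.exp (k : ℕ) : ∀ K : ℝ, 0 ≤ K → ∃ K' : ℝ, 1 ≤ K' ∧ ∀ (θ : ℝ) (u : ℝ → ℝ) (t : ℝ),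
    0 ≤ θ → ContDiffAt ℝ k u t → (∀ j, 1 ≤ j → j ≤ k → |iteratedDeriv j u t| ≤ K * θ ^ j) →
    JetBound k θ (K' * Real.exp (u t)) (fun x => Real.exp (u x)) t := by
  induction k with
  | zero =>
    intro K hK
    refine ⟨1, le_rfl, fun θ u t _ _ _ => ?_⟩
    rw [zero_iff, Real.abs_exp, one_mul]
  | succ k ih =>
    intro K hK
    obtain ⟨K', hK', H⟩ := ih K hK
    refine ⟨max K' (2 ^ k * (K' * K)), hK'.trans (le_max_left _ _), fun θ u t hθ hd hu => ?_⟩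
    have hd' : ContDiffAt ℝ k u t := hd.of_le (by exact_mod_cast Nat.le_succ k)
    have hi := H θ u t hθ hd' (fun j h1 h2 => hu j h1 (by omega))
    rw [succ_iff]
    refine ⟨hi.zero_le.trans (by gcongr; exact le_max_left _ _), ?_⟩
    have hJ : JetBound k θ (K * θ) (deriv u) t := by
      intro j hj
      rw [← iteratedDeriv_succ']
      calc _ ≤ _ := hu (j + 1) (by omega) (by omega)
        _ = _ := by ring
    have hprod := JetBound.mul hθ hd'.exp hd.deriv_nat hi hJ
    have heq : deriv (fun x => Real.exp (u x)) =ᶠ[nhds t] fun x => Real.exp (u x) * deriv u x := by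
      have hev : ∀ᶠ x in nhds t, ContDiffAt ℝ 1 u x := by
        have h1 : ContDiffAt ℝ 1 u t :=
          hd.of_le (by exact_mod_cast Nat.succ_le_succ (Nat.zero_le k))
        exact h1.eventually (by simp)
      filter_upwards [hev] with x hx
      exact (hx.differentiableAt one_ne_zero).hasDerivAt.exp.deriv
    refine (hprod.congr heq.symm).mono hθ ?_
    calc 2 ^ k * (K' * Real.exp (u t) * (K * θ))
        = (2 ^ k * (K' * K)) * Real.exp (u t) * θ := by ring
      _ ≤ _ := by gcongr; exact le_max_right _ _

lemma JetBound.comp (k : ℕ) : ∀ K : ℝ, 0 ≤ K → ∃ K' : ℝ, 1 ≤ K' ∧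
    ∀ (θ M : ℝ) (g ψ : ℝ → ℝ) (t : ℝ), 0 ≤ θ → ContDiffAt ℝ k g (ψ t) → ContDiffAt ℝ k ψ t →
      (∀ j, 1 ≤ j → j ≤ k → |iteratedDeriv j ψ t| ≤ K * θ ^ j) →
      (∀ j ≤ k, |iteratedDeriv j g (ψ t)| ≤ M) →
      JetBound k θ (K' * M) (fun x => g (ψ x)) t := by
  induction k with
  | zero =>
    intro K hK
    refine ⟨1, le_rfl, fun θ M g ψ t _ _ _ _ hg => ?_⟩
    rw [zero_iff, one_mul]
    simpa using hg 0 le_rfl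
  | succ k ih =>
    intro K hK
    obtain ⟨K', hK', H⟩ := ih K hK
    refine ⟨max K' (2 ^ k * (K' * K)), hK'.trans (le_max_left _ _),
      fun θ M g ψ t hθ hgd hψd hψ hg => ?_⟩
    have hM : 0 ≤ M := (abs_nonneg _).trans (hg 0 (Nat.zero_le _))
    have hψd' : ContDiffAt ℝ k ψ t := hψd.of_le (by exact_mod_cast Nat.le_succ k)
    have hi := H θ M (deriv g) ψ t hθ hgd.deriv_nat hψd' (fun j h1 h2 => hψ j h1 (by omega))
      (fun j hj => by rw [← iteratedDeriv_succ']; exact hg (j + 1) (by omega))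
    rw [succ_iff]
    have h1M : (1 : ℝ) ≤ max K' (2 ^ k * (K' * K)) := hK'.trans (le_max_left _ _)
    refine ⟨?_, ?_⟩
    · have := hg 0 (Nat.zero_le _)
      simp only [iteratedDeriv_zero] at this
      nlinarith
    have hJ : JetBound k θ (K * θ) (deriv ψ) t := by
      intro j hj
      rw [← iteratedDeriv_succ']
      calc _ ≤ _ := hψ (j + 1) (by omega) (by omega)
        _ = _ := by ring
    have hprod := JetBound.mul hθ (hgd.deriv_nat.comp t hψd') hψd.deriv_nat hi hJ
    have heq : deriv (fun x => g (ψ x)) =ᶠ[nhds t] fun x => deriv g (ψ x) * deriv ψ x := by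
      have h1g : ContDiffAt ℝ 1 g (ψ t) :=
        hgd.of_le (by exact_mod_cast Nat.succ_le_succ (Nat.zero_le k))
      have h1ψ : ContDiffAt ℝ 1 ψ t :=
        hψd.of_le (by exact_mod_cast Nat.succ_le_succ (Nat.zero_le k))
      filter_upwards [h1ψ.continuousAt.eventually (h1g.eventually (by simp)),
        h1ψ.eventually (by simp)] with x hx hx'
      exact ((hx.differentiableAt one_ne_zero).hasDerivAt.comp x
        (hx'.differentiableAt one_ne_zero).hasDerivAt).deriv
    refine (hprod.congr heq.symm).mono hθ ?_
    calc 2 ^ k * (K' * M * (K * θ))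
        = (2 ^ k * (K' * K)) * M * θ := by ring
      _ ≤ _ := by gcongr; exact le_max_right _ _

lemma contDiff_of_hasDerivAt_neg_exp {k : ℕ} {ψ u : ℝ → ℝ} (hu : ContDiff ℝ k u)
    (hψ : ∀ t, HasDerivAt ψ (-Real.exp (u t)) t) : ContDiff ℝ (k + 1 : ℕ) ψ := by
  have : deriv ψ = fun t => -Real.exp (u t) := funext fun t => (hψ t).deriv
  push_cast
  rw [contDiff_succ_iff_deriv]
  refine ⟨fun t => (hψ t).differentiableAt, by simp, ?_⟩
  rw [this]
  exact hu.exp.neg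

/-- A bound on the derivatives of the cocycle `log T'` along an orbit curve `ψ` with
`ψ' = -exp u`. -/
lemma abs_iteratedDeriv_log_deriv_comp_le (k : ℕ) (K : ℝ) (hK : 1 ≤ K) : ∃ C : ℝ, 1 ≤ C ∧
    ∀ (θ : ℝ) (u ψ T : ℝ → ℝ) (t : ℝ), 0 ≤ θ → θ ≤ 1 → ContDiff ℝ k u →
      (∀ t, HasDerivAt ψ (-Real.exp (u t)) t) → ContDiffAt ℝ (k + 2 : ℕ) T (ψ t) →
      (∀ j, 1 ≤ j → j ≤ k → |iteratedDeriv j u t| ≤ K * θ ^ j) →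
      Real.exp (u t) ≤ K * θ →
      (∀ j, 2 ≤ j → j ≤ k + 2 → |iteratedDeriv j T (ψ t)| ≤ K * θ) →
      1 / K ≤ deriv T (ψ t) → deriv T (ψ t) ≤ K →
      |iteratedDeriv (k + 1) (fun x => Real.log (deriv T (ψ x))) t|
        ≤ C * θ ^ (k + 1) * Real.exp (u t) := by
  have hK0 : 0 ≤ K := by linarith
  obtain ⟨C1, hC1, H1⟩ := JetBound.exp k K hK0
  obtain ⟨C2, hC2, H2⟩ := JetBound.comp k (C1 * K) (by positivity)
  obtain ⟨C3, hC3, H3⟩ := JetBound.inv k (C2 * K) (by nlinarith)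
  refine ⟨max 1 (2 ^ k * (2 ^ k * (C2 * K * C3) * C1)), le_max_left _ _,
    fun θ u ψ T t hθ hθ1 hu hψ hT hub hexp hTb hl hr => ?_⟩
  have hψd : ContDiff ℝ (k + 1 : ℕ) ψ := contDiff_of_hasDerivAt_neg_exp hu hψ
  have hψd' : ContDiffAt ℝ k ψ t := (hψd.of_le (by exact_mod_cast Nat.le_succ k)).contDiffAt
  have hT1 : ContDiffAt ℝ (k + 1 : ℕ) (deriv T) (ψ t) := hT.deriv_nat
  have hT2 : ContDiffAt ℝ k (deriv (deriv T)) (ψ t) := hT1.deriv_nat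
  have hT1' : ContDiffAt ℝ k (deriv T) (ψ t) := hT1.of_le (by exact_mod_cast Nat.le_succ k)
  have hE := H1 θ u t hθ hu.contDiffAt hub
  have hψ' : deriv ψ = fun t => -Real.exp (u t) := funext fun t => (hψ t).deriv
  have hψj : ∀ j, 1 ≤ j → j ≤ k → |iteratedDeriv j ψ t| ≤ C1 * K * θ ^ j := by
    intro j h1 h2
    obtain ⟨i, rfl⟩ : ∃ i, j = i + 1 := ⟨j - 1, by omega⟩
    rw [iteratedDeriv_succ', hψ', iteratedDeriv_fun_neg, abs_neg]
    calc _ ≤ _ := hE i (by omega)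
      _ ≤ C1 * (K * θ) * θ ^ i := by gcongr
      _ = _ := by ring
  have hJ2 := H2 θ (K * θ) (deriv (deriv T)) ψ t hθ hT2 hψd' hψj (fun j hj => by
    rw [← iteratedDeriv_succ', ← iteratedDeriv_succ']; exact hTb _ (by omega) (by omega))
  have hJ1 := H2 θ K (deriv T) ψ t hθ hT1' hψd' hψj (fun j hj => by
    rw [← iteratedDeriv_succ']
    rcases j with _ | j
    · simp only [zero_add, iteratedDeriv_one]
      rw [abs_of_nonneg ((by positivity : (0:ℝ) ≤ 1 / K).trans hl)]
      exact hr
    · exact (hTb _ (by omega) (by omega)).trans (by nlinarith))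
  have hpos : 0 < deriv T (ψ t) := (by positivity : (0:ℝ) < 1 / K).trans_le hl
  have hd1 : ContDiffAt ℝ k (fun x => deriv T (ψ x)) t := hT1'.comp t hψd'
  have hd2 : ContDiffAt ℝ k (fun x => deriv (deriv T) (ψ x)) t := hT2.comp t hψd'
  have hI := H3 θ 1 (fun x => deriv T (ψ x)) t hθ one_pos hd1
    ((one_div_le_one_div_of_le (by linarith) (by nlinarith)).trans hl) (by simpa using hJ1)
  have hP := JetBound.mul hθ (hd2.mul (hd1.inv hpos.ne')) hu.contDiffAt.exp
    (JetBound.mul hθ hd2 (hd1.inv hpos.ne') hJ2 hI) hE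
  have heq : deriv (fun x => Real.log (deriv T (ψ x))) =ᶠ[nhds t]
      fun x => -(deriv (deriv T) (ψ x) * (deriv T (ψ x))⁻¹ * Real.exp (u x)) := by
    have h1 : ContDiffAt ℝ 1 (deriv T) (ψ t) :=
      hT1.of_le (by exact_mod_cast Nat.succ_le_succ (Nat.zero_le k))
    filter_upwards [hψd.continuous.continuousAt.eventually (h1.eventually (by simp)),
      hd1.continuousAt.eventually_ne hpos.ne'] with x hx hne
    have := ((hx.differentiableAt one_ne_zero).hasDerivAt.comp x (hψ x)).log hne
    rw [show (fun x => Real.log (deriv T (ψ x))) = fun x => Real.log ((deriv T ∘ ψ) x) from rfl,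
      this.deriv]
    simp only [Function.comp]
    field_simp
  rw [iteratedDeriv_succ', heq.iteratedDeriv_eq, iteratedDeriv_fun_neg, abs_neg]
  calc _ ≤ _ := hP k le_rfl
    _ = (2 ^ k * (2 ^ k * (C2 * K * C3) * C1)) * θ ^ (k + 1) * Real.exp (u t) := by
        rw [pow_succ]; ring
    _ ≤ _ := by gcongr; exact le_max_right _ _

/-- Solutions of `v (t + 1) - v t = S t` whose increments between translates vanish at infinity
are as smooth as `S` when the derivative of `S` is summable along orbits. -/
lemma contDiff_one_of_cocycle {v S e p : ℝ → ℝ} {t₀ D : ℝ} (hS : ContDiff ℝ 1 S)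
    (hv : ∀ t, v (t + 1) - v t = S t)
    (hlim : ∀ s t : ℝ, Tendsto (fun n : ℕ => v (t + n) - v (s + n)) atTop (nhds 0))
    (he : ∀ t, t₀ ≤ t → |deriv S t| ≤ e t)
    (hD : ∀ s, t₀ ≤ s → ∀ t ∈ Icc s (s + 1), e t ≤ D * e s)
    (hsum : ∀ s, t₀ ≤ s → ∀ n : ℕ, ∑ i ∈ Finset.range n, e (s + i) ≤ p s)
    (hp : Tendsto p atTop (nhds 0)) :
    ContDiff ℝ 1 v ∧ Tendsto (deriv v) atTop (nhds 0) := by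
  have he0 : ∀ t, t₀ ≤ t → 0 ≤ e t := fun t ht => (abs_nonneg _).trans (he t ht)
  have hsumm : ∀ s, t₀ ≤ s → Summable fun i : ℕ => e (s + i) := fun s hs =>
    summable_of_sum_range_le (fun i => he0 _ (by linarith [(Nat.cast_nonneg i : (0:ℝ) ≤ i)]))
      (hsum s hs)
  have htele : ∀ (s t : ℝ) (n : ℕ), v t - v s =
      (v (t + n) - v (s + n)) - ∑ i ∈ Finset.range n, (S (t + i) - S (s + i)) := by
    intro s t n
    induction n with
    | zero => simp
    | succ n ih =>
      rw [Finset.sum_range_succ, ← hv, ← hv, ih]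
      push_cast
      rw [← add_assoc, ← add_assoc]
      ring
  have key : ∀ s, t₀ ≤ s → ∀ t ∈ Ioo s (s + 1),
      HasDerivAt v (-∑' i : ℕ, deriv S (t + i)) t := by
    intro s hs t ht
    have hb : ∀ (i : ℕ) (y : ℝ), y ∈ Ioo s (s + 1) → ‖deriv S (y + i)‖ ≤ D * e (s + i) := by
      intro i y hy
      have hi : (0 : ℝ) ≤ i := Nat.cast_nonneg i
      exact (he _ (by linarith [hy.1])).trans
        (hD _ (by linarith) _ ⟨by linarith [hy.1], by linarith [hy.2]⟩)
    have h1 : Summable fun i : ℕ => S (t + i) - S (t + i) := by simp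
    have h := hasDerivAt_tsum_of_isPreconnected (g := fun (i : ℕ) y => S (y + i) - S (t + i))
      (g' := fun i y => deriv S (y + i)) ((hsumm s hs).mul_left D) isOpen_Ioo
      isPreconnected_Ioo (fun i y hy => by
        have h0 := ((hS.differentiable one_ne_zero) (y + i)).hasDerivAt
        exact (h0.comp_add_const y (i : ℝ)).sub_const _) hb ht h1 ht
    have heq : ∀ y ∈ Ioo s (s + 1), v y = v t - ∑' i : ℕ, (S (y + i) - S (t + i)) := by
      intro y hy
      have hsy : Summable fun i : ℕ => S (y + i) - S (t + i) :=
        summable_of_summable_hasDerivAt_of_isPreconnected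
          (g := fun (i : ℕ) y => S (y + i) - S (t + i))
          (g' := fun i y => deriv S (y + i)) ((hsumm s hs).mul_left D) isOpen_Ioo
          isPreconnected_Ioo (fun i y hy => by
            have h0 := ((hS.differentiable one_ne_zero) (y + i)).hasDerivAt
            exact (h0.comp_add_const y (i : ℝ)).sub_const _) hb ht h1 hy
      have h2 := hsy.hasSum.tendsto_sum_nat
      have h3 := (hlim t y).sub h2
      have h4 : (fun n : ℕ => v (y + n) - v (t + n)
          - ∑ i ∈ Finset.range n, (S (y + i) - S (t + i))) = fun _ => v y - v t :=
        funext fun n => (htele t y n).symm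
      rw [h4] at h3
      have := tendsto_nhds_unique h3 tendsto_const_nhds
      linarith
    refine (h.const_sub (v t)).congr_of_eventuallyEq ?_
    filter_upwards [isOpen_Ioo.mem_nhds ht] with y hy using heq y hy
  have key2 : ∀ t, t₀ < t → HasDerivAt v (-∑' i : ℕ, deriv S (t + i)) t := fun t ht => by
    rcases lt_or_ge t (t₀ + 1) with h | h
    · exact key t₀ le_rfl t ⟨ht, h⟩
    · exact key (t - 1 / 2) (by linarith) t ⟨by linarith, by linarith⟩
  have hcd : ∀ t, t₀ < t → ContDiffAt ℝ 1 v t := by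
    intro t ht
    obtain ⟨s, hs, hst⟩ : ∃ s, t₀ ≤ s ∧ t ∈ Ioo s (s + 1) := by
      rcases lt_or_ge t (t₀ + 1) with h | h
      · exact ⟨t₀, le_rfl, ht, h⟩
      · exact ⟨t - 1 / 2, by linarith, by linarith, by linarith⟩
    have hon : ContDiffOn ℝ 1 v (Ioo s (s + 1)) := by
      rw [show (1 : WithTop ℕ∞) = 0 + 1 from rfl, contDiffOn_succ_iff_deriv_of_isOpen isOpen_Ioo]
      refine ⟨fun y hy => (key s hs y hy).differentiableAt.differentiableWithinAt, by simp, ?_⟩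
      rw [contDiffOn_zero]
      refine ContinuousOn.congr (f := fun t => -∑' i : ℕ, deriv S (t + i)) ?_
        (fun y hy => (key s hs y hy).deriv)
      refine (continuousOn_tsum (u := fun i : ℕ => D * e (s + i)) (fun i => ?_)
        ((hsumm s hs).mul_left D) ?_).neg
      · exact ((hS.continuous_deriv le_rfl).comp (continuous_add_const _)).continuousOn
      · intro i y hy
        have hi : (0 : ℝ) ≤ i := Nat.cast_nonneg i
        exact (he _ (by linarith [hy.1])).trans
          (hD _ (by linarith) _ ⟨by linarith [hy.1], by linarith [hy.2]⟩)
    exact hon.contDiffAt (isOpen_Ioo.mem_nhds hst)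
  have hdesc : ∀ n : ℕ, ∀ t, t₀ - n < t → ContDiffAt ℝ 1 v t := by
    intro n
    induction n with
    | zero => intro t ht; exact hcd t (by simpa using ht)
    | succ n ih =>
      intro t ht
      have h1 := ih (t + 1) (by push_cast at ht; linarith)
      have h2 : ContDiffAt ℝ 1 (fun x => v (x + 1)) t :=
        ContDiffAt.comp t h1 (contDiffAt_id.add contDiffAt_const)
      have h3 : v = fun x => v (x + 1) - S x := funext fun x => by rw [← hv]; ring
      rw [h3]
      exact h2.sub hS.contDiffAt
  refine ⟨contDiff_iff_contDiffAt.2 fun t => ?_, ?_⟩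
  · obtain ⟨n, hn⟩ := exists_nat_gt (t₀ - t)
    exact hdesc n t (by linarith)
  · refine squeeze_zero_norm' ?_ hp
    filter_upwards [eventually_gt_atTop t₀] with t ht
    rw [(key2 t ht).deriv, norm_neg]
    have hb : ∀ i : ℕ, ‖deriv S (t + i)‖ ≤ e (t + i) := fun i =>
      he _ (by linarith [(Nat.cast_nonneg i : (0:ℝ) ≤ i)])
    calc _ ≤ ∑' i : ℕ, ‖deriv S (t + i)‖ :=
          norm_tsum_le_tsum_norm (Summable.of_nonneg_of_le (fun _ => norm_nonneg _) hb
            (hsumm t ht.le))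
      _ ≤ ∑' i : ℕ, e (t + i) := Summable.tsum_le_tsum hb
            (Summable.of_nonneg_of_le (fun _ => norm_nonneg _) hb (hsumm t ht.le)) (hsumm t ht.le)
      _ ≤ p t := Real.tsum_le_of_sum_range_le
            (fun i => he0 _ (by linarith [(Nat.cast_nonneg i : (0:ℝ) ≤ i)])) (hsum t ht.le)

lemma natCast_le_infty (k : ℕ) : ((k : ℕ) : WithTop ℕ∞) ≤ ∞ := by exact_mod_cast le_top

/-- `ψ` is a decreasing curve in `(0, B)` with `ψ' = -exp u` on which the contraction `T` acts as
the unit time shift. -/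
structure ContractingCurve (B : ℝ) (T ψ u : ℝ → ℝ) : Prop where
  smooth : ContDiffOn ℝ ∞ T (Ioo 0 B)
  deriv_pos : ∀ x ∈ Ioo 0 B, 0 < deriv T x
  mem : ∀ t, ψ t ∈ Ioo 0 B
  hasDerivAt : ∀ t, HasDerivAt ψ (-Real.exp (u t)) t
  step : ∀ t, ψ (t + 1) = T (ψ t)
  tendsto_zero : Tendsto ψ atTop (nhds 0)
  dist : ∀ s t : ℝ, Tendsto (fun n : ℕ => u (t + n) - u (s + n)) atTop (nhds 0)
  cont : Continuous u

namespace ContractingCurve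

variable {B : ℝ} {T ψ u : ℝ → ℝ}

lemma contDiffAt (H : ContractingCurve B T ψ u) (t : ℝ) (k : ℕ) : ContDiffAt ℝ k T (ψ t) :=
  (H.smooth.contDiffAt (isOpen_Ioo.mem_nhds (H.mem t))).of_le (by exact_mod_cast le_top)

lemma anti (H : ContractingCurve B T ψ u) : StrictAnti ψ :=
  strictAnti_of_hasDerivAt_neg (fun t => H.hasDerivAt t)
    (fun _ => neg_neg_of_pos (Real.exp_pos _))

lemma cocycle (H : ContractingCurve B T ψ u) (t : ℝ) :
    u (t + 1) - u t = Real.log (deriv T (ψ t)) := by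
  have h1 : HasDerivAt (fun s => ψ (s + 1)) (-Real.exp (u (t + 1))) t :=
    (H.hasDerivAt (t + 1)).comp_add_const t 1
  have h2 : HasDerivAt (fun s => T (ψ s)) (deriv T (ψ t) * -Real.exp (u t)) t :=
    (((H.contDiffAt t 1).differentiableAt (by simp)).hasDerivAt).comp t (H.hasDerivAt t)
  rw [funext H.step] at h1
  have h3 := h1.unique h2
  have h4 : Real.exp (u (t + 1)) = deriv T (ψ t) * Real.exp (u t) := by linarith
  have h5 := congrArg Real.log h4
  rw [Real.log_exp, Real.log_mul (H.deriv_pos _ (H.mem t)).ne' (Real.exp_pos _).ne',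
    Real.log_exp] at h5
  linarith

lemma abs_sub_le (H : ContractingCurve B T ψ u) {K x₀ s t : ℝ} (hK0 : 0 ≤ K)
    (hK : ∀ x ∈ Ioc 0 x₀, ∀ y ∈ Ioc 0 x₀,
      |Real.log (deriv T x) - Real.log (deriv T y)| ≤ K * |x - y|)
    (hs : ψ s ≤ x₀) (hst : s ≤ t) (hts : t ≤ s + 1) : |u t - u s| ≤ K * ψ s := by
  have htele : ∀ n : ℕ, u t - u s = (u (t + n) - u (s + n)) -
      ∑ i ∈ Finset.range n, (Real.log (deriv T (ψ (t + i))) - Real.log (deriv T (ψ (s + i)))) := by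
    intro n
    induction n with
    | zero => simp
    | succ n ih =>
      rw [Finset.sum_range_succ, ← H.cocycle, ← H.cocycle, ih]
      push_cast
      rw [← add_assoc, ← add_assoc]
      ring
  have hle : ∀ n : ℕ, |u t - u s| ≤ |u (t + n) - u (s + n)| + K * ψ s := by
    intro n
    have hsum : ∑ i ∈ Finset.range n,
        |Real.log (deriv T (ψ (t + i))) - Real.log (deriv T (ψ (s + i)))|
        ≤ ∑ i ∈ Finset.range n, (K * ψ (s + i) - K * ψ (s + (i + 1 : ℕ))) := by
      refine Finset.sum_le_sum fun i _ => ?_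
      have hi : (0 : ℝ) ≤ i := Nat.cast_nonneg i
      have h1 : ψ (s + i) ≤ x₀ := (H.anti.antitone (by linarith)).trans hs
      have h2 : ψ (t + i) ≤ ψ (s + i) := H.anti.antitone (by linarith)
      have h3 : ψ (s + (i + 1 : ℕ)) ≤ ψ (t + i) := H.anti.antitone (by push_cast; linarith)
      calc _ ≤ K * |ψ (t + i) - ψ (s + i)| :=
            hK _ ⟨(H.mem _).1, h2.trans h1⟩ _ ⟨(H.mem _).1, h1⟩
        _ ≤ _ := by
            rw [abs_sub_comm, abs_of_nonneg (by linarith), ← mul_sub]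
            gcongr
    rw [Finset.sum_range_sub'] at hsum
    rw [htele n]
    have h4 := Finset.abs_sum_le_sum_abs
      (fun i : ℕ => Real.log (deriv T (ψ (t + i))) - Real.log (deriv T (ψ (s + i))))
      (Finset.range n)
    have h5 : 0 ≤ K * ψ (s + n) := mul_nonneg hK0 (H.mem _).1.le
    simp only [Nat.cast_zero, add_zero] at hsum
    refine (_root_.abs_sub _ _).trans ?_
    linarith
  have h1 : Tendsto (fun n : ℕ => |u (t + n) - u (s + n)| + K * ψ s) atTop
      (nhds (|(0:ℝ)| + K * ψ s)) := (H.dist s t).abs.add_const _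
  simpa using ge_of_tendsto' h1 hle

lemma exp_le (H : ContractingCurve B T ψ u) {K x₀ s : ℝ} (hK0 : 0 ≤ K)
    (hK : ∀ x ∈ Ioc 0 x₀, ∀ y ∈ Ioc 0 x₀,
      |Real.log (deriv T x) - Real.log (deriv T y)| ≤ K * |x - y|)
    (hs : ψ s ≤ x₀) :
    Real.exp (u s) ≤ Real.exp (K * ψ s) * (ψ s - ψ (s + 1)) ∧
      ψ s - ψ (s + 1) ≤ Real.exp (K * ψ s) * Real.exp (u s) := by
  obtain ⟨ξ, hξ, h⟩ := exists_hasDerivAt_eq_slope ψ (fun t => -Real.exp (u t))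
    (show s < s + 1 by linarith)
    (fun _ _ => (H.hasDerivAt _).continuousAt.continuousWithinAt) (fun _ _ => H.hasDerivAt _)
  have h1 : ψ s - ψ (s + 1) = Real.exp (u ξ) := by
    have : s + 1 - s = 1 := by ring
    rw [this, div_one] at h
    linarith
  have h2 := abs_le.1 (H.abs_sub_le hK0 hK hs hξ.1.le hξ.2.le)
  rw [h1, ← Real.exp_add, ← Real.exp_add, Real.exp_le_exp, Real.exp_le_exp]
  constructor <;> linarith [h2.1, h2.2]

lemma sum_exp_le (H : ContractingCurve B T ψ u) {K x₀ s : ℝ} (hK0 : 0 ≤ K)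
    (hK : ∀ x ∈ Ioc 0 x₀, ∀ y ∈ Ioc 0 x₀,
      |Real.log (deriv T x) - Real.log (deriv T y)| ≤ K * |x - y|)
    (hs : ψ s ≤ x₀) (n : ℕ) :
    ∑ i ∈ Finset.range n, Real.exp (u (s + i)) ≤ Real.exp (K * ψ s) * ψ s := by
  calc ∑ i ∈ Finset.range n, Real.exp (u (s + i))
      ≤ ∑ i ∈ Finset.range n,
        (Real.exp (K * ψ s) * ψ (s + i) - Real.exp (K * ψ s) * ψ (s + (i + 1 : ℕ))) := by
        refine Finset.sum_le_sum fun i _ => ?_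
        have hi : (0 : ℝ) ≤ i := Nat.cast_nonneg i
        have h1 : ψ (s + i) ≤ ψ s := H.anti.antitone (by linarith)
        have h2 : ψ (s + (i + 1 : ℕ)) ≤ ψ (s + i) := H.anti.antitone (by push_cast; linarith)
        refine (H.exp_le hK0 hK (h1.trans hs)).1.trans ?_
        rw [← mul_sub]
        push_cast at h2 ⊢
        rw [← add_assoc] at h2 ⊢
        gcongr
    _ ≤ _ := by
        rw [Finset.sum_range_sub']
        have := mul_nonneg (Real.exp_pos (K * ψ s)).le (H.mem (s + n)).1.le
        simp only [Nat.cast_zero, add_zero]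
        linarith

/-- A bound on `T''` gives a Lipschitz constant for `log T'`. -/
lemma lipschitz_log_deriv (hsm : ContDiffOn ℝ ∞ T (Ioo 0 B))
    {K M x₀ : ℝ} (hx₀ : x₀ < B) (hM : 0 ≤ M) (hK : 0 < K)
    (h2 : ∀ x ∈ Ioc 0 x₀, |iteratedDeriv 2 T x| ≤ M) (hl : ∀ x ∈ Ioc 0 x₀, 1 / K ≤ deriv T x) :
    ∀ x ∈ Ioc 0 x₀, ∀ y ∈ Ioc 0 x₀,
      |Real.log (deriv T x) - Real.log (deriv T y)| ≤ K * M * |x - y| := by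
  intro x hx y hy
  have hd : ∀ z ∈ Ioc 0 x₀, HasDerivWithinAt (fun z => Real.log (deriv T z))
      (iteratedDeriv 2 T z / deriv T z) (Ioc 0 x₀) z := by
    intro z hz
    have hT : ContDiffAt ℝ (1 + 1 : ℕ) T z :=
      (hsm.contDiffAt (isOpen_Ioo.mem_nhds ⟨hz.1, hz.2.trans_lt hx₀⟩)).of_le
        (natCast_le_infty _)
    have h1 := (hT.deriv_nat.differentiableAt (by simp)).hasDerivAt
    have hne : deriv T z ≠ 0 := ((by positivity : 0 < 1 / K).trans_le (hl z hz)).ne'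
    have h3 := h1.log hne
    rw [iteratedDeriv_succ, iteratedDeriv_one]
    exact h3.hasDerivWithinAt
  have hb : ∀ z ∈ Ioc 0 x₀, ‖iteratedDeriv 2 T z / deriv T z‖ ≤ K * M := by
    intro z hz
    have h3 := hl z hz
    have hp : 0 < deriv T z := (by positivity : 0 < 1 / K).trans_le h3
    rw [Real.norm_eq_abs, abs_div, abs_of_pos hp, div_le_iff₀ hp]
    have h4 : 1 ≤ K * deriv T z := by
      rw [div_le_iff₀ hK] at h3
      linarith
    nlinarith [h2 z hz]
  simpa [Real.norm_eq_abs] using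
    (convex_Ioc 0 x₀).norm_image_sub_le_of_norm_hasDerivWithin_le hd hb hy hx

lemma contDiff_cocycle (H : ContractingCurve B T ψ u) {k : ℕ} (hu : ContDiff ℝ k u) :
    ContDiff ℝ (k + 1 : ℕ) fun t => Real.log (deriv T (ψ t)) := by
  rw [contDiff_iff_contDiffAt]
  intro t
  have hψ := (contDiff_of_hasDerivAt_neg_exp hu H.hasDerivAt).contDiffAt (x := t)
  exact (((H.contDiffAt t (k + 1 + 1)).deriv_nat).comp t hψ).log (H.deriv_pos _ (H.mem t)).ne'

lemma iteratedDeriv_cocycle (H : ContractingCurve B T ψ u) {k : ℕ} (hu : ContDiff ℝ k u) (t : ℝ) :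
    iteratedDeriv k u (t + 1) - iteratedDeriv k u t =
      iteratedDeriv k (fun t => Real.log (deriv T (ψ t))) t := by
  have h1 : (fun t => Real.log (deriv T (ψ t))) = (fun t => u (t + 1)) - u := by
    ext t; simp [H.cocycle]
  have h2 : ContDiff ℝ k fun t => u (t + 1) := hu.comp (contDiff_id.add contDiff_const)
  rw [h1, iteratedDeriv_sub h2.contDiffAt hu.contDiffAt, iteratedDeriv_comp_add_const]

lemma contDiff_and_tendsto (H : ContractingCurve B T ψ u) {x₁ K : ℝ} (h0 : 0 < x₁) (h1 : x₁ < B)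
    (hK : 1 ≤ K) (hb : ∀ j, ∃ M, ∀ x ∈ Ioc 0 x₁, |iteratedDeriv j T x| ≤ M)
    (hl : ∀ x ∈ Ioc 0 x₁, 1 / K ≤ deriv T x) (k : ℕ) :
    ContDiff ℝ k u ∧ ∀ j, 1 ≤ j → j ≤ k → Tendsto (iteratedDeriv j u) atTop (nhds 0) := by
  choose M hM using hb
  have hM0 : ∀ j, 0 ≤ M j := fun j => (abs_nonneg _).trans (hM j x₁ ⟨h0, le_rfl⟩)
  set L := K * M 2 with hL
  have hL0 : 0 ≤ L := mul_nonneg (by linarith) (hM0 2)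
  have hlip := lipschitz_log_deriv H.smooth h1 (hM0 2) (by linarith : 0 < K) (hM 2) hl
  induction k with
  | zero => exact ⟨by simpa [contDiff_zero] using H.cont, fun j h1 h2 => by omega⟩
  | succ k ih =>
    obtain ⟨hu, hlim⟩ := ih
    set S := fun t => Real.log (deriv T (ψ t)) with hS
    have hScd := H.contDiff_cocycle hu
    set K' := K + M 1 + Real.exp (L * x₁) * x₁ + ∑ j ∈ Finset.range (k + 3), M j with hK'
    have hMs : ∀ j, j ≤ k + 2 → M j ≤ ∑ j ∈ Finset.range (k + 3), M j := fun j hj =>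
      Finset.single_le_sum (f := M) (fun j _ => hM0 j) (by simp; omega)
    have hMs0 : 0 ≤ ∑ j ∈ Finset.range (k + 3), M j := Finset.sum_nonneg fun j _ => hM0 j
    have hexp0 : 0 ≤ Real.exp (L * x₁) * x₁ := mul_nonneg (Real.exp_pos _).le h0.le
    obtain ⟨C, hC, halg⟩ := abs_iteratedDeriv_log_deriv_comp_le k K' (by linarith [hM0 1])
    have hev : ∀ᶠ t in atTop, ψ t ≤ x₁ ∧ ∀ j ∈ Finset.Icc 1 k, |iteratedDeriv j u t| ≤ 1 := by
      refine (H.tendsto_zero.eventually (eventually_le_nhds h0)).and ?_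
      rw [Filter.eventually_all_finset]
      intro j hj
      rw [Finset.mem_Icc] at hj
      have := (hlim j hj.1 hj.2).abs
      simp only [abs_zero] at this
      exact this.eventually (eventually_le_nhds one_pos)
    obtain ⟨t₀, ht₀⟩ := eventually_atTop.1 hev
    have hψle : ∀ t, t₀ ≤ t → ψ t ≤ x₁ := fun t ht => (ht₀ t ht).1
    have hexple : ∀ t, t₀ ≤ t → Real.exp (u t) ≤ Real.exp (L * x₁) * x₁ := fun t ht => by
      have h3 := (H.exp_le hL0 hlip (hψle t ht)).1
      have h4 := (H.mem (t + 1)).1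
      refine h3.trans (mul_le_mul ?_ (by linarith [hψle t ht]) ?_ (Real.exp_pos _).le)
      · gcongr; exact hψle t ht
      · have := H.anti (show t < t + 1 by linarith); linarith
    have hmain : ∀ t, t₀ ≤ t → |iteratedDeriv (k + 1) S t| ≤ C * Real.exp (u t) := by
      intro t ht
      have hm : ψ t ∈ Ioc 0 x₁ := ⟨(H.mem t).1, hψle t ht⟩
      have := halg 1 u ψ T t zero_le_one le_rfl hu H.hasDerivAt (H.contDiffAt t _) (fun j h1 h2 => by
        have h5 := (ht₀ t ht).2 j (Finset.mem_Icc.2 ⟨h1, h2⟩)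
        simp only [one_pow, mul_one]
        linarith [hM0 1]) (by linarith [hexple t ht, hM0 1])
        (fun j h1 h2 => by linarith [hM j _ hm, hMs j h2, hM0 1])
        ((one_div_le_one_div_of_le (by linarith) (by linarith [hM0 1])).trans (hl _ hm))
        (by
          have h6 := hM 1 _ hm
          rw [iteratedDeriv_one] at h6
          linarith [le_abs_self (deriv T (ψ t))])
      simpa using this
    have hcoc := contDiff_one_of_cocycle (v := iteratedDeriv k u) (S := iteratedDeriv k S)
      (e := fun t => C * Real.exp (u t)) (p := fun s => C * (Real.exp (L * x₁) * ψ s)) (t₀ := t₀)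
      (D := Real.exp (L * x₁))
      (by exact (contDiff_nat_succ_iff_contDiff_one_iteratedDeriv.1 hScd).2)
      (fun t => H.iteratedDeriv_cocycle hu t)
      (fun s t => by
        rcases k with _ | k
        · simpa using H.dist s t
        · have h7 := hlim (k + 1) (by omega) le_rfl
          have h8 : ∀ s : ℝ, Tendsto (fun n : ℕ => s + (n : ℝ)) atTop atTop := fun s =>
            tendsto_atTop_add_const_left _ _ tendsto_natCast_atTop_atTop
          simpa using (h7.comp (h8 t)).sub (h7.comp (h8 s)))
      (fun t ht => by rw [← iteratedDeriv_succ]; exact hmain t ht)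
      (fun s hs t ht => by
        have h9 := abs_le.1 (H.abs_sub_le hL0 hlip (hψle s hs) ht.1 ht.2)
        have h10 : u t ≤ L * x₁ + u s := by
          have := mul_le_mul_of_nonneg_left (hψle s hs) hL0
          linarith [h9.2]
        have := Real.exp_le_exp.2 h10
        rw [Real.exp_add] at this
        calc _ ≤ C * (Real.exp (L * x₁) * Real.exp (u s)) := by gcongr
          _ = _ := by ring)
      (fun s hs n => by
        rw [← Finset.mul_sum]
        refine mul_le_mul_of_nonneg_left ((H.sum_exp_le hL0 hlip (hψle s hs) n).trans ?_)
          (by linarith)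
        have := (H.mem s).1
        gcongr
        exact hψle s hs)
      (by simpa using (H.tendsto_zero.const_mul (Real.exp (L * x₁))).const_mul C)
    refine ⟨contDiff_nat_succ_iff_contDiff_one_iteratedDeriv.2 ⟨hu, hcoc.1⟩, fun j hj1 hj2 => ?_⟩
    rcases Nat.lt_or_ge j (k + 1) with h | h
    · exact hlim j hj1 (by omega)
    · obtain rfl : j = k + 1 := by omega
      rw [iteratedDeriv_succ]
      exact hcoc.2

/-- Quantitative control of a contracting curve from its first entrance in a region where the
contraction is close to the identity. -/
theorem exists_jet_bound (k : ℕ) : ∃ C : ℝ, 1 ≤ C ∧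
    ∀ (B : ℝ) (T ψ u : ℝ → ℝ) (θ δ t₀ : ℝ), ContractingCurve B T ψ u → ContDiff ℝ ∞ u →
      (∀ j, 1 ≤ j → Tendsto (iteratedDeriv j u) atTop (nhds 0)) →
      ψ t₀ ≤ 1 → 0 < δ → δ ≤ θ → θ ≤ 1 / 4 →
      (∀ x ∈ Ioc 0 (ψ t₀), |T x - x| ≤ δ) → |T (ψ t₀) - ψ t₀| = δ →
      (∀ x ∈ Ioc 0 (ψ t₀), |deriv T x - 1| ≤ θ) →
      (∀ j, 2 ≤ j → j ≤ k + 2 → ∀ x ∈ Ioc 0 (ψ t₀), |iteratedDeriv j T x| ≤ θ) →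
      (∀ t ∈ Icc t₀ (t₀ + 2 / θ), δ / C ≤ Real.exp (u t)) ∧
      ∀ t, t₀ ≤ t → Real.exp (u t) ≤ C * δ ∧
        ∀ j, 1 ≤ j → j ≤ k → |iteratedDeriv j u t| ≤ C * θ ^ j := by
  induction k with
  | zero =>
    refine ⟨Real.exp 6, Real.one_le_exp (by norm_num), ?_⟩
    intro B T ψ u θ δ t₀ H hu hlim hψ hδ hδθ hθ hT hT0 hT1 hT2
    have hθ0 : 0 < θ := hδ.trans_le hδθ
    have hl : ∀ x ∈ Ioc 0 (ψ t₀), 1 / 2 ≤ deriv T x := fun x hx => by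
      linarith [(abs_le.1 (hT1 x hx)).1]
    have hlip := lipschitz_log_deriv H.smooth (H.mem t₀).2 hθ0.le two_pos
      (hT2 2 le_rfl le_rfl) hl
    have hL0 : 0 ≤ 2 * θ := by positivity
    have hψle : ∀ t, t₀ ≤ t → ψ t ≤ ψ t₀ := fun t ht => H.anti.antitone ht
    have hgap : ∀ t, |T (ψ t) - ψ t| = ψ t - ψ (t + 1) := fun t => by
      rw [← H.step, abs_sub_comm, abs_of_nonneg]
      linarith [H.anti (show t < t + 1 by linarith)]
    have hsmall : ∀ t, t₀ ≤ t → 2 * θ * ψ t ≤ 1 / 2 := fun t ht => by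
      have := (H.mem t).1
      nlinarith [hψle t ht]
    refine ⟨fun t ht => ?_, fun t ht => ⟨?_, fun j h1 h2 => by omega⟩⟩
    · have hdesc : ∀ n : ℕ, u t₀ - 2 * θ * n ≤ u (t₀ + n) := by
        intro n
        induction n with
        | zero => simp
        | succ n ih =>
          have hn : (0 : ℝ) ≤ n := Nat.cast_nonneg n
          have h3 := H.cocycle (t₀ + n)
          have hm : ψ (t₀ + n) ∈ Ioc 0 (ψ t₀) := ⟨(H.mem _).1, hψle _ (by linarith)⟩
          have h4 := (abs_le.1 (hT1 _ hm)).1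
          have h5 := Real.one_sub_inv_le_log_of_pos (H.deriv_pos _ (H.mem (t₀ + n)))
          have h6 : (deriv T (ψ (t₀ + n)))⁻¹ ≤ 1 + 2 * θ := by
            rw [inv_le_comm₀ (by linarith) (by linarith)]
            refine le_trans ?_ (by linarith : 1 - θ ≤ _)
            rw [inv_le_iff_one_le_mul₀ (by linarith)]
            nlinarith
          push_cast
          rw [← add_assoc]
          linarith
      set n := ⌊t - t₀⌋₊ with hn
      have h3 : (n : ℝ) ≤ t - t₀ := Nat.floor_le (by linarith [ht.1])
      have h4 : t - t₀ < n + 1 := Nat.lt_floor_add_one _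
      have hn0 : (0 : ℝ) ≤ n := Nat.cast_nonneg n
      have h5 := (abs_le.1 (H.abs_sub_le hL0 hlip (hψle (t₀ + n) (by linarith))
        (show t₀ + n ≤ t by linarith) (by linarith))).1
      have h6 := hsmall (t₀ + n) (by linarith)
      have h7 := (H.exp_le hL0 hlip (le_refl (ψ t₀))).2
      rw [← hgap, hT0, ← Real.exp_add] at h7
      have h8 := hsmall t₀ le_rfl
      have h9 : 2 * θ * n ≤ 4 := by
        have : (n : ℝ) ≤ 2 / θ := by linarith [ht.2]
        calc 2 * θ * n ≤ 2 * θ * (2 / θ) := by gcongr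
          _ = 4 := by field_simp; norm_num
      rw [div_le_iff₀ (Real.exp_pos _), ← Real.exp_add]
      refine h7.trans (Real.exp_le_exp.2 ?_)
      linarith [hdesc n]
    · have h3 := (H.exp_le hL0 hlip (hψle t ht)).1
      have hm : ψ t ∈ Ioc 0 (ψ t₀) := ⟨(H.mem _).1, hψle _ ht⟩
      rw [← hgap] at h3
      refine h3.trans (mul_le_mul ?_ (hT _ hm) (abs_nonneg _) (Real.exp_pos _).le)
      rw [Real.exp_le_exp]
      linarith [hsmall t ht]
  | succ k ih =>
    obtain ⟨C, hC, IH⟩ := ih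
    obtain ⟨C', hC', halg⟩ := abs_iteratedDeriv_log_deriv_comp_le k (C + 2) (by linarith)
    refine ⟨max C (C' * Real.exp 1), hC.trans (le_max_left _ _), ?_⟩
    intro B T ψ u θ δ t₀ H hu hlim hψ hδ hδθ hθ hT hT0 hT1 hT2
    have hθ0 : 0 < θ := hδ.trans_le hδθ
    obtain ⟨hlow, hup⟩ := IH B T ψ u θ δ t₀ H hu hlim hψ hδ hδθ hθ hT hT0 hT1
      (fun j h1 h2 => hT2 j h1 (by omega))
    have hl : ∀ x ∈ Ioc 0 (ψ t₀), 1 / 2 ≤ deriv T x := fun x hx => by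
      linarith [(abs_le.1 (hT1 x hx)).1]
    have hlip := lipschitz_log_deriv H.smooth (H.mem t₀).2 hθ0.le two_pos
      (hT2 2 le_rfl (by omega)) hl
    have hL0 : 0 ≤ 2 * θ := by positivity
    have hψle : ∀ t, t₀ ≤ t → ψ t ≤ ψ t₀ := fun t ht => H.anti.antitone ht
    have huk : ∀ k : ℕ, ContDiff ℝ k u := fun k => hu.of_le (natCast_le_infty k)
    refine ⟨fun t ht => (div_le_div_of_nonneg_left hδ.le (by linarith) (le_max_left _ _)).trans
      (hlow t ht), fun t ht => ⟨(hup t ht).1.trans (by gcongr; exact le_max_left _ _),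
      fun j hj1 hj2 => ?_⟩⟩
    rcases Nat.lt_or_ge j (k + 1) with h | h
    · exact ((hup t ht).2 j hj1 (by omega)).trans (by gcongr; exact le_max_left _ _)
    obtain rfl : j = k + 1 := by omega
    set S := fun t => Real.log (deriv T (ψ t)) with hS
    have hmain : ∀ t, t₀ ≤ t → |iteratedDeriv (k + 1) S t| ≤ C' * θ ^ (k + 1) * Real.exp (u t) := by
      intro t ht
      have hm : ψ t ∈ Ioc 0 (ψ t₀) := ⟨(H.mem _).1, hψle _ ht⟩
      refine halg θ u ψ T t hθ0.le (by linarith) (huk k) H.hasDerivAt (H.contDiffAt t _)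
        (fun j h1 h2 => ((hup t ht).2 j h1 h2).trans (by gcongr; linarith))
        ((hup t ht).1.trans (by nlinarith)) (fun j h1 h2 => (hT2 j h1 (by omega) _ hm).trans
          (by nlinarith)) ((one_div_le_one_div_of_le two_pos (by linarith)).trans (hl _ hm))
        (by linarith [(abs_le.1 (hT1 _ hm)).2])
    have htele : ∀ n : ℕ, iteratedDeriv (k + 1) u t = iteratedDeriv (k + 1) u (t + n) -
        ∑ i ∈ Finset.range n, iteratedDeriv (k + 1) S (t + i) := by
      intro n
      induction n with
      | zero => simp
      | succ n ihn =>
        rw [Finset.sum_range_succ, ← H.iteratedDeriv_cocycle (huk _), ihn]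
        push_cast
        rw [← add_assoc]
        ring
    have hle : ∀ n : ℕ, |iteratedDeriv (k + 1) u t| ≤
        |iteratedDeriv (k + 1) u (t + n)| + C' * θ ^ (k + 1) * Real.exp 1 := by
      intro n
      rw [htele n]
      refine (_root_.abs_sub _ _).trans (add_le_add le_rfl ?_)
      refine (Finset.abs_sum_le_sum_abs _ _).trans ?_
      calc _ ≤ ∑ i ∈ Finset.range n, C' * θ ^ (k + 1) * Real.exp (u (t + i)) :=
            Finset.sum_le_sum fun i _ => hmain _ (by linarith [(Nat.cast_nonneg i : (0:ℝ) ≤ i)])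
        _ ≤ _ := by
            rw [← Finset.mul_sum]
            refine mul_le_mul_of_nonneg_left ((H.sum_exp_le hL0 hlip (hψle t ht) n).trans ?_)
              (by positivity)
            have h5 := (H.mem t).1
            have h6 := (hψle t ht).trans hψ
            calc _ ≤ Real.exp 1 * 1 := by
                  gcongr
                  nlinarith
              _ = _ := mul_one _
    have h1 : Tendsto (fun n : ℕ => |iteratedDeriv (k + 1) u (t + n)| +
        C' * θ ^ (k + 1) * Real.exp 1) atTop (nhds (|(0:ℝ)| + C' * θ ^ (k + 1) * Real.exp 1)) :=
      ((((hlim (k + 1) (by omega)).comp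
        (tendsto_atTop_add_const_left _ _ tendsto_natCast_atTop_atTop)).abs).add_const _)
    have h2 := ge_of_tendsto' h1 hle
    rw [abs_zero, zero_add] at h2
    calc _ ≤ _ := h2
      _ = C' * Real.exp 1 * θ ^ (k + 1) := by ring
      _ ≤ _ := by gcongr; exact le_max_right _ _

end ContractingCurve

/-- A smooth contraction `T` of `(0, B)`, with derivatives bounded near `0` and tangent to the
identity at `0`. -/
structure SmoothContraction (B : ℝ) (T : ℝ → ℝ) : Prop where
  smooth : ContDiffOn ℝ ∞ T (Ioo 0 B)
  deriv_pos : ∀ x ∈ Ioo 0 B, 0 < deriv T x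
  mapsTo : MapsTo T (Ioo 0 B) (Ioo 0 B)
  lt : ∀ x ∈ Ioo 0 B, T x < x
  bdd : ∀ x₁ ∈ Ioo 0 B, ∀ j, ∃ M, ∀ x ∈ Ioc 0 x₁, |iteratedDeriv j T x| ≤ M
  lower : ∀ x₁ ∈ Ioo 0 B, ∃ K, 1 ≤ K ∧ ∀ x ∈ Ioc 0 x₁, 1 / K ≤ deriv T x
  tendsto_deriv : Tendsto (deriv T) (nhdsWithin 0 (Ioi 0)) (nhds 1)

namespace SmoothContraction

variable {B : ℝ} {T : ℝ → ℝ}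

lemma iterate_mem (H : SmoothContraction B T) {x : ℝ} (hx : x ∈ Ioo 0 B) (n : ℕ) :
    T^[n] x ∈ Ioo 0 B := H.mapsTo.iterate n hx

lemma strictMonoOn (H : SmoothContraction B T) : StrictMonoOn T (Ioo 0 B) := by
  refine strictMonoOn_of_deriv_pos (convex_Ioo 0 B) H.smooth.continuousOn fun x hx => ?_
  rw [interior_Ioo] at hx
  exact H.deriv_pos x hx

lemma iterate_monotoneOn (H : SmoothContraction B T) (n : ℕ) :
    MonotoneOn T^[n] (Ioo 0 B) := by
  induction n with
  | zero => exact monotoneOn_id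
  | succ n ih =>
    intro x hx y hy hxy
    rw [Function.iterate_succ_apply, Function.iterate_succ_apply]
    exact ih (H.mapsTo hx) (H.mapsTo hy) (H.strictMonoOn.monotoneOn hx hy hxy)

lemma iterate_antitone (H : SmoothContraction B T) {x : ℝ} (hx : x ∈ Ioo 0 B) :
    Antitone fun n : ℕ => T^[n] x :=
  antitone_nat_of_succ_le fun n => by
    rw [Function.iterate_succ_apply']
    exact (H.lt _ (H.iterate_mem hx n)).le

lemma tendsto_iterate (H : SmoothContraction B T) {x : ℝ} (hx : x ∈ Ioo 0 B) :
    Tendsto (fun n : ℕ => T^[n] x) atTop (nhds 0) := by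
  have hbdd : BddBelow (range fun n : ℕ => T^[n] x) :=
    ⟨0, by rintro _ ⟨n, rfl⟩; exact (H.iterate_mem hx n).1.le⟩
  have hlim := tendsto_atTop_ciInf (H.iterate_antitone hx) hbdd
  set l := ⨅ n : ℕ, T^[n] x with hl
  have hl0 : 0 ≤ l := le_ciInf fun n => (H.iterate_mem hx n).1.le
  have hlx : l ≤ x := ciInf_le hbdd 0
  rcases hl0.eq_or_lt with h | h
  · rwa [← h] at hlim
  · have hmem : l ∈ Ioo 0 B := ⟨h, hlx.trans_lt hx.2⟩
    have hc : ContinuousAt T l :=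
      (H.smooth.contDiffAt (isOpen_Ioo.mem_nhds hmem)).continuousAt
    have h1 : Tendsto (fun n : ℕ => T^[n + 1] x) atTop (nhds (T l)) := by
      simp_rw [Function.iterate_succ_apply']
      exact hc.tendsto.comp hlim
    have h2 := tendsto_nhds_unique h1 (hlim.comp (tendsto_add_atTop_nat 1))
    exact absurd h2 (H.lt l hmem).ne

lemma summable_sub (H : SmoothContraction B T) {x : ℝ} (hx : x ∈ Ioo 0 B) (m : ℕ) :
    Summable fun i : ℕ => T^[i] x - T^[i + m] x := by
  refine summable_of_sum_range_le (c := m * x)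
    (fun i => sub_nonneg.2 (H.iterate_antitone hx (Nat.le_add_right i m))) fun n => ?_
  have hstep : ∀ m : ℕ, ∑ i ∈ Finset.range n, (T^[i] x - T^[i + m] x) ≤ m * x := by
    intro m
    induction m with
    | zero => simp
    | succ m ih =>
      have h1 : ∑ i ∈ Finset.range n, (T^[i] x - T^[i + (m + 1)] x) =
          ∑ i ∈ Finset.range n, (T^[i] x - T^[i + m] x) +
          ∑ i ∈ Finset.range n, (T^[i + m] x - T^[(i + 1) + m] x) := by
        rw [← Finset.sum_add_distrib]
        refine Finset.sum_congr rfl fun i _ => ?_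
        rw [show i + (m + 1) = i + 1 + m by ring]
        ring
      rw [h1, Finset.sum_range_sub' (fun i => T^[i + m] x)]
      have h2 := (H.iterate_mem hx (n + m)).1
      have h3 : T^[0 + m] x ≤ x := by
        simpa using H.iterate_antitone hx (Nat.zero_le m)
      push_cast
      linarith
  exact hstep m

lemma exists_lipschitz (H : SmoothContraction B T) {x₁ : ℝ} (hx₁ : x₁ ∈ Ioo 0 B) :
    ∃ K, 0 ≤ K ∧ ∀ x ∈ Ioc 0 x₁, ∀ y ∈ Ioc 0 x₁,
      |Real.log (deriv T x) - Real.log (deriv T y)| ≤ K * |x - y| := by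
  obtain ⟨M, hM⟩ := H.bdd x₁ hx₁ 2
  obtain ⟨K, hK, hl⟩ := H.lower x₁ hx₁
  have hM0 : 0 ≤ M := (abs_nonneg _).trans (hM x₁ ⟨hx₁.1, le_rfl⟩)
  exact ⟨K * M, by positivity, ContractingCurve.lipschitz_log_deriv H.smooth hx₁.2 hM0
    (by linarith) hM hl⟩

/-- The distortion of the iterates of a contraction converges to a continuous cobounding
function. -/
theorem exists_cobound (H : SmoothContraction B T) {x₀ : ℝ} (hx₀ : x₀ ∈ Ioo 0 B) :
    ∃ P : ℝ → ℝ, ContinuousOn P (Ioo 0 B) ∧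
      (∀ x ∈ Ioo 0 B, Tendsto (fun n : ℕ =>
        birkhoffSum T (fun x => Real.log (deriv T x)) n x₀ -
        birkhoffSum T (fun x => Real.log (deriv T x)) n x) atTop (nhds (P x))) ∧
      ∀ x ∈ Ioo 0 B, P (T x) = P x + Real.log (deriv T x) := by
  set g : ℝ → ℝ := fun x => Real.log (deriv T x) with hg
  have hgc : ContinuousOn g (Ioo 0 B) := by
    intro x hx
    have h1 : ContDiffAt ℝ (0 + 1 : ℕ) T x :=
      (H.smooth.contDiffAt (isOpen_Ioo.mem_nhds hx)).of_le (natCast_le_infty _)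
    exact (h1.deriv_nat.continuousAt.log (H.deriv_pos x hx).ne').continuousWithinAt
  have hic : ∀ n : ℕ, ContinuousOn T^[n] (Ioo 0 B) := fun n =>
    H.smooth.continuousOn.iterate H.mapsTo n
  have hbound : ∀ x' ∈ Ioo 0 B, ∃ K, 0 ≤ K ∧ ∀ m : ℕ, ∀ y ∈ Icc (T^[m] x') x', ∀ i : ℕ,
      ‖g (T^[i] y) - g (T^[i] x')‖ ≤ K * (T^[i] x' - T^[i + m] x') := by
    intro x' hx'
    obtain ⟨K, hK0, hK⟩ := H.exists_lipschitz hx'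
    refine ⟨K, hK0, fun m y hy i => ?_⟩
    have hyB : y ∈ Ioo 0 B := ⟨(H.iterate_mem hx' m).1.trans_le hy.1, hy.2.trans_lt hx'.2⟩
    have h1 : T^[i] y ≤ T^[i] x' := H.iterate_monotoneOn i hyB hx' hy.2
    have h2 : T^[i + m] x' ≤ T^[i] y := by
      rw [Function.iterate_add_apply]
      exact H.iterate_monotoneOn i (H.iterate_mem hx' m) hyB hy.1
    have h3 : T^[i] x' ≤ x' := H.iterate_antitone hx' (Nat.zero_le i)
    calc _ ≤ K * |T^[i] y - T^[i] x'| := hK _ ⟨(H.iterate_mem hyB i).1, h1.trans h3⟩ _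
          ⟨(H.iterate_mem hx' i).1, h3⟩
      _ ≤ _ := by
        rw [abs_sub_comm, abs_of_nonneg (by linarith)]
        gcongr
  have hex : ∀ x ∈ Ioo 0 B, ∃ x' ∈ Ioo 0 B, ∃ m : ℕ, x ∈ Ioo (T^[m] x') x' ∧
      x₀ ∈ Icc (T^[m] x') x' := by
    intro x hx
    obtain ⟨x', h1, h2⟩ := exists_between (max_lt hx.2 hx₀.2)
    have hx' : x' ∈ Ioo 0 B := ⟨(hx.1.trans_le (le_max_left _ _)).trans h1, h2⟩
    obtain ⟨m, hm⟩ := ((H.tendsto_iterate hx').eventually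
      (eventually_lt_nhds (lt_min hx.1 hx₀.1))).exists
    exact ⟨x', hx', m, ⟨hm.trans_le (min_le_left _ _), (le_max_left _ _).trans_lt h1⟩,
      (hm.trans_le (min_le_right _ _)).le, (le_max_right _ _).trans h1.le⟩
  set P : ℝ → ℝ := fun x => ∑' i : ℕ, (g (T^[i] x₀) - g (T^[i] x)) with hP
  have hsumm : ∀ x ∈ Ioo 0 B, Summable fun i : ℕ => g (T^[i] x₀) - g (T^[i] x) := by
    intro x hx
    obtain ⟨x', hx', m, h1, h2⟩ := hex x hx
    obtain ⟨K, hK0, hK⟩ := hbound x' hx'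
    have hs : ∀ y ∈ Icc (T^[m] x') x', Summable fun i : ℕ => g (T^[i] y) - g (T^[i] x') :=
      fun y hy => Summable.of_norm_bounded ((H.summable_sub hx' m).mul_left K) (hK m y hy)
    have := (hs x₀ h2).sub (hs x ⟨h1.1.le, h1.2.le⟩)
    simpa using this
  have hlim : ∀ x ∈ Ioo 0 B, Tendsto (fun n : ℕ => birkhoffSum T g n x₀ - birkhoffSum T g n x)
      atTop (nhds (P x)) := by
    intro x hx
    have := (hsumm x hx).hasSum.tendsto_sum_nat
    simpa [birkhoffSum, Finset.sum_sub_distrib] using this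
  refine ⟨P, fun x hx => ?_, hlim, fun x hx => ?_⟩
  · obtain ⟨x', hx', m, h1, h2⟩ := hex x hx
    obtain ⟨K, hK0, hK⟩ := hbound x' hx'
    have hsub : Icc (T^[m] x') x' ⊆ Ioo 0 B := fun y hy =>
      ⟨(H.iterate_mem hx' m).1.trans_le hy.1, hy.2.trans_lt hx'.2⟩
    have hcont : ContinuousOn (fun y => ∑' i : ℕ, (g (T^[i] y) - g (T^[i] x')))
        (Icc (T^[m] x') x') := by
      refine continuousOn_tsum (fun i => ?_) ((H.summable_sub hx' m).mul_left K)
        fun i y hy => hK m y hy i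
      exact ((hgc.comp (hic i) (fun y hy => H.iterate_mem hy i)).mono hsub).sub continuousOn_const
    have heq : ∀ y ∈ Icc (T^[m] x') x', P y = P x' - ∑' i : ℕ, (g (T^[i] y) - g (T^[i] x')) := by
      intro y hy
      have hs : Summable fun i : ℕ => g (T^[i] y) - g (T^[i] x') :=
        Summable.of_norm_bounded ((H.summable_sub hx' m).mul_left K) (hK m y hy)
      rw [hP, ← (hsumm x' hx').tsum_sub hs]
      exact tsum_congr fun i => by ring
    have hc2 : ContinuousOn P (Icc (T^[m] x') x') := (continuousOn_const.sub hcont).congr heq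
    exact (hc2.continuousAt (Icc_mem_nhds h1.1 h1.2)).continuousWithinAt
  · have h1 := hlim (T x) (H.mapsTo hx)
    have h2 : Tendsto (fun n : ℕ => g (T^[n] x)) atTop (nhds 0) := by
      have h3 : Tendsto g (nhdsWithin 0 (Ioi 0)) (nhds 0) := by
        simpa using H.tendsto_deriv.log one_ne_zero
      exact h3.comp (tendsto_nhdsWithin_iff.2 ⟨H.tendsto_iterate hx,
        Eventually.of_forall fun n => (H.iterate_mem hx n).1⟩)
    have h4 := ((hlim x hx).add_const (g x)).sub h2
    rw [sub_zero] at h4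
    refine tendsto_nhds_unique h1 (h4.congr fun n => ?_)
    have h5 := birkhoffSum_succ T g n x
    have h6 := birkhoffSum_succ' T g n x
    linarith

end SmoothContraction

/-- Integration of the vector field `exp P`, invariant under `F`, to a flow curve. -/
theorem exists_flow_curve {a b : ℝ} {F G P : ℝ → ℝ} (hab : a < b)
    (hF : MapsTo F (Ioo a b) (Ioo a b)) (hG : MapsTo G (Ioo a b) (Ioo a b))
    (hFG : ∀ x ∈ Ioo a b, F (G x) = x) (hlt : ∀ x ∈ Ioo a b, x < F x)
    (hd : ∀ x ∈ Ioo a b, DifferentiableAt ℝ F x) (hd0 : ∀ x ∈ Ioo a b, 0 < deriv F x)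
    (hP : ContinuousOn P (Ioo a b))
    (hPF : ∀ x ∈ Ioo a b, P (F x) = P x + Real.log (deriv F x)) :
    ∃ (c : ℝ) (ψ : ℝ → ℝ), (∀ t, ψ t ∈ Ioo a b) ∧
      (∀ t, HasDerivAt ψ (Real.exp (P (ψ t) + c)) t) ∧ (∀ t, ψ (t + 1) = F (ψ t)) ∧
      Tendsto ψ atTop (nhds b) ∧ Tendsto ψ atBot (nhds a) ∧
      ∀ x ∈ Ioo a b, ∃ t, ψ t = x := by
  obtain ⟨x₀, hx₀⟩ := nonempty_Ioo.2 hab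
  have hE : ContinuousOn (fun x => Real.exp (-P x)) (Ioo a b) := hP.neg.rexp
  set τ : ℝ → ℝ := fun x => ∫ y in x₀..x, Real.exp (-P y) with hτ
  have hτd : ∀ x ∈ Ioo a b, HasDerivAt τ (Real.exp (-P x)) x := by
    intro x hx
    have hsub : uIcc x₀ x ⊆ Ioo a b := ordConnected_Ioo.uIcc_subset hx₀ hx
    refine intervalIntegral.integral_hasDerivAt_right ((hE.mono hsub).intervalIntegrable) ?_
      (hE.continuousAt (isOpen_Ioo.mem_nhds hx))
    exact hE.stronglyMeasurableAtFilter isOpen_Ioo x hx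
  have hτc : ContinuousOn τ (Ioo a b) := fun x hx => (hτd x hx).continuousAt.continuousWithinAt
  have hτm : StrictMonoOn τ (Ioo a b) := by
    refine strictMonoOn_of_deriv_pos (convex_Ioo a b) hτc fun x hx => ?_
    rw [interior_Ioo] at hx
    rw [(hτd x hx).deriv]
    exact Real.exp_pos _
  set w := τ (F x₀) - τ x₀ with hw
  have hw0 : 0 < w := sub_pos.2 (hτm hx₀ (hF hx₀) (hlt x₀ hx₀))
  have hconst : ∀ x ∈ Ioo a b, τ (F x) = τ x + w := by
    have hD : ∀ x ∈ Ioo a b, HasDerivWithinAt (fun x => τ (F x) - τ x) 0 (Ioo a b) x := by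
      intro x hx
      have h1 := (hτd (F x) (hF hx)).comp x (hd x hx).hasDerivAt
      have h2 := h1.sub (hτd x hx)
      have h3 : Real.exp (-P (F x)) * deriv F x - Real.exp (-P x) = 0 := by
        rw [hPF x hx, neg_add, Real.exp_add, Real.exp_neg (Real.log _), Real.exp_log (hd0 x hx),
          mul_assoc, inv_mul_cancel₀ (hd0 x hx).ne', mul_one, sub_self]
      rw [h3] at h2
      exact h2.hasDerivWithinAt
    intro x hx
    have h4 := (convex_Ioo a b).norm_image_sub_le_of_norm_hasDerivWithin_le (C := 0) hD
      (fun x _ => by simp) hx₀ hx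
    rw [zero_mul, norm_le_zero_iff, sub_eq_zero] at h4
    linarith
  have hFn : ∀ n : ℕ, F^[n] x₀ ∈ Ioo a b ∧ τ (F^[n] x₀) = τ x₀ + n * w := by
    intro n
    induction n with
    | zero => simpa using hx₀
    | succ n ih =>
      rw [Function.iterate_succ_apply']
      refine ⟨hF ih.1, ?_⟩
      rw [hconst _ ih.1, ih.2]
      push_cast
      ring
  have hGn : ∀ n : ℕ, G^[n] x₀ ∈ Ioo a b ∧ τ (G^[n] x₀) = τ x₀ - n * w := by
    intro n
    induction n with
    | zero => simpa using hx₀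
    | succ n ih =>
      rw [Function.iterate_succ_apply']
      refine ⟨hG ih.1, ?_⟩
      have := hconst _ (hG ih.1)
      rw [hFG _ ih.1, ih.2] at this
      push_cast
      linarith
  have hsurj : ∀ t : ℝ, ∃ x ∈ Ioo a b, τ x = w * t := by
    intro t
    obtain ⟨n, hn⟩ := exists_nat_gt (|t| + |τ x₀| / w)
    have h1 : |t| * w + |τ x₀| < n * w := by
      have := mul_lt_mul_of_pos_right hn hw0
      rwa [add_mul, div_mul_cancel₀ _ hw0.ne'] at this
    have h2 := neg_abs_le t
    have h3 := le_abs_self t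
    have h4 := neg_abs_le (τ x₀)
    have h5 := le_abs_self (τ x₀)
    have hle : G^[n] x₀ ≤ F^[n] x₀ := by
      rw [← hτm.le_iff_le (hGn n).1 (hFn n).1, (hGn n).2, (hFn n).2]
      nlinarith [(Nat.cast_nonneg n : (0:ℝ) ≤ n)]
    have hsub : Icc (G^[n] x₀) (F^[n] x₀) ⊆ Ioo a b := fun y hy =>
      ⟨(hGn n).1.1.trans_le hy.1, hy.2.trans_lt (hFn n).1.2⟩
    have h6 : w * t ∈ Icc (τ (G^[n] x₀)) (τ (F^[n] x₀)) := by
      rw [(hGn n).2, (hFn n).2]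
      constructor <;> nlinarith
    obtain ⟨x, hx, hxt⟩ := intermediate_value_Icc hle (hτc.mono hsub) h6
    exact ⟨x, hsub hx, hxt⟩
  choose ψ hψ hψτ using hsurj
  have hψm : StrictMono ψ := by
    intro s t hst
    rw [← hτm.lt_iff_lt (hψ s) (hψ t), hψτ, hψτ]
    exact mul_lt_mul_of_pos_left hst hw0
  have hleft : ∀ x ∈ Ioo a b, ψ (τ x / w) = x := by
    intro x hx
    refine hτm.injOn (hψ _) hx ?_
    rw [hψτ]
    field_simp
  have hrange : range ψ = Ioo a b := by
    ext x
    exact ⟨by rintro ⟨t, rfl⟩; exact hψ t, fun hx => ⟨_, hleft x hx⟩⟩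
  have hψc : Continuous ψ := by
    rw [continuous_iff_continuousAt]
    intro t
    refine continuousAt_of_monotoneOn_of_image_mem_nhds (hψm.monotone.monotoneOn univ) univ_mem ?_
    rw [image_univ, hrange]
    exact isOpen_Ioo.mem_nhds (hψ t)
  refine ⟨Real.log w, ψ, hψ, fun t => ?_, fun t => ?_, ?_, ?_, fun x hx => ⟨_, hleft x hx⟩⟩
  · have h1 : HasDerivAt (fun x => τ x / w) (Real.exp (-P (ψ t)) / w) (ψ t) :=
      (hτd _ (hψ t)).div_const w
    have h2 := h1.of_local_left_inverse hψc.continuousAt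
      (div_pos (Real.exp_pos _) hw0).ne' (Eventually.of_forall fun s => by
        rw [hψτ]
        field_simp)
    have h3 : Real.exp (P (ψ t) + Real.log w) = (Real.exp (-P (ψ t)) / w)⁻¹ := by
      rw [Real.exp_add, Real.exp_log hw0, Real.exp_neg]
      field_simp
    rwa [h3]
  · refine hτm.injOn (hψ _) (hF (hψ t)) ?_
    rw [hψτ, hconst _ (hψ t), hψτ]
    ring
  · refine tendsto_atTop_isLUB hψm.monotone ?_
    rw [hrange]
    exact isLUB_Ioo hab
  · refine tendsto_atBot_isGLB hψm.monotone ?_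
    rw [hrange]
    exact isGLB_Ioo hab

lemma ContDiffAt.iteratedDeriv_nat {h : ℝ → ℝ} {t : ℝ} {k : ℕ} (j : ℕ)
    (hd : ContDiffAt ℝ (k + j : ℕ) h t) : ContDiffAt ℝ k (iteratedDeriv j h) t := by
  induction j generalizing k with
  | zero => simpa using hd
  | succ j ih =>
    rw [iteratedDeriv_succ]
    exact (ih (k := k + 1) (by rwa [add_right_comm, add_assoc])).deriv_nat

/-- If `ψ` is a local diffeomorphism at `t` and `G ∘ ψ` is smooth there, so is `G` at `ψ t`. -/
lemma contDiffAt_of_eventually_comp {ψ G h : ℝ → ℝ} {t : ℝ} (hψ : ContDiffAt ℝ ∞ ψ t)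
    (h0 : deriv ψ t ≠ 0) (hG : ∀ᶠ s in nhds t, G (ψ s) = h s) (hh : ContDiffAt ℝ ∞ h t) :
    ContDiffAt ℝ ∞ G (ψ t) := by
  have hd : HasFDerivAt ψ ((ContinuousLinearEquiv.unitsEquivAut ℝ (Units.mk0 _ h0) :
      ℝ ≃L[ℝ] ℝ) : ℝ →L[ℝ] ℝ) t := by
    have := (hψ.differentiableAt (by simp)).hasDerivAt.hasFDerivAt
    refine this.congr_fderiv ?_
    ext
    simp
  have h1 := hψ.to_localInverse hd (by simp)
  set τ := hψ.localInverse hd (by simp) with hτ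
  have h2 : τ (ψ t) = t := hψ.localInverse_apply_image hd (by simp)
  have h3 : ∀ᶠ y in nhds (ψ t), ψ (τ y) = y := by
    exact (hψ.toOpenPartialHomeomorph ψ hd (by simp)).eventually_right_inverse'
      (hψ.mem_toOpenPartialHomeomorph_source hd (by simp))
  have h4 : Tendsto τ (nhds (ψ t)) (nhds t) := by
    have := h1.continuousAt.tendsto
    rwa [h2] at this
  have h5 : (fun y => h (τ y)) =ᶠ[nhds (ψ t)] G := by
    filter_upwards [h3, h4.eventually hG] with y hy hy'
    rw [← hy', hy]
  refine ContDiffAt.congr_of_eventuallyEq ?_ h5.symm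
  exact ContDiffAt.comp (ψ t) (by rw [h2]; exact hh) h1

/-- Closeness to the identity of the unit shift along a slow curve. -/
theorem exists_shift_bound (r : ℕ) {K : ℝ} (hK : 1 ≤ K) : ∃ C : ℝ, 1 ≤ C ∧
    ∀ (ψ G : ℝ → ℝ) (s v θ t : ℝ), |s| ≤ 1 → ContDiff ℝ ∞ ψ → (∀ τ, 0 < deriv ψ τ) →
      (∀ᶠ τ in nhds t, G (ψ τ) = ψ (τ + s)) → 0 < v → 0 < θ →
      (∀ τ ∈ Icc (t - 1) (t + 1), v / K ≤ deriv ψ τ ∧ JetBound r θ (K * v) (deriv ψ) τ) →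
      ∀ j ≤ r, |iteratedDeriv j (fun y => G y - y) (ψ t)| ≤ C * (v * (θ / v) ^ j) := by
  obtain ⟨K', hK', hinv⟩ := JetBound.inv r K hK
  refine ⟨K * (2 ^ r * K') ^ r, ?_, ?_⟩
  · exact one_le_mul_of_one_le_of_one_le hK
      (one_le_pow₀ (one_le_mul_of_one_le_of_one_le (one_le_pow₀ (by norm_num)) hK'))
  intro ψ G s v θ t hs hψ hψ0 hG hv hθ hwin
  have hdψ : ContDiff ℝ ∞ (deriv ψ) := hψ.deriv' 
  have hGs : ∀ᶠ τ in nhds t, ContDiffAt ℝ ∞ (fun y => G y - y) (ψ τ) := by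
    filter_upwards [hG.eventually_nhds] with τ hτ
    exact (contDiffAt_of_eventually_comp hψ.contDiffAt (hψ0 τ).ne' hτ
      (by fun_prop : ContDiff ℝ ∞ fun τ => ψ (τ + s)).contDiffAt).sub contDiffAt_id
  set Δ : ℝ → ℝ := fun y => G y - y with hΔ
  have htmem : t ∈ Icc (t - 1) (t + 1) := ⟨by linarith, by linarith⟩
  have hq := hwin t htmem
  have hqc : ∀ l : ℕ, ContDiffAt ℝ l (deriv ψ) t := fun l => hdψ.contDiffAt.of_le (natCast_le_infty _)
  have hqinv : JetBound r θ (K' / v) (fun x => (deriv ψ x)⁻¹) t :=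
    hinv θ v _ t hθ.le hv (hqc r) hq.1 hq.2
  have hstep : ∀ j, (fun τ => iteratedDeriv (j + 1) Δ (ψ τ)) =ᶠ[nhds t]
      fun τ => deriv (fun τ => iteratedDeriv j Δ (ψ τ)) τ * (deriv ψ τ)⁻¹ := by
    intro j
    filter_upwards [hGs] with τ hτ
    have h1 : DifferentiableAt ℝ (iteratedDeriv j Δ) (ψ τ) :=
      ((hτ.of_le (natCast_le_infty (1 + j))).iteratedDeriv_nat j).differentiableAt (by simp)
    have h2 := h1.hasDerivAt.comp τ (hψ.differentiable (by simp) τ).hasDerivAt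
    have h3 : deriv (fun τ => iteratedDeriv j Δ (ψ τ)) τ =
      deriv (iteratedDeriv j Δ) (ψ τ) * deriv ψ τ := h2.deriv
    rw [h3, iteratedDeriv_succ]
    field_simp [(hψ0 τ).ne']
  have key : ∀ j ≤ r, ContDiffAt ℝ ∞ (fun τ => iteratedDeriv j Δ (ψ τ)) t ∧
      JetBound (r - j) θ (K * (2 ^ r * K') ^ j * (v * (θ / v) ^ j))
        (fun τ => iteratedDeriv j Δ (ψ τ)) t := by
    intro j
    induction j with
    | zero =>
      intro _
      have e0 : (fun τ => ψ (τ + s) - ψ τ) =ᶠ[nhds t] fun τ => iteratedDeriv 0 Δ (ψ τ) := by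
        filter_upwards [hG] with τ hτ
        simp [hΔ, hτ]
      have hc : ContDiff ℝ ∞ fun τ => ψ (τ + s) - ψ τ := by fun_prop
      refine ⟨hc.contDiffAt.congr_of_eventuallyEq e0.symm, JetBound.congr ?_ e0⟩
      intro i hi
      have h1 : iteratedDeriv i (fun τ => ψ (τ + s) - ψ τ) t =
          iteratedDeriv i ψ (t + s) - iteratedDeriv i ψ t := by
        have := iteratedDeriv_sub (n := i) (f := fun τ => ψ (τ + s)) (g := ψ) (x := t)
          ((by fun_prop : ContDiff ℝ ∞ fun τ => ψ (τ + s)).contDiffAt.of_le (natCast_le_infty _))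
          (hψ.contDiffAt.of_le (natCast_le_infty _))
        rw [iteratedDeriv_comp_add_const] at this
        exact this
      rw [h1]
      have h2 := (convex_Icc (t - 1) (t + 1)).norm_image_sub_le_of_norm_hasDerivWithin_le
        (f := iteratedDeriv i ψ) (f' := iteratedDeriv i (deriv ψ)) (C := K * v * θ ^ i)
        (fun x hx => by
          rw [← iteratedDeriv_succ', iteratedDeriv_succ]
          exact (((hψ.of_le (natCast_le_infty (i + 1))).differentiable_iteratedDeriv i
            (by norm_cast; omega)) x).hasDerivAt.hasDerivWithinAt)
        (fun x hx => (hwin x hx).2 i (by omega)) htmem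
        (show t + s ∈ Icc (t - 1) (t + 1) from
          ⟨by linarith [(abs_le.1 hs).1], by linarith [(abs_le.1 hs).2]⟩)
      rw [Real.norm_eq_abs, Real.norm_eq_abs, add_sub_cancel_left] at h2
      have h3 : 0 ≤ K * v * θ ^ i := by positivity
      calc _ ≤ _ := h2
        _ ≤ K * v * θ ^ i * 1 := mul_le_mul_of_nonneg_left hs h3
        _ = _ := by simp
    | succ j ih =>
      intro hj
      obtain ⟨hc, hJ⟩ := ih (by omega)
      have hrj : r - j = r - (j + 1) + 1 := by omega
      rw [hrj] at hJ
      have hJ' := (JetBound.succ_iff.1 hJ).2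
      have hcd : ∀ l : ℕ, ContDiffAt ℝ l (deriv fun τ => iteratedDeriv j Δ (ψ τ)) t := fun l =>
        (hc.of_le (natCast_le_infty (l + 1))).deriv_nat
      have hic : ContDiffAt ℝ ∞ (fun x => (deriv ψ x)⁻¹) t := hdψ.contDiffAt.inv (hψ0 t).ne'
      have hm := JetBound.mul hθ.le (hcd _) (hic.of_le (natCast_le_infty _)) hJ'
        (hqinv.mono_order (show r - (j + 1) ≤ r by omega))
      refine ⟨?_, (hm.congr (hstep j).symm).mono hθ.le ?_⟩
      · refine ContDiffAt.congr_of_eventuallyEq ?_ (hstep j)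
        exact (contDiffAt_infty.2 hcd).mul hic
      · have h2 : (2:ℝ) ^ (r - (j + 1)) ≤ 2 ^ r := pow_le_pow_right₀ (by norm_num) (by omega)
        have h3 : 0 ≤ K * (2 ^ r * K') ^ j * (v * (θ / v) ^ j) * θ * (K' / v) := by positivity
        calc _ ≤ 2 ^ r * (K * (2 ^ r * K') ^ j * (v * (θ / v) ^ j) * θ * (K' / v)) :=
              mul_le_mul_of_nonneg_right h2 h3
          _ = _ := by rw [pow_succ, pow_succ]; field_simp
  intro j hj
  have h1 := ((key j hj).2).zero_le
  refine h1.trans (mul_le_mul_of_nonneg_right ?_ (by positivity))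
  refine mul_le_mul_of_nonneg_left (pow_le_pow_right₀ ?_ hj) (by linarith)
  exact one_le_mul_of_one_le_of_one_le (one_le_pow₀ (by norm_num)) hK'

namespace Real.smoothTransition

lemma iteratedDeriv_eq_zero {i : ℕ} {s : ℝ} (hs : s < 0 ∨ 1 < s) :
    iteratedDeriv (i + 1) smoothTransition s = 0 := by
  have : ∃ c : ℝ, smoothTransition =ᶠ[nhds s] fun _ => c := by
    rcases hs with hs | hs
    · exact ⟨0, by filter_upwards [Iio_mem_nhds hs] with x hx using zero_of_nonpos (le_of_lt hx)⟩
    · exact ⟨1, by filter_upwards [Ioi_mem_nhds hs] with x hx using one_of_one_le (le_of_lt hx)⟩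
  obtain ⟨c, hc⟩ := this
  rw [hc.iteratedDeriv_eq, iteratedDeriv_const]
  simp

lemma exists_iteratedDeriv_bound (k : ℕ) : ∃ B : ℝ, 1 ≤ B ∧ ∀ i ≤ k, ∀ s,
    |iteratedDeriv i smoothTransition s| ≤ B := by
  induction k with
  | zero =>
    refine ⟨1, le_rfl, fun i hi s => ?_⟩
    obtain rfl : i = 0 := by omega
    rw [iteratedDeriv_zero, abs_of_nonneg (smoothTransition.nonneg s)]
    exact smoothTransition.le_one s
  | succ k ih =>
    obtain ⟨B, hB, h⟩ := ih
    have hc : ContinuousOn (iteratedDeriv (k + 1) smoothTransition) (Icc 0 1) :=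
      ((smoothTransition.contDiff (n := ⊤)).continuous_iteratedDeriv (k + 1)
        (by exact_mod_cast le_top)).continuousOn
    obtain ⟨B', hB'⟩ := isCompact_Icc.exists_bound_of_continuousOn hc
    refine ⟨max B B', le_max_of_le_left hB, fun i hi s => ?_⟩
    rcases Nat.lt_or_ge k i with hik | hik
    · obtain rfl : i = k + 1 := by omega
      by_cases hs : s ∈ Icc (0 : ℝ) 1
      · exact (hB' s hs).trans (le_max_right _ _)
      · rw [iteratedDeriv_eq_zero (by by_contra! h; exact hs ⟨h.1, h.2⟩), abs_zero]
        exact zero_le_one.trans (le_max_of_le_left hB)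
    · exact (h i hik s).trans (le_max_left _ _)

end Real.smoothTransition

/-- The primitive of the smooth transition function. -/
def smoothRamp (s : ℝ) : ℝ := ∫ x in (0 : ℝ)..s, smoothTransition x

namespace smoothRamp

lemma hasDerivAt (s : ℝ) : HasDerivAt smoothRamp (smoothTransition s) s :=
  intervalIntegral.integral_hasDerivAt_right
    (smoothTransition.continuous.intervalIntegrable _ _)
    (smoothTransition.continuous.stronglyMeasurableAtFilter _ _) smoothTransition.continuous.continuousAt

lemma deriv_eq : deriv smoothRamp = smoothTransition := funext fun s => (hasDerivAt s).deriv

lemma contDiff : ContDiff ℝ ∞ smoothRamp := by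
  rw [contDiff_infty_iff_deriv, deriv_eq]
  exact ⟨fun s => (hasDerivAt s).differentiableAt, smoothTransition.contDiff⟩

lemma of_nonpos {s : ℝ} (hs : s ≤ 0) : smoothRamp s = 0 := by
  rw [smoothRamp, intervalIntegral.integral_congr (g := fun _ => 0)]
  · simp
  · intro x hx
    rw [uIcc_of_ge hs] at hx
    exact smoothTransition.zero_of_nonpos hx.2

lemma of_one_le {s : ℝ} (hs : 1 ≤ s) : smoothRamp s = smoothRamp 1 + (s - 1) := by
  have h := intervalIntegral.integral_add_adjacent_intervals (μ := MeasureTheory.volume)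
    (smoothTransition.continuous.intervalIntegrable 0 1)
    (smoothTransition.continuous.intervalIntegrable 1 s)
  rw [smoothRamp, ← h, smoothRamp]
  congr 1
  rw [intervalIntegral.integral_congr (g := fun _ => 1)]
  · simp
  · intro x hx
    rw [uIcc_of_le hs] at hx
    exact smoothTransition.one_of_one_le hx.1

lemma monotone : Monotone smoothRamp :=
  monotone_of_deriv_nonneg (fun s => (hasDerivAt s).differentiableAt)
    fun s => by rw [deriv_eq]; exact smoothTransition.nonneg s

lemma nonneg (s : ℝ) : 0 ≤ smoothRamp s := by
  rcases le_total 0 s with h | h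
  · exact (of_nonpos le_rfl).symm.le.trans (monotone h)
  · rw [of_nonpos h]

lemma one_le_one : smoothRamp 1 ≤ 1 := by
  have h : Monotone fun s => s - smoothRamp s :=
    monotone_of_deriv_nonneg (by
      exact fun s => ((hasDerivAt_id s).sub (hasDerivAt s)).differentiableAt)
      fun s => by
        have : deriv (fun s => s - smoothRamp s) s = 1 - smoothTransition s :=
          ((hasDerivAt_id s).sub (hasDerivAt s)).deriv
        rw [this]
        linarith [smoothTransition.le_one s]
  have := h zero_le_one
  simp only [of_nonpos le_rfl] at this
  linarith

end smoothRamp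

/-- A smooth profile growing from `1` to `M` at unit speed, with scale-invariant jets. -/
theorem exists_growth_profile (k : ℕ) : ∃ C : ℝ, 1 ≤ C ∧ ∀ M : ℝ, 2 ≤ M →
    ∃ (S : ℝ → ℝ) (m : ℝ), 0 ≤ m ∧ ContDiff ℝ ∞ S ∧ (∀ s ≤ 0, S s = 1) ∧ (∀ s ≥ m, S s = M) ∧
      (∀ s, 1 ≤ S s) ∧ (∀ s, 0 ≤ deriv S s ∧ deriv S s ≤ 1) ∧
      (∀ s, JetBound k (S s)⁻¹ (C * S s) S s) ∧ ∀ s ∈ Icc 0 m, 1 + s ≤ 3 * S s := by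
  obtain ⟨B, hB, hBd⟩ := smoothTransition.exists_iteratedDeriv_bound k
  refine ⟨2 * 3 ^ k * B, one_le_mul_of_one_le_of_one_le (one_le_mul_of_one_le_of_one_le
    (by norm_num) (one_le_pow₀ (by norm_num))) hB, fun M hM => ?_⟩
  set c := smoothRamp 1 with hc
  have hc0 : 0 ≤ c := smoothRamp.nonneg 1
  have hc1 : c ≤ 1 := smoothRamp.one_le_one
  set X := (M - c) / (2 - c) with hX
  have hX1 : 1 ≤ X := by rw [hX, le_div_iff₀ (by linarith)]; linarith
  have hX0 : 0 < X := by linarith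
  have hMX : M = (2 - c) * X + c := by rw [hX]; field_simp [(by linarith : (2 - c) ≠ 0)]; ring
  set S : ℝ → ℝ := fun s => 1 + smoothRamp s - X * smoothRamp (X⁻¹ * (s + -X)) with hS
  have hSd : ∀ s, HasDerivAt S (smoothTransition s - smoothTransition (X⁻¹ * (s + -X))) s := by
    intro s
    have h1 := (smoothRamp.hasDerivAt (X⁻¹ * (s + -X))).comp s
      (((hasDerivAt_id s).add_const (-X)).const_mul X⁻¹)
    refine (((smoothRamp.hasDerivAt s).const_add 1).sub (h1.const_mul X)).congr_deriv ?_
    field_simp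
  have hsm : ContDiff ℝ ∞ S := by
    have := smoothRamp.contDiff
    fun_prop
  have hdS : deriv S = fun s => smoothTransition s - smoothTransition (X⁻¹ * (s + -X)) :=
    funext fun s => (hSd s).deriv
  have hd01 : ∀ s, 0 ≤ deriv S s ∧ deriv S s ≤ 1 := by
    intro s
    rw [hdS]
    refine ⟨?_, ?_⟩
    · rw [sub_nonneg]
      rcases le_total s 0 with h | h
      · rw [smoothTransition.zero_of_nonpos (x := X⁻¹ * (s + -X))
          (mul_nonpos_of_nonneg_of_nonpos (by positivity) (by linarith))]
        exact smoothTransition.nonneg s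
      · refine smoothTransition.monotone ?_
        rw [inv_mul_le_iff₀ hX0]
        nlinarith
    · linarith [smoothTransition.le_one s, smoothTransition.nonneg (X⁻¹ * (s + -X))]
  have hmono : Monotone S := monotone_of_deriv_nonneg (hsm.differentiable (by simp)) fun s => (hd01 s).1
  have hS0 : ∀ s ≤ 0, S s = 1 := by
    intro s hs
    simp only [hS]
    rw [smoothRamp.of_nonpos hs, smoothRamp.of_nonpos
      (mul_nonpos_of_nonneg_of_nonpos (by positivity) (by linarith))]
    simp
  have hSm : ∀ s ≥ 2 * X, S s = M := by
    intro s hs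
    simp only [hS]
    rw [smoothRamp.of_one_le (by linarith), smoothRamp.of_one_le (s := X⁻¹ * (s + -X))
      (by rw [le_inv_mul_iff₀ hX0]; linarith), ← hc, hMX]
    field_simp
    ring
  have hS1 : ∀ s, 1 ≤ S s := fun s => by
    rcases le_total s 0 with h | h
    · exact (hS0 s h).ge
    · exact (hS0 0 le_rfl).ge.trans (hmono h)
  have hSX : ∀ s ≤ X, S s = 1 + smoothRamp s := by
    intro s hs
    simp only [hS]
    rw [smoothRamp.of_nonpos (s := X⁻¹ * (s + -X))
      (mul_nonpos_of_nonneg_of_nonpos (by positivity) (by linarith))]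
    simp
  have hup : ∀ s ≥ 0, S s ≤ 1 + s := by
    intro s hs
    have h : Monotone fun s => s - S s :=
      monotone_of_deriv_nonneg (by
        exact fun s => ((hasDerivAt_id s).sub (hSd s)).differentiableAt)
        fun s => by
          have : deriv (fun s => s - S s) s = 1 - deriv S s :=
            ((hasDerivAt_id s).sub (hSd s).differentiableAt.hasDerivAt).deriv
          rw [this]
          linarith [(hd01 s).2]
    have := h hs
    simp only [hS0 0 le_rfl] at this
    linarith
  refine ⟨S, 2 * X, by positivity, hsm, hS0, hSm, hS1, hd01, ?_, ?_⟩
  · intro s j hj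
    have hSs : 0 < S s := by linarith [hS1 s]
    have h3k : (1 : ℝ) ≤ 3 ^ k := one_le_pow₀ (by norm_num)
    rcases j with _ | j
    · rw [iteratedDeriv_zero, abs_of_pos hSs, pow_zero, mul_one]
      nlinarith [mul_le_mul h3k hB (by norm_num) (by positivity)]
    · have hbr : ∀ y, 0 < y → S s ≤ 3 * y → y⁻¹ ^ j ≤ 3 ^ k * S s * (S s)⁻¹ ^ (j + 1) := by
        intro y hy hle
        rw [pow_succ, mul_assoc, mul_comm (_ ^ j), ← mul_assoc (S s), mul_inv_cancel₀ hSs.ne',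
          one_mul]
        calc y⁻¹ ^ j ≤ (3 * (S s)⁻¹) ^ j := by
              refine pow_le_pow_left₀ (by positivity) ?_ j
              rw [← div_eq_mul_inv, le_div_iff₀ hSs, inv_mul_le_iff₀ hy]
              linarith
          _ = 3 ^ j * (S s)⁻¹ ^ j := mul_pow ..
          _ ≤ _ := mul_le_mul_of_nonneg_right (pow_le_pow_right₀ (by norm_num) (by omega))
            (by positivity)
      rcases Nat.eq_zero_or_pos j with rfl | hj0
      · rw [zero_add, iteratedDeriv_one, abs_of_nonneg (hd01 s).1]
        have h1 : 2 * 3 ^ k * B * S s * (S s)⁻¹ ^ 1 = 2 * 3 ^ k * B := by field_simp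
        rw [h1]
        nlinarith [(hd01 s).2, mul_le_mul h3k hB (by norm_num) (by positivity)]
      · obtain ⟨i, rfl⟩ : ∃ i, j = i + 1 := ⟨j - 1, by omega⟩
        have e1 : iteratedDeriv (i + 1) (fun s => smoothTransition (X⁻¹ * (s + -X))) s =
            X⁻¹ ^ (i + 1) * iteratedDeriv (i + 1) smoothTransition (X⁻¹ * (s + -X)) := by
          have h1 := congrFun (iteratedDeriv_comp_add_const (i + 1)
            (fun s => smoothTransition (X⁻¹ * s)) (-X)) s
          have h2 := iteratedDeriv_comp_const_mul (n := i + 1)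
            (smoothTransition.contDiff (n := ⊤) |>.of_le (by exact_mod_cast le_top)) X⁻¹
          rw [h1, h2]
        have e2 : iteratedDeriv (i + 1 + 1) S s = iteratedDeriv (i + 1) smoothTransition s -
            X⁻¹ ^ (i + 1) * iteratedDeriv (i + 1) smoothTransition (X⁻¹ * (s + -X)) := by
          rw [iteratedDeriv_succ', hdS, ← e1]
          refine iteratedDeriv_fun_sub ?_ ?_
          · exact smoothTransition.contDiffAt.of_le (natCast_le_infty _)
          · have : ContDiff ℝ ∞ fun s => smoothTransition (X⁻¹ * (s + -X)) :=
              smoothTransition.contDiff.comp (by fun_prop)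
            exact this.contDiffAt.of_le (natCast_le_infty _)
        set R := 3 ^ k * S s * (S s)⁻¹ ^ (i + 1 + 1) with hR
        have hR0 : 0 ≤ R := by positivity
        have b1 : |iteratedDeriv (i + 1) smoothTransition s| ≤ B * R := by
          by_cases h : s ∈ Icc (0 : ℝ) 1
          · have h1 := hbr 1 one_pos (by linarith [hup s h.1, h.2])
            rw [inv_one, one_pow] at h1
            exact (hBd (i + 1) (by omega) s).trans (le_mul_of_one_le_right (by linarith) h1)
          · rw [smoothTransition.iteratedDeriv_eq_zero
              (by by_contra! h'; exact h ⟨h'.1, h'.2⟩), abs_zero]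
            positivity
        have b2 : |X⁻¹ ^ (i + 1) * iteratedDeriv (i + 1) smoothTransition (X⁻¹ * (s + -X))| ≤
            B * R := by
          rw [abs_mul, abs_of_pos (by positivity : 0 < X⁻¹ ^ (i + 1)), mul_comm]
          by_cases h : X⁻¹ * (s + -X) ∈ Icc (0 : ℝ) 1
          · have h1 : 0 ≤ s + -X := by
              have := mul_nonneg hX0.le h.1
              rwa [mul_inv_cancel_left₀ hX0.ne'] at this
            have h2 : s + -X ≤ X * 1 := (inv_mul_le_iff₀ hX0).1 h.2
            exact mul_le_mul (hBd (i + 1) (by omega) _)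
              (hbr X hX0 (by linarith [hup s (by linarith)])) (by positivity) (by linarith)
          · rw [smoothTransition.iteratedDeriv_eq_zero
              (by by_contra! h'; exact h ⟨h'.1, h'.2⟩), abs_zero, zero_mul]
            positivity
        rw [e2]
        calc _ ≤ B * R + B * R := (abs_sub _ _).trans (add_le_add b1 b2)
          _ = _ := by rw [hR]; ring
  · intro s hs
    rcases le_total s X with h | h
    · rcases le_total s 1 with h1 | h1
      · linarith [hS1 s]
      · rw [hSX s h, smoothRamp.of_one_le h1]
        linarith
    · have h1 := hmono h
      rw [hSX X le_rfl, smoothRamp.of_one_le hX1] at h1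
      linarith [hs.2]

/-- A growth profile whose logarithm has scale-invariant derivatives. -/
theorem exists_log_growth_profile (k : ℕ) : ∃ C : ℝ, 1 ≤ C ∧ ∀ M : ℝ, 2 ≤ M →
    ∃ (S : ℝ → ℝ) (m : ℝ), 0 ≤ m ∧ ContDiff ℝ ∞ S ∧ (∀ s ≤ 0, S s = 1) ∧ (∀ s ≥ m, S s = M) ∧
      (∀ s, 1 ≤ S s) ∧ (∀ s, 0 ≤ deriv S s ∧ deriv S s ≤ 1) ∧
      (∀ s j, 1 ≤ j → j ≤ k → |iteratedDeriv j (fun x => Real.log (S x)) s| ≤ C * (S s)⁻¹ ^ j) ∧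
      ∀ s ∈ Icc 0 m, 1 + s ≤ 3 * S s := by
  obtain ⟨C, hC, H⟩ := exists_growth_profile k
  obtain ⟨K, hK, hinv⟩ := JetBound.inv k C hC
  refine ⟨2 ^ k * (C * K), one_le_mul_of_one_le_of_one_le (one_le_pow₀ (by norm_num))
    (one_le_mul_of_one_le_of_one_le hC hK), fun M hM => ?_⟩
  obtain ⟨S, m, hm, hsm, h0, hM', h1, hd, hJ, hlow⟩ := H M hM
  refine ⟨S, m, hm, hsm, h0, hM', h1, hd, fun s j hj hjk => ?_, hlow⟩
  obtain ⟨i, rfl⟩ : ∃ i, j = i + 1 := ⟨j - 1, by omega⟩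
  obtain ⟨l, rfl⟩ : ∃ l, k = l + 1 := ⟨k - 1, by omega⟩
  have hpos : ∀ x, 0 < S x := fun x => zero_lt_one.trans_le (h1 x)
  have hSs := hpos s
  have e1 : deriv (fun x => Real.log (S x)) = fun x => deriv S x * (S x)⁻¹ := funext fun x => by
    rw [deriv.log (hsm.differentiable (by simp) x) (hpos x).ne', div_eq_mul_inv]
  have j1 := (JetBound.succ_iff.1 (hJ s)).2
  have j2 : JetBound (l + 1) (S s)⁻¹ (K / S s) (fun x => (S x)⁻¹) s :=
    hinv _ _ S s (by positivity) hSs (hsm.contDiffAt.of_le (natCast_le_infty _))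
      (div_le_self hSs.le hC) (hJ s)
  have c1 : ContDiffAt ℝ l (deriv S) s :=
    ContDiffAt.deriv_nat (hsm.contDiffAt.of_le (natCast_le_infty _))
  have c2 : ContDiffAt ℝ l (fun x => (S x)⁻¹) s :=
    (hsm.contDiffAt.of_le (natCast_le_infty _)).inv hSs.ne'
  have j3 := JetBound.mul (by positivity) c1 c2 j1 (j2.mono_order (Nat.le_succ l)) i (by omega)
  rw [iteratedDeriv_succ', e1]
  have hp : (2 : ℝ) ^ l ≤ 2 ^ (l + 1) := pow_le_pow_right₀ (by norm_num) (by omega)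
  calc _ ≤ _ := j3
    _ = 2 ^ l * ((C * K) * (S s)⁻¹ ^ (i + 1)) := by
      rw [mul_inv_cancel_right₀ hSs.ne']
      ring
    _ ≤ 2 ^ (l + 1) * ((C * K) * (S s)⁻¹ ^ (i + 1)) :=
      mul_le_mul_of_nonneg_right hp (by positivity)
    _ = _ := by ring

/-- On the unit window around `t`, the speed `q` is comparable to some `v`, varies at some scale
`θ`, and the resulting unit shift is `ε`-close to the identity up to order `r`. -/
def SlowAt (r : ℕ) (K ε : ℝ) (q : ℝ → ℝ) (t : ℝ) : Prop :=
  ∃ v θ : ℝ, 0 < v ∧ 0 < θ ∧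
    (∀ τ ∈ Icc (t - 1) (t + 1), v / K ≤ q τ ∧ JetBound r θ (K * v) q τ) ∧
    ∀ j ≤ r, v * (θ / v) ^ j ≤ ε

lemma SlowAt.congr {r : ℕ} {K ε : ℝ} {q q' : ℝ → ℝ} {t : ℝ} {V : Set ℝ} (H : SlowAt r K ε q t)
    (hV : IsOpen V) (hsub : Icc (t - 1) (t + 1) ⊆ V) (hq : EqOn q q' V) : SlowAt r K ε q' t := by
  obtain ⟨v, θ, hv, hθ, h, h'⟩ := H
  refine ⟨v, θ, hv, hθ, fun τ hτ => ?_, h'⟩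
  rw [← hq (hsub hτ)]
  exact ⟨(h τ hτ).1, (h τ hτ).2.congr (hq.eventuallyEq_of_mem (hV.mem_nhds (hsub hτ)))⟩

lemma SlowAt.mono {r : ℕ} {K K' ε : ℝ} {q : ℝ → ℝ} {t : ℝ} (H : SlowAt r K ε q t)
    (hK : 0 < K) (hKK : K ≤ K') : SlowAt r K' ε q t := by
  obtain ⟨v, θ, hv, hθ, h, h'⟩ := H
  refine ⟨v, θ, hv, hθ, fun τ hτ => ⟨le_trans ?_ (h τ hτ).1, (h τ hτ).2.mono hθ.le ?_⟩, h'⟩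
  · exact div_le_div_of_nonneg_left hv.le hK hKK
  · exact mul_le_mul_of_nonneg_right hKK hv.le

lemma SlowAt.comp_add_const {r : ℕ} {K ε : ℝ} {q : ℝ → ℝ} {t s : ℝ} (H : SlowAt r K ε q (t + s)) :
    SlowAt r K ε (fun x => q (x + s)) t := by
  obtain ⟨v, θ, hv, hθ, h, h'⟩ := H
  refine ⟨v, θ, hv, hθ, fun τ hτ => ?_, h'⟩
  have := h (τ + s) ⟨by linarith [hτ.1], by linarith [hτ.2]⟩
  exact ⟨this.1, this.2.comp_add_const⟩

lemma SlowAt.comp_neg {r : ℕ} {K ε : ℝ} {q : ℝ → ℝ} {t : ℝ} (H : SlowAt r K ε q (-t)) :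
    SlowAt r K ε (fun x => q (-x)) t := by
  obtain ⟨v, θ, hv, hθ, h, h'⟩ := H
  refine ⟨v, θ, hv, hθ, fun τ hτ => ?_, h'⟩
  obtain ⟨h1, h2⟩ := h (-τ) ⟨by linarith [hτ.2], by linarith [hτ.1]⟩
  refine ⟨h1, fun j hj => ?_⟩
  rw [iteratedDeriv_comp_neg, smul_eq_mul, abs_mul, abs_pow, abs_neg, abs_one, one_pow, one_mul]
  exact h2 j hj

/-- The loss of regularity exponent used at order `r`. -/
def lossExp (r : ℕ) : ℝ := 1 / (4 * (r + 1))

lemma lossExp_pos (r : ℕ) : 0 < lossExp r := by unfold lossExp; positivity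

lemma lossExp_le (r : ℕ) : lossExp r ≤ 1 / 4 := by
  unfold lossExp
  exact one_div_le_one_div_of_le (by norm_num) (by linarith [Nat.cast_nonneg (α := ℝ) r])

lemma lossExp_mul_le {r j : ℕ} (hj : j ≤ r) : lossExp r * j ≤ 1 / 4 := by
  unfold lossExp
  have : (j : ℝ) ≤ r := by exact_mod_cast hj
  rw [div_mul_eq_mul_div, div_le_div_iff₀ (by positivity) (by norm_num)]
  linarith

lemma mul_rpow_div_pow_le {r j : ℕ} {v ε : ℝ} (hj : j ≤ r) (hv : 0 < v) (hv1 : v ≤ 1)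
    (hε : 0 ≤ ε) (hve : v ≤ ε ^ 2) : v * (v ^ (1 - 2 * lossExp r) / v) ^ j ≤ ε := by
  have h1 : v * (v ^ (1 - 2 * lossExp r) / v) ^ j = v ^ (1 - 2 * (lossExp r * j)) := by
    have h2 : v ^ (1 - 2 * lossExp r) / v = v ^ (-(2 * lossExp r)) := by
      rw [← Real.rpow_sub_one hv.ne']
      ring_nf
    rw [h2, ← Real.rpow_natCast, ← Real.rpow_mul hv.le, show 1 - 2 * (lossExp r * j) =
      1 + -(2 * lossExp r) * j by ring, Real.rpow_add hv, Real.rpow_one]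
  rw [h1]
  calc v ^ (1 - 2 * (lossExp r * j)) ≤ v ^ (1 / 2 : ℝ) :=
        Real.rpow_le_rpow_of_exponent_ge hv hv1 (by linarith [lossExp_mul_le hj])
    _ = Real.sqrt v := (Real.sqrt_eq_rpow v).symm
    _ ≤ Real.sqrt (ε ^ 2) := Real.sqrt_le_sqrt hve
    _ = ε := Real.sqrt_sq hε

/-- Interpolating a logarithmic speed `U` near `log δ` with a slowly decreasing profile. -/
theorem exists_braking_log (r : ℕ) {C : ℝ} (hC : 1 ≤ C) : ∃ K : ℝ, 1 ≤ K ∧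
    ∀ (δ θ θ' p M t₁ ta : ℝ) (U : ℝ → ℝ), 0 < δ → 0 ≤ θ → θ ≤ θ' → 0 < θ' → 0 ≤ p → p ≤ 2 →
      2 ≤ M → ContDiff ℝ ∞ U → t₁ + 1 / θ' ≤ ta →
      (∀ t ∈ Icc (t₁ - 2) ta, |U t - Real.log δ| ≤ Real.log C ∧
        ∀ j, 1 ≤ j → j ≤ r → |iteratedDeriv j U t| ≤ C * θ ^ j) →
      ∃ (L ρ : ℝ → ℝ) (tA : ℝ), t₁ + 1 / θ' ≤ tA ∧ ContDiff ℝ ∞ L ∧ (∀ t ≤ t₁, L t = U t) ∧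
        (∀ t ≥ tA, L t = Real.log δ - p * Real.log M) ∧ (∀ t, 1 ≤ ρ t) ∧
        (∀ t τ, |ρ t - ρ τ| ≤ θ' * |t - τ|) ∧
        (∀ t ≥ t₁ - 2, |L t - (Real.log δ - p * Real.log (ρ t))| ≤ Real.log C ∧
          ∀ j, 1 ≤ j → j ≤ r → |iteratedDeriv j L t| ≤ K * (θ' / ρ t) ^ j) ∧
        (∀ t ≤ t₁ + 1 / θ', ρ t = 1) ∧
        ∀ t ∈ Icc (t₁ + 1 / θ') tA, L t = Real.log δ - p * Real.log (ρ t) ∧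
          1 + θ' * (t - (t₁ + 1 / θ')) ≤ 3 * ρ t := by
  obtain ⟨CS, hCS, HS⟩ := exists_log_growth_profile r
  obtain ⟨B, hB, hBd⟩ := smoothTransition.exists_iteratedDeriv_bound r
  have hlogC : 0 ≤ Real.log C := Real.log_nonneg hC
  have hlogC' : Real.log C ≤ C := by linarith [Real.log_le_sub_one_of_pos (by linarith : 0 < C)]
  refine ⟨2 ^ r * ((1 + B) * C) + 2 * CS, ?_, ?_⟩
  · have : 0 ≤ 2 ^ r * ((1 + B) * C) := by positivity
    linarith
  intro δ θ θ' p M t₁ ta U hδ hθ hθθ' hθ' hp0 hp hM hU hta hUb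
  obtain ⟨S, m, hm, hSsm, hS0, hSm, hS1, hSd, hSj, hSlow⟩ := HS M hM
  set t₂ := t₁ + 1 / θ' with ht₂
  have ht₁₂ : t₁ < t₂ := by rw [ht₂]; linarith [one_div_pos.2 hθ']
  set F : ℝ → ℝ := fun t => (1 - smoothTransition (θ' * (t + -t₁))) * (U t - Real.log δ) with hF
  set G : ℝ → ℝ := fun t => Real.log (S (θ' * (t + -t₂))) with hG
  set ρ : ℝ → ℝ := fun t => S (θ' * (t + -t₂)) with hρ
  have hρ1 : ∀ t, 1 ≤ ρ t := fun t => hS1 _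
  have hρ0 : ∀ t, 0 < ρ t := fun t => zero_lt_one.trans_le (hρ1 t)
  have hρ2 : ∀ t ≤ t₂, ρ t = 1 := fun t ht =>
    hS0 _ (mul_nonpos_of_nonneg_of_nonpos hθ'.le (by linarith))
  have hlS : ContDiff ℝ ∞ fun s => Real.log (S s) :=
    hSsm.log fun s => (zero_lt_one.trans_le (hS1 s)).ne'
  have hGc : ContDiff ℝ ∞ G := hlS.comp (g := fun s => Real.log (S s)) (by fun_prop)
  have hχ : ContDiff ℝ ∞ fun t => smoothTransition (θ' * (t + -t₁)) :=
    smoothTransition.contDiff.comp (by fun_prop)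
  have hFc : ContDiff ℝ ∞ F := by fun_prop
  have hF2 : ∀ t ≥ t₂, F t = 0 := by
    intro t ht
    simp only [hF]
    rw [smoothTransition.one_of_one_le, sub_self, zero_mul]
    have : 1 = θ' * (t₂ + -t₁) := by rw [ht₂]; field_simp; ring
    rw [this]
    gcongr
  have hF1 : ∀ t ∈ Icc (t₁ - 2) t₂, |F t| ≤ Real.log C := by
    intro t ht
    simp only [hF]
    rw [abs_mul]
    refine (mul_le_of_le_one_left (abs_nonneg _) ?_).trans (hUb t ⟨ht.1, ht.2.trans hta⟩).1
    rw [abs_le]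
    constructor <;> linarith [smoothTransition.le_one (θ' * (t + -t₁)),
      smoothTransition.nonneg (θ' * (t + -t₁))]
  have hFj : ∀ t ∈ Icc (t₁ - 2) t₂, JetBound r θ' (2 ^ r * ((1 + B) * C)) F t := by
    intro t ht
    have b1 : JetBound r θ' (1 + B) (fun t => 1 + (-1) * smoothTransition (θ' * (t + -t₁))) t := by
      refine JetBound.add contDiffAt_const ((contDiff_const.mul hχ).contDiffAt.of_le
        (natCast_le_infty _)) (by simpa using JetBound.const_fun hθ'.le 1) ?_
      have := JetBound.const_mul (k := r) (θ := θ') (C := B) (t := t) (-1)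
        (h := fun t => smoothTransition (θ' * (t + -t₁))) ?_
      · simpa using this
      · refine JetBound.comp_add_const (h := fun t => smoothTransition (θ' * t)) fun j hj => ?_
        rw [iteratedDeriv_comp_const_mul (n := j)
          (smoothTransition.contDiff (n := ⊤) |>.of_le (by exact_mod_cast le_top)) θ', abs_mul,
          abs_of_nonneg (by positivity : 0 ≤ θ' ^ j), mul_comm]
        exact mul_le_mul_of_nonneg_right (hBd j hj _) (by positivity)
    have b2 : JetBound r θ' C (fun t => U t - Real.log δ) t := by
      obtain ⟨h1, h2⟩ := hUb t ⟨ht.1, ht.2.trans hta⟩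
      intro j hj
      rcases j with _ | j
      · simpa using h1.trans hlogC'
      · have : iteratedDeriv (j + 1) (fun t => U t - Real.log δ) t = iteratedDeriv (j + 1) U t := by
          rw [iteratedDeriv_succ', iteratedDeriv_succ']
          congr 1
          ext x
          simp
        rw [this]
        exact (h2 (j + 1) (by omega) hj).trans (by gcongr)
    have := JetBound.mul hθ'.le (((contDiff_const.add (contDiff_const.mul hχ)) :
      ContDiff ℝ ∞ fun t => 1 + (-1) * smoothTransition (θ' * (t + -t₁))).contDiffAt.of_le
        (natCast_le_infty _)) ((hU.sub contDiff_const).contDiffAt.of_le (natCast_le_infty _)) b1 b2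
    refine this.congr (Eventually.of_forall fun x => ?_)
    simp only [hF]
    ring
  have hGj : ∀ t j, 1 ≤ j → j ≤ r → |iteratedDeriv j G t| ≤ CS * (θ' / ρ t) ^ j := by
    intro t j h1 h2
    have e1 := congrFun (iteratedDeriv_comp_add_const j
      (fun s => Real.log (S (θ' * s))) (-t₂)) t
    have e2 := iteratedDeriv_comp_const_mul (n := j) (hlS.of_le (natCast_le_infty j)) θ'
    have e3 : iteratedDeriv j G t = θ' ^ j * iteratedDeriv j (fun s => Real.log (S s))
      (θ' * (t + -t₂)) := by rw [← congrFun e2 (t + -t₂)]; exact e1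
    rw [e3, abs_mul, abs_of_nonneg (by positivity : 0 ≤ θ' ^ j), div_eq_mul_inv, mul_pow]
    calc _ ≤ θ' ^ j * (CS * (ρ t)⁻¹ ^ j) :=
          mul_le_mul_of_nonneg_left (hSj _ j h1 h2) (by positivity)
      _ = _ := by ring
  set L : ℝ → ℝ := fun t => (Real.log δ + F t) - p * G t with hL
  refine ⟨L, ρ, t₂ + m / θ', by linarith [div_nonneg hm hθ'.le], by fun_prop, ?_, ?_, hρ1, ?_, ?_,
    hρ2, ?_⟩
  · intro t ht
    simp only [hL, hF, hG]
    rw [smoothTransition.zero_of_nonpos (mul_nonpos_of_nonneg_of_nonpos hθ'.le (by linarith)),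
      hS0 _ (mul_nonpos_of_nonneg_of_nonpos hθ'.le (by linarith)), Real.log_one]
    ring
  · intro t ht
    simp only [hL, hG]
    rw [hF2 t (by linarith [div_nonneg hm hθ'.le]), hSm _ ?_, add_zero]
    have : m = θ' * (m / θ') := by field_simp
    rw [ge_iff_le, this]
    gcongr
    linarith
  · intro t τ
    have h1 : ∀ s, HasDerivAt ρ (deriv S (θ' * (s + -t₂)) * θ') s := fun s =>
      (((hSsm.differentiable (by simp)) _).hasDerivAt.comp s
        (((hasDerivAt_id s).add_const (-t₂)).const_mul θ')).congr_deriv (by simp)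
    have h2 := convex_univ.norm_image_sub_le_of_norm_hasDerivWithin_le (f := ρ) (C := θ')
      (x := τ) (y := t) (fun s _ => (h1 s).hasDerivWithinAt) (fun s _ => ?_) trivial trivial
    · exact h2
    · rw [Real.norm_eq_abs, abs_of_nonneg (mul_nonneg (hSd _).1 hθ'.le)]
      exact mul_le_of_le_one_left hθ'.le (hSd _).2
  · intro t ht
    have e1 : L t - (Real.log δ - p * Real.log (ρ t)) = F t := by
      simp only [hL, hG, hρ]
      ring
    refine ⟨?_, fun j hj1 hjr => ?_⟩
    · rw [e1]
      rcases le_total t t₂ with h | h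
      · exact hF1 t ⟨ht, h⟩
      · rw [hF2 t h, abs_zero]
        exact hlogC
    · have hFt : |iteratedDeriv j F t| ≤ 2 ^ r * ((1 + B) * C) * (θ' / ρ t) ^ j := by
        have hθρ := hρ0 t
        rcases le_or_gt t t₂ with h | h
        · rw [hρ2 t h, div_one]
          exact hFj t ⟨ht, h⟩ j hjr
        · have : F =ᶠ[nhds t] fun _ => 0 := by
            filter_upwards [Ioi_mem_nhds h] with x hx using hF2 x (le_of_lt hx)
          rw [this.iteratedDeriv_eq, iteratedDeriv_const]
          simp only [ite_self, abs_zero]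
          positivity
      have e2 : iteratedDeriv j L t = iteratedDeriv j F t - p * iteratedDeriv j G t := by
        have h1 := iteratedDeriv_fun_sub (n := j) (x := t) (f := fun t => Real.log δ + F t)
          (g := fun t => p * G t)
          ((contDiff_const.add hFc).contDiffAt.of_le (natCast_le_infty _))
          ((contDiff_const.mul hGc).contDiffAt.of_le (natCast_le_infty _))
        have h2 : iteratedDeriv j (fun t => Real.log δ + F t) t = iteratedDeriv j F t := by
          obtain ⟨i, rfl⟩ : ∃ i, j = i + 1 := ⟨j - 1, by omega⟩
          rw [iteratedDeriv_succ', iteratedDeriv_succ']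
          congr 1
          ext x
          simp
        rw [h2, iteratedDeriv_const_mul_field] at h1
        exact h1
      have h0 : 0 ≤ CS * (θ' / ρ t) ^ j := (abs_nonneg _).trans (hGj t j hj1 hjr)
      rw [e2]
      calc _ ≤ |iteratedDeriv j F t| + p * |iteratedDeriv j G t| := by
            refine (abs_sub _ _).trans ?_
            rw [abs_mul, abs_of_nonneg hp0]
        _ ≤ 2 ^ r * ((1 + B) * C) * (θ' / ρ t) ^ j + 2 * (CS * (θ' / ρ t) ^ j) :=
          add_le_add hFt (mul_le_mul hp (hGj t j hj1 hjr) (abs_nonneg _) (by norm_num))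
        _ = _ := by ring
  · intro t ht
    refine ⟨?_, ?_⟩
    · simp only [hL, hG, hρ]
      rw [hF2 t ht.1, add_zero]
    · refine hSlow _ ⟨mul_nonneg hθ'.le (by linarith [ht.1]), ?_⟩
      have : m = θ' * (m / θ') := by field_simp
      rw [this]
      gcongr
      linarith [ht.2]

/-- A logarithmic speed following a slow profile gives a slow curve. -/
theorem exists_slowAt_of_log (r : ℕ) {C K : ℝ} (hC : 1 ≤ C) (hK : 1 ≤ K) : ∃ K' : ℝ, 1 ≤ K' ∧
    ∀ (δ p ε t : ℝ) (L ρ : ℝ → ℝ), 0 < δ → δ ≤ 1 → 0 ≤ ε → δ ≤ ε ^ 2 →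
      p * (1 - 2 * lossExp r) = 1 → ContDiff ℝ ∞ L → (∀ s, 1 ≤ ρ s) →
      (∀ s τ, |ρ s - ρ τ| ≤ |s - τ|) →
      (∀ τ ∈ Icc (t - 1) (t + 1), |L τ - (Real.log δ - p * Real.log (ρ τ))| ≤ Real.log C ∧
        ∀ j, 1 ≤ j → j ≤ r →
          |iteratedDeriv j L τ| ≤ K * (δ ^ (1 - 2 * lossExp r) / ρ τ) ^ j) →
      SlowAt r K' ε (fun s => Real.exp (L s)) t := by
  obtain ⟨K₁, hK₁, hexp⟩ := JetBound.exp r (K * 2 ^ r) (by positivity)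
  refine ⟨4 * C * K₁, one_le_mul_of_one_le_of_one_le (by linarith) hK₁, ?_⟩
  intro δ p ε t L ρ hδ hδ1 hε hδε hp hL hρ1 hρ H
  have hη := lossExp_pos r
  have hη' := lossExp_le r
  have hp0 : 0 ≤ p := by
    by_contra! h
    nlinarith
  have hp2 : p ≤ 2 := by nlinarith
  have hρ0 : ∀ s, 0 < ρ s := fun s => zero_lt_one.trans_le (hρ1 s)
  have hl0 : 0 ≤ Real.log (ρ t) := Real.log_nonneg (hρ1 t)
  set v := Real.exp (Real.log δ - p * Real.log (ρ t)) with hv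
  have hv0 : 0 < v := Real.exp_pos _
  have hvδ : v ≤ δ := by
    rw [hv, ← Real.le_log_iff_exp_le hδ]
    nlinarith
  set θ := δ ^ (1 - 2 * lossExp r) / ρ t with hθ
  have hθ0 : 0 < θ := div_pos (Real.rpow_pos_of_pos hδ _) (hρ0 t)
  have hθv : θ = v ^ (1 - 2 * lossExp r) := by
    rw [hv, ← Real.exp_mul, sub_mul, Real.exp_sub, mul_right_comm, hp, one_mul,
      Real.exp_log (hρ0 t), hθ, Real.rpow_def_of_pos hδ]
  refine ⟨v, θ, hv0, hθ0, ?_, fun j hj => ?_⟩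
  · intro τ hτ
    obtain ⟨h1, h2⟩ := H τ hτ
    have hd : |ρ t - ρ τ| ≤ 1 := (hρ t τ).trans (abs_le.2 ⟨by linarith [hτ.2], by linarith [hτ.1]⟩)
    have hd' := abs_le.1 hd
    have l1 : Real.log (ρ τ) ≤ Real.log 2 + Real.log (ρ t) := by
      rw [← Real.log_mul (by norm_num) (hρ0 t).ne']
      exact Real.log_le_log (hρ0 τ) (by linarith [hρ1 t])
    have l2 : Real.log (ρ t) ≤ Real.log 2 + Real.log (ρ τ) := by
      rw [← Real.log_mul (by norm_num) (hρ0 τ).ne']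
      exact Real.log_le_log (hρ0 t) (by linarith [hρ1 τ])
    have hlog2 : 0 ≤ Real.log 2 := Real.log_nonneg (by norm_num)
    have m1 : p * Real.log (ρ τ) ≤ 2 * Real.log 2 + p * Real.log (ρ t) := by nlinarith
    have m2 : p * Real.log (ρ t) ≤ 2 * Real.log 2 + p * Real.log (ρ τ) := by nlinarith
    have h1' := abs_le.1 h1
    have hlog4 : Real.log (4 * C) = 2 * Real.log 2 + Real.log C := by
      rw [Real.log_mul (by norm_num) (by linarith), show (4 : ℝ) = 2 ^ 2 by norm_num, Real.log_pow]
      norm_num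
    have up : Real.exp (L τ) ≤ 4 * C * v := by
      rw [hv, ← Real.exp_log (by linarith : 0 < 4 * C), ← Real.exp_add, hlog4]
      exact Real.exp_le_exp.2 (by linarith)
    have low : v / (4 * C) ≤ Real.exp (L τ) := by
      rw [hv, ← Real.exp_log (by linarith : 0 < 4 * C), ← Real.exp_sub, hlog4]
      exact Real.exp_le_exp.2 (by linarith)
    refine ⟨le_trans ?_ low, ?_⟩
    · exact div_le_div_of_nonneg_left hv0.le (by linarith) (le_mul_of_one_le_right (by linarith) hK₁)
    · refine (hexp θ L τ hθ0.le (hL.contDiffAt.of_le (natCast_le_infty _))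
        fun j hj1 hjr => ?_).mono hθ0.le ?_
      · have h3 : δ ^ (1 - 2 * lossExp r) / ρ τ ≤ 2 * θ := by
          rw [hθ, ← mul_div_assoc, div_le_div_iff₀ (hρ0 τ) (hρ0 t)]
          have := Real.rpow_pos_of_pos hδ (1 - 2 * lossExp r)
          nlinarith [hρ1 τ]
        have h0 : 0 ≤ δ ^ (1 - 2 * lossExp r) / ρ τ :=
          div_nonneg (Real.rpow_pos_of_pos hδ _).le (hρ0 τ).le
        calc _ ≤ _ := h2 j hj1 hjr
          _ ≤ K * (2 * θ) ^ j := by gcongr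
          _ = K * (2 ^ j * θ ^ j) := by rw [mul_pow]
          _ ≤ K * (2 ^ r * θ ^ j) := by
            have : (2 : ℝ) ^ j ≤ 2 ^ r := pow_le_pow_right₀ (by norm_num) hjr
            gcongr
          _ = _ := by ring
      · calc _ ≤ K₁ * (4 * C * v) := mul_le_mul_of_nonneg_left up (by linarith)
          _ = _ := by ring
  · rw [hθv]
    exact mul_rpow_div_pow_le hj hv0 (hvδ.trans hδ1) hε (hvδ.trans hδε)

/-- Displacement along a braking profile. -/
lemma braking_displacement {Ψ L ρ : ℝ → ℝ} {δ θ p t₂ tA : ℝ} (hδ : 0 < δ) (hθ : 0 < θ)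
    (hp : 1 < p) (hp2 : p ≤ 2) (htA : t₂ ≤ tA) (hΨ : ∀ t, HasDerivAt Ψ (Real.exp (L t)) t)
    (hρ1 : ∀ t, 1 ≤ ρ t) (H : ∀ t ∈ Icc t₂ tA, L t = Real.log δ - p * Real.log (ρ t) ∧
      1 + θ * (t - t₂) ≤ 3 * ρ t) : Ψ tA - Ψ t₂ ≤ 9 / (p - 1) * (δ / θ) := by
  set Z : ℝ → ℝ := fun t => -(9 / (p - 1) * (δ / θ)) * (1 + θ * (t - t₂)) ^ (1 - p) with hZ
  have hbase : ∀ t ∈ Icc t₂ tA, 0 < 1 + θ * (t - t₂) := fun t ht => by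
    have := mul_nonneg hθ.le (by linarith [ht.1] : 0 ≤ t - t₂)
    linarith
  have hZd : ∀ t ∈ Icc t₂ tA, HasDerivAt Z (9 * δ * (1 + θ * (t - t₂)) ^ (-p)) t := by
    intro t ht
    have h1 : HasDerivAt (fun t => 1 + θ * (t - t₂)) θ t := by
      simpa using (((hasDerivAt_id t).sub_const t₂).const_mul θ).const_add 1
    refine ((h1.rpow_const (p := 1 - p) (Or.inl (hbase t ht).ne')).const_mul
      (-(9 / (p - 1) * (δ / θ)))).congr_deriv ?_
    rw [show 1 - p - 1 = -p by ring]
    have : p - 1 ≠ 0 := by linarith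
    field_simp
    ring
  have hanti : AntitoneOn (fun t => Ψ t - Z t) (Icc t₂ tA) := by
    refine antitoneOn_of_hasDerivWithinAt_nonpos (convex_Icc _ _)
      (f' := fun t => Real.exp (L t) - 9 * δ * (1 + θ * (t - t₂)) ^ (-p)) ?_ ?_ ?_
    · exact fun t ht => ((hΨ t).sub (hZd t ht)).continuousAt.continuousWithinAt
    · intro t ht
      rw [interior_Icc] at ht
      exact ((hΨ t).sub (hZd t (Ioo_subset_Icc_self ht))).hasDerivWithinAt
    · intro t ht
      rw [interior_Icc] at ht
      have ht' := Ioo_subset_Icc_self ht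
      obtain ⟨h1, h2⟩ := H t ht'
      have hρt : 0 < ρ t := by linarith [hρ1 t]
      have hb := hbase t ht'
      rw [h1, Real.exp_sub, Real.exp_log hδ, Real.rpow_neg hb.le, mul_comm p, Real.exp_mul,
        Real.exp_log hρt, sub_nonpos, ← div_eq_mul_inv,
        div_le_div_iff₀ (Real.rpow_pos_of_pos hρt _) (Real.rpow_pos_of_pos hb _)]
      calc δ * (1 + θ * (t - t₂)) ^ p ≤ δ * (3 * ρ t) ^ p := by
            gcongr
        _ = δ * (3 ^ p * ρ t ^ p) := by rw [Real.mul_rpow (by norm_num) hρt.le]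
        _ ≤ δ * (9 * ρ t ^ p) := by
          gcongr
          calc (3 : ℝ) ^ p ≤ 3 ^ (2 : ℝ) := Real.rpow_le_rpow_of_exponent_le (by norm_num) hp2
            _ = 9 := by norm_num
        _ = _ := by ring
  have h := hanti (left_mem_Icc.2 htA) (right_mem_Icc.2 htA) htA
  have hc : 0 < 9 / (p - 1) * (δ / θ) :=
    mul_pos (div_pos (by norm_num) (by linarith)) (div_pos hδ hθ)
  have h1 : Z t₂ = -(9 / (p - 1) * (δ / θ)) := by simp [hZ]
  have h2 : Z tA ≤ 0 := by
    simp only [hZ]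
    have := Real.rpow_pos_of_pos (hbase tA (right_mem_Icc.2 htA)) (1 - p)
    nlinarith
  simp only at h
  linarith

/-- A slow curve can be braked to an arbitrarily small constant speed, without reaching the
position it would have attained. -/
theorem exists_braking (r : ℕ) {C : ℝ} (hC : 1 ≤ C) : ∃ K : ℝ, 1 ≤ K ∧ ∀ ε > 0, ∃ δ₀ > 0,
    ∀ (δ t₁ ta : ℝ) (ψ U : ℝ → ℝ), 0 < δ → δ ≤ δ₀ → ContDiff ℝ ∞ U →
      (∀ t, HasDerivAt ψ (Real.exp (U t)) t) → t₁ = ta - 2 / δ ^ (1 - lossExp r) + 2 →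
      (∀ t ≤ ta, Real.exp (U t) ≤ C * δ ∧
        ∀ j, 1 ≤ j → j ≤ r → |iteratedDeriv j U t| ≤ C * (δ ^ (1 - lossExp r)) ^ j) →
      (∀ t ∈ Icc (t₁ - 2) ta, δ / C ≤ Real.exp (U t)) →
      ∃ c < ψ ta, ∃ w₀ > 0, ∀ w, 0 < w → w ≤ w₀ → w ≤ ε ^ 2 ∧ w ≤ 1 ∧ ∃ (Ψ : ℝ → ℝ) (tA : ℝ),
        ContDiff ℝ ∞ Ψ ∧ (∀ t, 0 < deriv Ψ t) ∧ (∀ t ≤ t₁, Ψ t = ψ t) ∧ t₁ ≤ tA ∧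
        (∀ t ≥ tA, deriv Ψ t = w) ∧ Ψ tA ≤ c ∧ ∀ t ≥ t₁ - 1, SlowAt r K ε (deriv Ψ) t := by
  obtain ⟨K, hK, Hlog⟩ := exists_braking_log r hC
  obtain ⟨K', hK', Hslow⟩ := exists_slowAt_of_log r hC hK
  refine ⟨K', hK', fun ε hε => ?_⟩
  have hη := lossExp_pos r
  have hη' := lossExp_le r
  set η := lossExp r with hηdef
  have hα : 0 < 1 - 2 * η := by linarith
  set p := 1 / (1 - 2 * η) with hp
  have hpα : p * (1 - 2 * η) = 1 := by rw [hp]; field_simp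
  have hp1 : 1 < p := by rw [hp, lt_div_iff₀ hα]; linarith
  have hp2 : p ≤ 2 := by rw [hp, div_le_iff₀ hα]; linarith
  set D := C + 9 / (p - 1) with hD
  have hDC : C ≤ D := by
    have : 0 < 9 / (p - 1) := div_pos (by norm_num) (by linarith)
    linarith
  have hD0 : 0 < D := by linarith
  have hCD : 1 ≤ C * D := one_le_mul_of_one_le_of_one_le hC (hC.trans hDC)
  set b := 1 / (2 * (C * D)) with hb
  have hb0 : 0 < b := by positivity
  refine ⟨min 1 (min (ε ^ 2) (b ^ (1 / η))), by positivity, ?_⟩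
  intro δ t₁ ta ψ U hδ hδ₀ hU hψ ht₁ hUup hUlow
  have hδ1 : δ ≤ 1 := hδ₀.trans (min_le_left _ _)
  have hδε : δ ≤ ε ^ 2 := hδ₀.trans ((min_le_right _ _).trans (min_le_left _ _))
  have hδb : δ ^ η ≤ b := by
    have h1 : δ ≤ b ^ (1 / η) := hδ₀.trans ((min_le_right _ _).trans (min_le_right _ _))
    calc δ ^ η ≤ (b ^ (1 / η)) ^ η := Real.rpow_le_rpow hδ.le h1 hη.le
      _ = b := by rw [← Real.rpow_mul hb0.le, one_div_mul_cancel hη.ne', Real.rpow_one]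
  have hb2 : b ≤ 1 / 2 := one_div_le_one_div_of_le (by norm_num) (by linarith)
  set θ := δ ^ (1 - η) with hθ
  set θ' := δ ^ (1 - 2 * η) with hθ'
  have hθ0 : 0 < θ := Real.rpow_pos_of_pos hδ _
  have hθ'0 : 0 < θ' := Real.rpow_pos_of_pos hδ _
  have hθθ' : θ = θ' * δ ^ η := by rw [hθ, hθ', ← Real.rpow_add hδ]; ring_nf
  have hθle : θ ≤ θ' * b := by rw [hθθ']; gcongr
  have hθ'1 : θ' ≤ 1 := Real.rpow_le_one hδ.le hδ1 hα.le
  have hθhalf : θ ≤ 1 / 2 := by nlinarith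
  have hθ'le : θ ≤ θ' := by nlinarith
  have hinv : 2 * (C * D) / θ' ≤ 1 / θ := by
    rw [div_le_div_iff₀ hθ'0 hθ0]
    calc 2 * (C * D) * θ ≤ 2 * (C * D) * (θ' * b) := by gcongr
      _ = 1 * θ' := by rw [hb]; field_simp
  have h2θ : 2 ≤ 1 / θ := by rw [le_div_iff₀ hθ0]; linarith
  have hta' : ta - t₁ ≥ 1 / θ := by
    have : 2 / θ = 1 / θ + 1 / θ := by ring
    rw [ht₁]
    linarith
  have h1θ' : 1 / θ' ≤ 2 * (C * D) / θ' := by gcongr; linarith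
  set c := ψ t₁ + D * (δ / θ') with hc
  have hcψ : c < ψ ta := by
    have h1 := (convex_Icc t₁ ta).mul_sub_le_image_sub_of_le_deriv (f := ψ) (C := δ / C)
      (fun t _ => (hψ t).continuousAt.continuousWithinAt)
      (fun t _ => (hψ t).differentiableAt.differentiableWithinAt)
      (fun t ht => by
        rw [interior_Icc] at ht
        rw [(hψ t).deriv]
        exact hUlow t ⟨by linarith [ht.1], ht.2.le⟩)
      t₁ (left_mem_Icc.2 (by linarith [one_div_pos.2 hθ0])) ta
      (right_mem_Icc.2 (by linarith [one_div_pos.2 hθ0])) (by linarith [one_div_pos.2 hθ0])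
    have h2 : δ / C * (2 * (C * D) / θ') ≤ δ / C * (ta - t₁) := by
      gcongr
      linarith
    have h3 : δ / C * (2 * (C * D) / θ') = 2 * (D * (δ / θ')) := by field_simp
    have h4 : 0 < D * (δ / θ') := mul_pos (by linarith) (div_pos hδ hθ'0)
    rw [hc]
    linarith
  refine ⟨c, hcψ, min (δ * 2 ^ (-p)) δ, by positivity, fun w hw hwle => ?_⟩
  have hwδ : w ≤ δ := hwle.trans (min_le_right _ _)
  refine ⟨hwδ.trans hδε, hwδ.trans hδ1, ?_⟩
  set M := (δ / w) ^ (1 - 2 * η) with hM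
  have hM2 : 2 ≤ M := by
    have h1 : (2 : ℝ) ^ p ≤ δ / w := by
      rw [le_div_iff₀ hw]
      have := hwle.trans (min_le_left _ _)
      calc (2 : ℝ) ^ p * w ≤ 2 ^ p * (δ * 2 ^ (-p)) := by gcongr
        _ = δ := by rw [Real.rpow_neg (by norm_num)]; field_simp
    calc (2 : ℝ) = (2 ^ p) ^ (1 - 2 * η) := by
          rw [← Real.rpow_mul (by norm_num), hpα, Real.rpow_one]
      _ ≤ M := Real.rpow_le_rpow (by positivity) h1 hα.le
  have hMw : Real.log δ - p * Real.log M = Real.log w := by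
    rw [hM, Real.log_rpow (by positivity), ← mul_assoc, hpα, one_mul,
      Real.log_div hδ.ne' hw.ne']
    ring
  obtain ⟨L, ρ, tA, htA, hL, hLU, hLw, hρ1, hρL, hLj, hρ2, hLd⟩ := Hlog δ θ θ' p M t₁ ta U hδ
    hθ0.le hθ'le hθ'0 (by linarith) hp2 hM2 hU (by linarith) (fun t ht => by
      refine ⟨?_, (hUup t ht.2).2⟩
      have h1 : U t ≤ Real.log C + Real.log δ := by
        rw [← Real.log_mul (by linarith) hδ.ne', Real.le_log_iff_exp_le (by positivity)]
        exact (hUup t ht.2).1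
      have h2 : Real.log δ - Real.log C ≤ U t := by
        rw [← Real.log_div hδ.ne' (by linarith), Real.log_le_iff_le_exp (by positivity)]
        exact hUlow t ht
      exact abs_le.2 ⟨by linarith, by linarith⟩)
  have hcL : Continuous fun t => Real.exp (L t) := Real.continuous_exp.comp hL.continuous
  set Ψ : ℝ → ℝ := fun t => ψ t₁ + ∫ s in t₁..t, Real.exp (L s) with hΨ
  have hΨd : ∀ t, HasDerivAt Ψ (Real.exp (L t)) t := fun t =>
    (intervalIntegral.integral_hasDerivAt_right (hcL.intervalIntegrable _ _)
      (hcL.stronglyMeasurableAtFilter _ _) hcL.continuousAt).const_add _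
  have hdΨ : deriv Ψ = fun t => Real.exp (L t) := funext fun t => (hΨd t).deriv
  have hΨ₁ : Ψ t₁ = ψ t₁ := by simp [hΨ]
  refine ⟨Ψ, tA, ?_, ?_, ?_, ?_, ?_, ?_, ?_⟩
  · rw [contDiff_infty_iff_deriv, hdΨ]
    exact ⟨fun t => (hΨd t).differentiableAt, Real.contDiff_exp.comp hL⟩
  · intro t
    rw [hdΨ]
    exact Real.exp_pos _
  · intro t ht
    have h1 : ∫ s in t₁..t, Real.exp (L s) = ∫ s in t₁..t, Real.exp (U s) := by
      refine intervalIntegral.integral_congr fun s hs => ?_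
      rw [uIcc_of_ge ht] at hs
      simp only [hLU s hs.2]
    have h2 := intervalIntegral.integral_eq_sub_of_hasDerivAt (a := t₁) (b := t)
      (fun s _ => hψ s) ((Real.continuous_exp.comp hU.continuous).intervalIntegrable _ _)
    simp only [hΨ]
    rw [h1, h2]
    ring
  · linarith [one_div_pos.2 hθ'0]
  · intro t ht
    rw [hdΨ]
    simp only
    rw [hLw t ht, hMw, Real.exp_log hw]
  · have h1 := braking_displacement hδ hθ'0 hp1 hp2 htA hΨd hρ1 hLd
    have h2 := (convex_Icc t₁ (t₁ + 1 / θ')).image_sub_le_mul_sub_of_deriv_le (f := Ψ)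
      (C := C * δ) (fun t _ => (hΨd t).continuousAt.continuousWithinAt)
      (fun t _ => (hΨd t).differentiableAt.differentiableWithinAt)
      (fun t ht => by
        rw [interior_Icc] at ht
        rw [(hΨd t).deriv]
        have h3 := (abs_le.1 (hLj t (by linarith [ht.1])).1).2
        rw [hρ2 t ht.2.le, Real.log_one, mul_zero] at h3
        rw [← Real.exp_log (by positivity : 0 < C * δ), Real.log_mul (by linarith) hδ.ne']
        exact Real.exp_le_exp.2 (by linarith))
      t₁ (left_mem_Icc.2 (by linarith [one_div_pos.2 hθ'0])) (t₁ + 1 / θ')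
      (right_mem_Icc.2 (by linarith [one_div_pos.2 hθ'0])) (by linarith [one_div_pos.2 hθ'0])
    have h3 : C * δ * (t₁ + 1 / θ' - t₁) = C * (δ / θ') := by ring
    rw [hc, hD]
    linarith
  · intro t ht
    rw [hdΨ]
    exact Hslow δ p ε t L ρ hδ hδ1 hε.le hδε hpα hL hρ1
      (fun s τ => (hρL s τ).trans (mul_le_of_le_one_left (abs_nonneg _) hθ'1))
      fun τ hτ => hLj τ (by linarith [hτ.1])

/-- `T` is close to the identity at `x`, with derivatives up to order `k`. -/
def NearId (k : ℕ) (δ θ : ℝ) (T : ℝ → ℝ) (x : ℝ) : Prop :=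
  |T x - x| ≤ δ ∧ ∀ j, 1 ≤ j → j ≤ k → |iteratedDeriv j (fun y => T y - y) x| ≤ θ

/-- The contraction `T` with inverse `T'` moves `x₁` by exactly `δ`, and both are close to the
identity between the fixed point `0` and this point. -/
structure SlowEnd (r : ℕ) (δ x₁ : ℝ) (T T' : ℝ → ℝ) : Prop where
  pos : 0 < x₁
  le_one : x₁ ≤ 1
  hit : |T x₁ - x₁| = δ
  near : ∀ x ∈ Ioc 0 x₁, NearId (r + 2) δ (δ ^ (1 - lossExp r)) T x
  near_inv : ∀ x ∈ Ioc 0 (T x₁), NearId (r + 2) δ (δ ^ (1 - lossExp r)) T' x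

lemma iteratedDeriv_sub_id {T : ℝ → ℝ} {x : ℝ} {j : ℕ} (hT : ContDiffAt ℝ j T x) :
    iteratedDeriv j (fun y => T y - y) x = iteratedDeriv j T x - iteratedDeriv j id x :=
  iteratedDeriv_fun_sub hT contDiffAt_id

lemma iteratedDeriv_id_of_two_le {x : ℝ} {j : ℕ} (hj : 2 ≤ j) : iteratedDeriv j id x = 0 := by
  obtain ⟨i, rfl⟩ : ∃ i, j = i + 2 := ⟨j - 2, by omega⟩
  rw [iteratedDeriv_succ', deriv_id', iteratedDeriv_const]
  simp

/-- The half-line curve attached to a slow end, braked to a small constant speed. -/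
theorem exists_end_curve (r : ℕ) : ∃ K : ℝ, 1 ≤ K ∧ ∀ ε > 0, ∃ δ₀ > 0,
    ∀ (δ x₁ B t₀ : ℝ) (T T' ψ u : ℝ → ℝ), 0 < δ → δ ≤ δ₀ → ContractingCurve B T ψ u →
      ContDiff ℝ ∞ u → (∀ j, 1 ≤ j → Tendsto (iteratedDeriv j u) atTop (nhds 0)) →
      ψ t₀ = x₁ → SlowEnd r δ x₁ T T' →
      ∃ c < x₁, ∃ w₀ > 0, ∀ w, 0 < w → w ≤ w₀ → w ≤ ε ^ 2 ∧ w ≤ 1 ∧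
        ∃ (Ψ : ℝ → ℝ) (t₁ tA : ℝ), ContDiff ℝ ∞ Ψ ∧ (∀ t, 0 < deriv Ψ t) ∧
          (∀ t ≤ t₁, Ψ t = ψ (-t)) ∧ t₁ ≤ tA ∧ (∀ t ≥ tA, deriv Ψ t = w) ∧ Ψ tA ≤ c ∧
          (∀ t ≥ t₁ - 1, SlowAt r K ε (deriv Ψ) t) ∧
          ∀ t < t₁ - 1, ∀ j ≤ r, |iteratedDeriv j (fun y => T y - y) (ψ (-t))| ≤ ε ∧
            |iteratedDeriv j (fun y => T' y - y) (ψ (-t))| ≤ ε := by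
  obtain ⟨C, hC, HJ⟩ := ContractingCurve.exists_jet_bound r
  obtain ⟨K, hK, HB⟩ := exists_braking r hC
  refine ⟨K, hK, fun ε hε => ?_⟩
  obtain ⟨δ₁, hδ₁, HB⟩ := HB ε hε
  have hη := lossExp_pos r
  have hη' := lossExp_le r
  refine ⟨min δ₁ (min (1 / 16) (ε ^ 2)), by positivity, ?_⟩
  intro δ x₁ B t₀ T T' ψ u hδ hδ₀ H hu hlim hψt₀ hend
  have hδ16 : δ ≤ 1 / 16 := hδ₀.trans ((min_le_right _ _).trans (min_le_left _ _))
  have hδε : δ ≤ ε ^ 2 := hδ₀.trans ((min_le_right _ _).trans (min_le_right _ _))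
  have hsq : δ ^ (1 - lossExp r) ≤ Real.sqrt δ := by
    rw [Real.sqrt_eq_rpow]
    exact Real.rpow_le_rpow_of_exponent_ge hδ (by linarith) (by linarith)
  set θ := δ ^ (1 - lossExp r) with hθ
  have hθ0 : 0 < θ := Real.rpow_pos_of_pos hδ _
  have hθ4 : θ ≤ 1 / 4 := hsq.trans (by
    rw [Real.sqrt_le_left (by norm_num)]
    norm_num
    linarith)
  have hθε : θ ≤ ε := hsq.trans (by rwa [Real.sqrt_le_left hε.le])
  have hδθ : δ ≤ θ := by
    calc δ = δ ^ (1 : ℝ) := (Real.rpow_one δ).symm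
      _ ≤ θ := Real.rpow_le_rpow_of_exponent_ge hδ (by linarith) (by linarith)
  have hTc : ∀ x ∈ Ioc 0 (ψ t₀), ∀ j : ℕ, ContDiffAt ℝ j T x := fun x hx j =>
    (H.smooth.contDiffAt (isOpen_Ioo.mem_nhds ⟨hx.1, hx.2.trans_lt (H.mem t₀).2⟩)).of_le
      (natCast_le_infty j)
  obtain ⟨hlow, hup⟩ := HJ B T ψ u θ δ t₀ H hu hlim (hψt₀.le.trans hend.le_one) hδ hδθ hθ4
    (fun x hx => (hend.near x (hψt₀ ▸ hx)).1) (hψt₀ ▸ hend.hit)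
    (fun x hx => by
      have h1 := (hend.near x (hψt₀ ▸ hx)).2 1 le_rfl (by omega)
      rw [iteratedDeriv_sub_id (hTc x hx 1), iteratedDeriv_one, iteratedDeriv_one, deriv_id] at h1
      exact h1)
    (fun j hj hjr x hx => by
      have h1 := (hend.near x (hψt₀ ▸ hx)).2 j (by omega) hjr
      rw [iteratedDeriv_sub_id (hTc x hx j), iteratedDeriv_id_of_two_le hj, sub_zero] at h1
      exact h1)
  have hanti : StrictAnti ψ := strictAnti_of_deriv_neg fun t => by
    rw [(H.hasDerivAt t).deriv]
    exact neg_lt_zero.2 (Real.exp_pos _)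
  obtain ⟨c, hc, w₀, hw₀, HB⟩ := HB δ (-t₀ - 2 / θ + 2) (-t₀) (fun t => ψ (-t)) (fun t => u (-t)) hδ
    (hδ₀.trans (min_le_left _ _)) (by fun_prop)
    (fun t => ((H.hasDerivAt (-t)).comp t (hasDerivAt_neg t)).congr_deriv (by ring)) rfl
    (fun t ht => by
      obtain ⟨h1, h2⟩ := hup (-t) (by linarith)
      refine ⟨h1, fun j hj hjr => ?_⟩
      rw [iteratedDeriv_comp_neg, smul_eq_mul, abs_mul, abs_pow, abs_neg, abs_one, one_pow, one_mul]
      exact h2 j hj hjr)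
    (fun t ht => hlow (-t) ⟨by linarith [ht.2], by linarith [ht.1]⟩)
  simp only [neg_neg, hψt₀] at hc
  refine ⟨c, hc, w₀, hw₀, fun w hw hw' => ?_⟩
  obtain ⟨hwε, hw1, Ψ, tA, h1, h2, h3, h4, h5, h6, h7⟩ := HB w hw hw'
  refine ⟨hwε, hw1, Ψ, _, tA, h1, h2, h3, h4, h5, h6, h7, fun t ht j hj => ?_⟩
  have h2θ : 8 ≤ 2 / θ := by rw [le_div_iff₀ hθ0]; linarith
  have hm1 : ψ (-t) ∈ Ioc 0 x₁ := ⟨(H.mem _).1, by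
    rw [← hψt₀]
    exact hanti.antitone (by linarith)⟩
  have hm2 : ψ (-t) ∈ Ioc 0 (T x₁) := ⟨(H.mem _).1, by
    rw [← hψt₀, ← H.step]
    exact hanti.antitone (by linarith)⟩
  have key : ∀ S : ℝ → ℝ, NearId (r + 2) δ θ S (ψ (-t)) →
      |iteratedDeriv j (fun y => S y - y) (ψ (-t))| ≤ ε := by
    intro S hS
    rcases Nat.eq_zero_or_pos j with rfl | hj0
    · rw [iteratedDeriv_zero]
      exact hS.1.trans (hδθ.trans hθε)
    · exact (hS.2 j hj0 (by omega)).trans hθε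
  exact ⟨key T (hend.near _ hm1), key T' (hend.near_inv _ hm2)⟩

lemma eq_affine_of_deriv_eq {Ψ : ℝ → ℝ} {w t₀ : ℝ} {s : Set ℝ} (hs : Convex ℝ s) (ht₀ : t₀ ∈ s)
    (hΨ : Differentiable ℝ Ψ) (h : ∀ t ∈ s, deriv Ψ t = w) {t : ℝ} (ht : t ∈ s) :
    Ψ t = Ψ t₀ + w * (t - t₀) := by
  have h2 := hs.norm_image_sub_le_of_norm_hasDerivWithin_le (f := fun x => Ψ x - w * x)
    (f' := fun x => deriv Ψ x - w) (C := 0) (x := t₀) (y := t)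
    (fun x _ => ((hΨ x).hasDerivAt.sub (by
      simpa using (hasDerivAt_id x).const_mul w)).hasDerivWithinAt)
    (fun x hx => by simp [h x hx]) ht₀ ht
  rw [zero_mul, norm_le_zero_iff] at h2
  linarith

/-- Two curves with the same constant speed on their plateaus can be joined along an integer
translation. -/
theorem exists_joined_curve (r : ℕ) {K : ℝ} (hK : 1 ≤ K) : ∃ K' : ℝ, 1 ≤ K' ∧
    ∀ (ε w tA tB sA sB : ℝ) (ΨA ΨB : ℝ → ℝ), 0 ≤ ε → 0 < w → w ≤ ε ^ 2 → w ≤ 1 →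
      ContDiff ℝ ∞ ΨA → ContDiff ℝ ∞ ΨB → (∀ t, 0 < deriv ΨA t) → (∀ t, 0 < deriv ΨB t) →
      (∀ t ≥ tA, deriv ΨA t = w) → (∀ t ≤ tB, deriv ΨB t = w) →
      (∀ t ≥ sA, SlowAt r K ε (deriv ΨA) t) → (∀ t ≤ sB, SlowAt r K ε (deriv ΨB) t) →
      w * (8 + 1 / w ^ (1 - 2 * lossExp r)) ≤ ΨB tB - ΨA tA →
      ∃ (m : ℤ) (Ψ : ℝ → ℝ), ContDiff ℝ ∞ Ψ ∧ (∀ t, 0 < deriv Ψ t) ∧ tA ≤ m + tB ∧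
        (∀ t ≤ tA, Ψ t = ΨA t) ∧ (∀ t ≥ m + tB, Ψ t = ΨB (t - m)) ∧
        ∀ t, sA ≤ t → t ≤ m + sB → SlowAt r K' ε (deriv Ψ) t := by
  obtain ⟨B, hB, hBd⟩ := smoothTransition.exists_iteratedDeriv_bound (r + 1)
  refine ⟨max K (1 + B), le_max_of_le_left hK, ?_⟩
  intro ε w tA tB sA sB ΨA ΨB hε hw hwε hw1 hA hB' hA0 hB0 hAw hBw hAs hBs hroom
  set θ := w ^ (1 - 2 * lossExp r) with hθ
  have hθ0 : 0 < θ := Real.rpow_pos_of_pos hw _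
  have hθi : 0 < 1 / θ := one_div_pos.2 hθ0
  set m : ℤ := ⌊(ΨB tB - ΨA tA) / w - (tB - tA)⌋ with hm
  have hm1 : (m : ℝ) ≤ (ΨB tB - ΨA tA) / w - (tB - tA) := Int.floor_le _
  have hm2 : (ΨB tB - ΨA tA) / w - (tB - tA) < m + 1 := Int.lt_floor_add_one _
  have hroom' : 8 + 1 / θ ≤ (ΨB tB - ΨA tA) / w := by rw [le_div_iff₀ hw]; linarith
  set e := ΨB tB - ΨA tA - w * (m + tB - tA) with he
  have hwd : w * ((ΨB tB - ΨA tA) / w) = ΨB tB - ΨA tA := by field_simp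
  have he0 : 0 ≤ e := by nlinarith
  have hew : e ≤ w := by nlinarith
  set tc := tA + 3 with htc
  have hgap : tc + 1 / θ + 4 < m + tB := by linarith
  set χ : ℝ → ℝ := fun t => smoothTransition (θ * (t + -tc)) with hχ
  have hχc : ContDiff ℝ ∞ χ := smoothTransition.contDiff.comp (by fun_prop)
  have hχd : ∀ t, HasDerivAt χ (deriv smoothTransition (θ * (t + -tc)) * θ) t := fun t =>
    ((((smoothTransition.contDiff (n := ⊤)).differentiable (by simp) _).hasDerivAt).comp t
      (((hasDerivAt_id t).add_const (-tc)).const_mul θ)).congr_deriv (by simp)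
  have hχ0 : ∀ t ≤ tc, χ t = 0 := fun t ht => smoothTransition.zero_of_nonpos
    (mul_nonpos_of_nonneg_of_nonpos hθ0.le (by linarith))
  have hχ1 : ∀ t ≥ tc + 1 / θ, χ t = 1 := fun t ht => smoothTransition.one_of_one_le (by
    have : 1 = θ * (1 / θ) := by field_simp
    rw [this]
    gcongr
    linarith)
  have hχ' : ∀ t, 0 ≤ deriv smoothTransition t := fun t => smoothTransition.monotone.deriv_nonneg
  have hAf : ∀ t ≥ tA, ΨA t = ΨA tA + w * (t - tA) := fun t ht =>
    eq_affine_of_deriv_eq (convex_Ici tA) self_mem_Ici (hA.differentiable (by simp)) hAw ht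
  have hBf : ∀ t ≤ tB, ΨB t = ΨB tB + w * (t - tB) := fun t ht =>
    eq_affine_of_deriv_eq (convex_Iic tB) self_mem_Iic (hB'.differentiable (by simp)) hBw ht
  set Ψ : ℝ → ℝ := fun t => ΨA t + ΨB (t - m) - (ΨB tB + w * (t - m - tB)) + e * χ t with hΨ
  have hΨc : ContDiff ℝ ∞ Ψ := by fun_prop
  have f1 : ∀ t ≤ m + tB, Ψ t = ΨA t + e * χ t := by
    intro t ht
    simp only [hΨ]
    rw [hBf (t - m) (by linarith)]
    ring
  have f2 : ∀ t ≥ tA, Ψ t = ΨB (t - m) + e * (χ t - 1) := by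
    intro t ht
    simp only [hΨ]
    rw [hAf t ht, he]
    ring
  have fA : ∀ t ≤ tc, Ψ t = ΨA t := fun t ht => by rw [f1 t (by linarith), hχ0 t ht]; ring
  have fB : ∀ t ≥ tc + 1 / θ, Ψ t = ΨB (t - m) := fun t ht => by
    rw [f2 t (by linarith), hχ1 t ht]; ring
  have dΨ : ∀ t, deriv Ψ t = deriv ΨA t + deriv ΨB (t - m) - w +
      e * (deriv smoothTransition (θ * (t + -tc)) * θ) := by
    intro t
    have h1 : HasDerivAt (fun t => ΨB (t - m)) (deriv ΨB (t - m)) t :=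
      ((hB'.differentiable (by simp) _).hasDerivAt.comp t
        ((hasDerivAt_id t).sub_const (m : ℝ))).congr_deriv (by simp)
    have h2 : HasDerivAt (fun t : ℝ => ΨB tB + w * (t - m - tB)) w t := by
      simpa using ((((hasDerivAt_id t).sub_const (m : ℝ)).sub_const tB).const_mul w).const_add
        (ΨB tB)
    exact ((((hA.differentiable (by simp) t).hasDerivAt.add h1).sub h2).add
      ((hχd t).const_mul e)).deriv
  have hbump : ∀ t, 0 ≤ e * (deriv smoothTransition (θ * (t + -tc)) * θ) := fun t =>
    mul_nonneg he0 (mul_nonneg (hχ' _) hθ0.le)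
  have dmid : ∀ t ∈ Ioo tA (m + tB), w + e * θ * deriv smoothTransition (θ * (t + -tc)) =
      deriv Ψ t := by
    intro t ht
    rw [dΨ, hAw t ht.1.le, hBw (t - m) (by linarith [ht.2])]
    ring
  refine ⟨m, Ψ, hΨc, ?_, by linarith, fun t ht => fA t (by linarith),
    fun t ht => fB t (by linarith), ?_⟩
  · intro t
    rw [dΨ]
    rcases le_total t (m + tB) with h | h
    · rw [hBw (t - m) (by linarith)]
      linarith [hA0 t, hbump t]
    · rw [hAw t (by linarith)]
      linarith [hB0 (t - m), hbump t]
  · intro t htA htB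
    rcases lt_or_ge t (tA + 2) with h | h
    · refine ((hAs t htA).mono (by linarith) (le_max_left _ _)).congr isOpen_Iio
        (V := Iio tc) (fun s hs => show s < tc by linarith [hs.2]) fun s hs => ?_
      refine (Filter.EventuallyEq.deriv_eq ?_).symm
      filter_upwards [Iio_mem_nhds hs] with x hx using fA x (le_of_lt hx)
    rcases lt_or_ge (tc + 1 / θ + 1) t with h' | h'
    · have h3 : SlowAt r K ε (fun x => deriv ΨB (x + -(m : ℝ))) t :=
        SlowAt.comp_add_const (hBs _ (by linarith))
      refine (h3.mono (by linarith) (le_max_left _ _)).congr isOpen_Ioi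
        (V := Ioi (tc + 1 / θ)) (fun s hs => show tc + 1 / θ < s by linarith [hs.1]) fun s hs => ?_
      have : Ψ =ᶠ[nhds s] fun x => ΨB (x - m) := by
        filter_upwards [Ioi_mem_nhds hs] with x hx using fB x (le_of_lt hx)
      rw [this.deriv_eq]
      simp only [← sub_eq_add_neg]
      exact (deriv_comp_sub_const ..).symm
    · refine SlowAt.congr (q := fun x => w + e * θ * deriv smoothTransition (θ * (x + -tc)))
        ?_ isOpen_Ioo (V := Ioo tA (m + tB))
        (fun s hs => ⟨by linarith [hs.1], by linarith [hs.2]⟩) dmid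
      refine SlowAt.mono (K := 1 + B) ?_ (by linarith) (le_max_right _ _)
      refine ⟨w, θ, hw, hθ0, fun τ _ => ⟨?_, ?_⟩, fun j hj =>
        mul_rpow_div_pow_le hj hw hw1 hε hwε⟩
      · have := hbump τ
        have h4 : w / (1 + B) ≤ w := div_le_self hw.le (by linarith)
        linarith
      · have hcd : ContDiff ℝ ∞ (deriv smoothTransition) :=
          (smoothTransition.contDiff (n := ⊤)).deriv'
        have j1 : JetBound r θ B (fun x => deriv smoothTransition (θ * (x + -tc))) τ := by
          refine JetBound.comp_add_const (h := fun x => deriv smoothTransition (θ * x)) fun j hj => ?_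
          rw [iteratedDeriv_comp_const_mul (n := j) (hcd.of_le (natCast_le_infty j)) θ, abs_mul,
            abs_of_nonneg (by positivity : 0 ≤ θ ^ j), mul_comm, ← iteratedDeriv_succ']
          exact mul_le_mul_of_nonneg_right (hBd (j + 1) (by omega) _) (by positivity)
        have hcd' : ContDiff ℝ ∞ fun x => e * θ * deriv smoothTransition (θ * (x + -tc)) :=
          contDiff_const.mul (hcd.comp (by fun_prop))
        refine (JetBound.add contDiffAt_const (hcd'.contDiffAt.of_le (natCast_le_infty _))
          (JetBound.const_fun hθ0.le w) (j1.const_mul (e * θ))).mono hθ0.le ?_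
        rw [abs_of_pos hw, abs_of_nonneg (by positivity)]
        have hθ1 : θ ≤ 1 := Real.rpow_le_one hw.le hw1 (by linarith [lossExp_le r])
        have : e * θ ≤ w * 1 := mul_le_mul hew hθ1 hθ0.le hw.le
        nlinarith

namespace DiffIcc

lemma smooth' (f : DiffIcc ⊤) : ContDiffOn ℝ ∞ f.toFun (Icc 0 1) := f.smooth

lemma uniqueDiffOn_unit : UniqueDiffOn ℝ (Icc (0:ℝ) 1) := uniqueDiffOn_Icc zero_lt_one

lemma differentiableOn (f : DiffIcc ⊤) : DifferentiableOn ℝ f.toFun (Icc 0 1) :=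
  f.smooth'.differentiableOn (by simp)

lemma strictMonoOn (f : DiffIcc ⊤) : StrictMonoOn f.toFun (Icc 0 1) := by
  refine strictMonoOn_of_deriv_pos (convex_Icc 0 1) f.smooth'.continuousOn fun x hx => ?_
  rw [interior_Icc] at hx
  rw [← derivWithin_of_mem_nhds (Icc_mem_nhds hx.1 hx.2)]
  exact f.deriv_pos x (Ioo_subset_Icc_self hx)

/-- The inverse diffeomorphism. -/
def symm (f : DiffIcc ⊤) : DiffIcc ⊤ where
  toFun := f.invFun
  invFun := f.toFun
  smooth := f.smooth_inv
  smooth_inv := f.smooth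
  maps := f.maps_inv
  maps_inv := f.maps
  left_inv := f.right_inv
  right_inv := f.left_inv
  fix0 := by have := f.left_inv 0 (by simp); rwa [f.fix0] at this
  fix1 := by have := f.left_inv 1 (by simp); rwa [f.fix1] at this
  deriv_pos := by
    intro x hx
    have hd : DifferentiableOn ℝ f.invFun (Icc 0 1) := f.smooth_inv.differentiableOn (by simp)
    have h1 := derivWithin_comp x (f.differentiableOn _ (f.maps_inv hx)) (hd x hx) f.maps_inv
    have h2 : derivWithin (f.toFun ∘ f.invFun) (Icc 0 1) x = 1 :=
      (derivWithin_congr (f₁ := f.toFun ∘ f.invFun) (f := id) (fun y hy => f.right_inv y hy)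
        (f.right_inv x hx)).trans (derivWithin_id _ _ (uniqueDiffOn_unit x hx))
    rw [h2] at h1
    exact pos_of_mul_pos_right (h1 ▸ one_pos) (f.deriv_pos _ (f.maps_inv hx)).le

@[simp] lemma symm_toFun (f : DiffIcc ⊤) : f.symm.toFun = f.invFun := rfl

lemma iterate_mem (f : DiffIcc ⊤) {x : ℝ} (hx : x ∈ Icc (0:ℝ) 1) (n : ℕ) :
    f.toFun^[n] x ∈ Icc (0:ℝ) 1 := f.maps.iterate n hx

lemma contDiffOn_iterate (f : DiffIcc ⊤) (n : ℕ) : ContDiffOn ℝ ∞ f.toFun^[n] (Icc 0 1) := by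
  induction n with
  | zero => exact contDiffOn_id
  | succ n ih => exact ih.comp f.smooth' f.maps

lemma derivWithin_iterate_pos_and (f : DiffIcc ⊤) (n : ℕ) {x : ℝ} (hx : x ∈ Icc (0:ℝ) 1) :
    0 < derivWithin f.toFun^[n] (Icc 0 1) x ∧
    Real.log (derivWithin f.toFun^[n] (Icc 0 1) x) =
      birkhoffSum f.toFun (fun x => Real.log (derivWithin f.toFun (Icc 0 1) x)) n x := by
  induction n generalizing x with
  | zero =>
    have : derivWithin (f.toFun^[0]) (Icc 0 1) x = 1 :=
      derivWithin_id _ _ (uniqueDiffOn_unit x hx)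
    rw [this]
    simp
  | succ n ih =>
    have h1 : derivWithin (f.toFun^[n + 1]) (Icc 0 1) x =
        derivWithin f.toFun^[n] (Icc 0 1) (f.toFun x) * derivWithin f.toFun (Icc 0 1) x := by
      rw [Function.iterate_succ]
      exact derivWithin_comp x
        ((f.contDiffOn_iterate n).differentiableOn (by simp) _ (f.maps hx))
        (f.differentiableOn x hx) f.maps
    obtain ⟨h2, h3⟩ := ih (f.maps hx)
    have h4 := f.deriv_pos x hx
    rw [h1]
    refine ⟨mul_pos h2 h4, ?_⟩
    rw [Real.log_mul h2.ne' h4.ne', h3, birkhoffSum_succ', add_comm]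

lemma boundedVariationOn_log_deriv (f : DiffIcc ⊤) (n : ℕ) :
    eVariationOn (fun x => Real.log (derivWithin f.toFun^[n] (Icc 0 1) x)) (Icc 0 1) ≠ ⊤ := by
  have h1 : ContDiffOn ℝ 1 (derivWithin f.toFun^[n] (Icc 0 1)) (Icc 0 1) :=
    (f.contDiffOn_iterate n).derivWithin uniqueDiffOn_unit
      (by exact_mod_cast natCast_le_infty (1 + 1))
  have h2 : ContDiffOn ℝ 1 (fun x => Real.log (derivWithin f.toFun^[n] (Icc 0 1) x))
      (Icc 0 1) := h1.log fun x hx => (f.derivWithin_iterate_pos_and n hx).1.ne'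
  obtain ⟨K, hK⟩ := (h2.locallyLipschitzOn
    (convex_Icc 0 1)).exists_lipschitzOnWith_of_compact isCompact_Icc
  have h3 := hK.locallyBoundedVariationOn 0 1 (by simp) (by simp)
  rwa [inter_self] at h3

lemma sum_abs_le_variation (f : DiffIcc ⊤) (n N : ℕ) {w : ℕ → ℝ}
    (hw : Monotone w ∨ Antitone w) (hmem : ∀ i, w i ∈ Icc (0:ℝ) 1) :
    ∑ i ∈ Finset.range N, |Real.log (derivWithin f.toFun^[n] (Icc 0 1) (w (i + 1))) -
      Real.log (derivWithin f.toFun^[n] (Icc 0 1) (w i))| ≤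
    (eVariationOn (fun x => Real.log (derivWithin f.toFun^[n] (Icc 0 1) x)) (Icc 0 1)).toReal := by
  set g := fun x => Real.log (derivWithin f.toFun^[n] (Icc 0 1) x) with hg
  have key : ∀ w : ℕ → ℝ, MonotoneOn w (Iic N) → (∀ i, w i ∈ Icc (0:ℝ) 1) →
      ∑ i ∈ Finset.range N, |g (w (i + 1)) - g (w i)| ≤ (eVariationOn g (Icc 0 1)).toReal := by
    intro w hw hmem
    have h1 := eVariationOn.sum_le_of_monotoneOn_Iic (f := g) hw (fun i _ => hmem i)
    have h2 := ENNReal.toReal_mono (f.boundedVariationOn_log_deriv n) h1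
    rw [ENNReal.toReal_sum (fun _ _ => edist_ne_top _ _)] at h2
    simpa [edist_dist, Real.dist_eq] using h2
  rcases hw with hw | hw
  · exact key w (hw.monotoneOn _) hmem
  · have h1 := key (fun i => w (N - i)) (fun i _ j _ hij => hw (by omega)) (fun i => hmem _)
    rw [← Finset.sum_range_reflect] at h1
    refine le_trans (le_of_eq (Finset.sum_congr rfl fun i hi => ?_)) h1
    rw [Finset.mem_range] at hi
    rw [abs_sub_comm, show N - (N - 1 - i + 1) = i by omega, show N - (N - 1 - i) = i + 1 by omega]

/-- Vanishing asymptotic variation forces derivative one at the fixed points. -/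
lemma derivWithin_eq_one (f : DiffIcc ⊤) (hvar : IAsympVarVanishes f.toFun) {c : ℝ}
    (hc : c ∈ Icc (0:ℝ) 1) (hfix : f.toFun c = c) : derivWithin f.toFun (Icc 0 1) c = 1 := by
  set ℓ := Real.log (derivWithin f.toFun (Icc 0 1) c) with hℓ
  have hle : ∀ n : ℕ, 1 ≤ n → |ℓ| ≤
      (eVariationOn (fun x => Real.log (derivWithin f.toFun^[n] (Icc 0 1) x))
        (Icc 0 1)).toReal / n := by
    intro n hn
    have hn0 : (0 : ℝ) < n := by exact_mod_cast hn
    have hcd := f.contDiffOn_iterate n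
    obtain ⟨ξ, hξ, h1⟩ := exists_deriv_eq_slope f.toFun^[n] zero_lt_one hcd.continuousOn
      ((hcd.differentiableOn (by simp)).mono Ioo_subset_Icc_self)
    have h0 : f.toFun^[n] 0 = 0 := Function.iterate_fixed f.fix0 n
    have h1' : f.toFun^[n] 1 = 1 := Function.iterate_fixed f.fix1 n
    rw [h0, h1', ← derivWithin_of_mem_nhds (Icc_mem_nhds hξ.1 hξ.2)] at h1
    have h2 : Real.log (derivWithin f.toFun^[n] (Icc 0 1) ξ) = 0 := by rw [h1]; simp
    have h3 : Real.log (derivWithin f.toFun^[n] (Icc 0 1) c) = n * ℓ := by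
      rw [(f.derivWithin_iterate_pos_and n hc).2]
      simp [birkhoffSum, Function.iterate_fixed hfix, hℓ]
    have h4 : |n * ℓ - 0| ≤ (eVariationOn (fun x => Real.log (derivWithin f.toFun^[n] (Icc 0 1) x))
        (Icc 0 1)).toReal := by
      have := ENNReal.toReal_mono (f.boundedVariationOn_log_deriv n)
        (eVariationOn.edist_le (fun x => Real.log (derivWithin f.toFun^[n] (Icc 0 1) x)) hc
          (Ioo_subset_Icc_self hξ))
      rw [edist_dist, ENNReal.toReal_ofReal dist_nonneg, Real.dist_eq] at this
      simp only [h2, h3] at this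
      exact this
    rw [le_div_iff₀ hn0]
    rw [sub_zero, abs_mul, abs_of_pos hn0] at h4
    linarith
  have h5 : |ℓ| ≤ 0 := ge_of_tendsto hvar (eventually_atTop.2 ⟨1, hle⟩)
  have h6 : ℓ = 0 := abs_nonpos_iff.1 h5
  have h7 := f.deriv_pos c hc
  rw [← Real.exp_log h7, ← hℓ, h6, Real.exp_zero]

end DiffIcc

lemma iteratedDeriv_comp_const_mul' (h : ℝ → ℝ) (κ : ℝ) (j : ℕ) :
    iteratedDeriv j (fun y => h (κ * y)) = fun y => κ ^ j * iteratedDeriv j h (κ * y) := by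
  induction j with
  | zero => simp
  | succ j ih =>
    ext y
    rw [iteratedDeriv_succ, ih, deriv_const_mul_field,
      deriv_comp_mul_left κ (iteratedDeriv j h) y, ← iteratedDeriv_succ, smul_eq_mul, pow_succ]
    ring

/-- The map `f` read in the affine chart `y ↦ c + κ y`. -/
def chartConj (f : ℝ → ℝ) (c κ y : ℝ) : ℝ := (f (c + κ * y) - c) / κ

lemma iteratedDeriv_chartConj (f : ℝ → ℝ) (c : ℝ) {κ : ℝ} (hκ : κ ≠ 0) (j : ℕ) (y : ℝ) :
    iteratedDeriv (j + 1) (chartConj f c κ) y = κ ^ j * iteratedDeriv (j + 1) f (c + κ * y) := by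
  have h1 : deriv (chartConj f c κ) = fun y => deriv f (c + κ * y) := by
    ext y
    have : chartConj f c κ = fun y => κ⁻¹ * ((fun z => f (c + z)) (κ * y) - c) := by
      ext y; simp only [chartConj]; field_simp
    rw [this, deriv_const_mul_field, deriv_sub_const, deriv_comp_mul_left κ (fun z => f (c + z)) y,
      deriv_comp_const_add, smul_eq_mul]
    field_simp
  rw [iteratedDeriv_succ', h1, iteratedDeriv_succ']
  have h2 := congrFun (iteratedDeriv_comp_const_mul' (fun z => deriv f (c + z)) κ j) y
  rw [iteratedDeriv_comp_const_add] at h2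
  exact h2

namespace DiffIcc

lemma contDiffAt (f : DiffIcc ⊤) {x : ℝ} (hx : x ∈ Ioo (0:ℝ) 1) : ContDiffAt ℝ ∞ f.toFun x :=
  f.smooth'.contDiffAt (Icc_mem_nhds hx.1 hx.2)

lemma derivWithin_eq (f : ℝ → ℝ) {x : ℝ} (hx : x ∈ Ioo (0:ℝ) 1) :
    derivWithin f (Icc 0 1) x = deriv f x := derivWithin_of_mem_nhds (Icc_mem_nhds hx.1 hx.2)

lemma iteratedDerivWithin_eq (f : DiffIcc ⊤) (j : ℕ) {x : ℝ} (hx : x ∈ Ioo (0:ℝ) 1) :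
    iteratedDerivWithin j f.toFun (Icc 0 1) x = iteratedDeriv j f.toFun x :=
  iteratedDerivWithin_eq_iteratedDeriv uniqueDiffOn_unit
    ((f.contDiffAt hx).of_le (natCast_le_infty _)) (Ioo_subset_Icc_self hx)

lemma continuousOn_iteratedDerivWithin (f : DiffIcc ⊤) (j : ℕ) :
    ContinuousOn (iteratedDerivWithin j f.toFun (Icc 0 1)) (Icc 0 1) :=
  f.smooth'.continuousOn_iteratedDerivWithin (natCast_le_infty _) uniqueDiffOn_unit

lemma continuousOn_derivWithin (f : DiffIcc ⊤) :
    ContinuousOn (derivWithin f.toFun (Icc 0 1)) (Icc 0 1) :=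
  f.smooth'.continuousOn_derivWithin uniqueDiffOn_unit (by exact_mod_cast le_top)

lemma exists_bound (f : DiffIcc ⊤) (j : ℕ) :
    ∃ M, 0 ≤ M ∧ ∀ x ∈ Icc (0:ℝ) 1, |iteratedDerivWithin j f.toFun (Icc 0 1) x| ≤ M := by
  obtain ⟨M, hM⟩ := isCompact_Icc.exists_bound_of_continuousOn (f.continuousOn_iteratedDerivWithin j)
  exact ⟨M, (norm_nonneg _).trans (hM 0 (by simp)), hM⟩

lemma exists_lower (f : DiffIcc ⊤) :
    ∃ K, 1 ≤ K ∧ ∀ x ∈ Icc (0:ℝ) 1, 1 / K ≤ derivWithin f.toFun (Icc 0 1) x := by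
  obtain ⟨z, hz, hmin⟩ := isCompact_Icc.exists_isMinOn (nonempty_Icc.2 zero_le_one)
    f.continuousOn_derivWithin
  have h0 := f.deriv_pos z hz
  refine ⟨max 1 (derivWithin f.toFun (Icc 0 1) z)⁻¹, le_max_left _ _, fun x hx => ?_⟩
  refine le_trans ?_ (hmin hx)
  rw [one_div]
  exact inv_le_of_inv_le₀ h0 (le_max_right _ _)

/-- Charts at a fixed point with derivative one, contracted towards the fixed point. -/
theorem smoothContraction_chartConj (f : DiffIcc ⊤) {c κ B : ℝ} (hκ : κ ≠ 0) (hB : 0 < B)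
    (hc : c ∈ Icc (0:ℝ) 1) (hDc : derivWithin f.toFun (Icc 0 1) c = 1)
    (hsub : ∀ y ∈ Ioo 0 B, c + κ * y ∈ Ioo (0:ℝ) 1)
    (hmaps : MapsTo (chartConj f.toFun c κ) (Ioo 0 B) (Ioo 0 B))
    (hlt : ∀ y ∈ Ioo 0 B, chartConj f.toFun c κ y < y) :
    SmoothContraction B (chartConj f.toFun c κ) := by
  have hder : ∀ y ∈ Ioo 0 B, deriv (chartConj f.toFun c κ) y =
      derivWithin f.toFun (Icc 0 1) (c + κ * y) := fun y hy => by
    have := iteratedDeriv_chartConj f.toFun c hκ 0 y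
    rw [derivWithin_eq _ (hsub y hy)]
    simpa using this
  obtain ⟨K, hK1, hK⟩ := f.exists_lower
  refine ⟨?_, fun y hy => ?_, hmaps, hlt, fun x₁ hx₁ j => ?_, fun x₁ hx₁ => ?_, ?_⟩
  · have h1 : ContDiffOn ℝ ∞ (fun y => f.toFun (c + κ * y)) (Ioo 0 B) := by
      refine f.smooth'.comp (t := Icc 0 1) (by fun_prop) fun y hy => Ioo_subset_Icc_self (hsub y hy)
    exact (h1.sub contDiffOn_const).div_const κ
  · rw [hder y hy]
    exact f.deriv_pos _ (Ioo_subset_Icc_self (hsub y hy))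
  · cases j with
    | zero =>
      refine ⟨B, fun x hx => ?_⟩
      have := hmaps ⟨hx.1, hx.2.trans_lt hx₁.2⟩
      rw [iteratedDeriv_zero, abs_of_pos this.1]
      exact this.2.le
    | succ j =>
      obtain ⟨M, hM0, hM⟩ := f.exists_bound (j + 1)
      refine ⟨|κ| ^ j * M, fun x hx => ?_⟩
      have hx' := hsub x ⟨hx.1, hx.2.trans_lt hx₁.2⟩
      rw [iteratedDeriv_chartConj _ _ hκ, abs_mul, abs_pow, ← f.iteratedDerivWithin_eq _ hx']
      exact mul_le_mul_of_nonneg_left (hM _ (Ioo_subset_Icc_self hx')) (by positivity)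
  · refine ⟨K, hK1, fun x hx => ?_⟩
    have hx' : x ∈ Ioo 0 B := ⟨hx.1, hx.2.trans_lt hx₁.2⟩
    rw [hder x hx']
    exact hK _ (Ioo_subset_Icc_self (hsub x hx'))
  · have h1 : Tendsto (fun y => c + κ * y) (nhdsWithin 0 (Ioi 0)) (nhdsWithin c (Icc 0 1)) := by
      refine tendsto_nhdsWithin_iff.2 ⟨?_, ?_⟩
      · have : Tendsto (fun y => c + κ * y) (nhds 0) (nhds (c + κ * 0)) :=
          (by fun_prop : Continuous fun y => c + κ * y).tendsto 0
        simpa using this.mono_left nhdsWithin_le_nhds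
      · filter_upwards [Ioo_mem_nhdsGT hB] with y hy using Ioo_subset_Icc_self (hsub y hy)
    have h2 := (f.continuousOn_derivWithin c hc).tendsto.comp h1
    rw [hDc] at h2
    refine h2.congr' ?_
    filter_upwards [Ioo_mem_nhdsGT hB] with y hy using (hder y hy).symm

lemma strictMono_inv (f : DiffIcc ⊤) : StrictMonoOn f.invFun (Icc 0 1) := f.symm.strictMonoOn

lemma iterate_left_inv (f : DiffIcc ⊤) (n : ℕ) {x : ℝ} (hx : x ∈ Icc (0:ℝ) 1) :
    f.invFun^[n] (f.toFun^[n] x) = x := by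
  induction n generalizing x with
  | zero => rfl
  | succ n ih =>
    rw [Function.iterate_succ_apply, Function.iterate_succ_apply',
      f.left_inv _ (f.iterate_mem hx n), ih hx]

lemma iterate_strictMonoOn (f : DiffIcc ⊤) (n : ℕ) : StrictMonoOn f.toFun^[n] (Icc 0 1) := by
  induction n with
  | zero => exact fun x _ y _ h => h
  | succ n ih =>
    intro x hx y hy h
    rw [Function.iterate_succ_apply, Function.iterate_succ_apply]
    exact ih (f.maps hx) (f.maps hy) (f.strictMonoOn hx hy h)

lemma asympVar_symm (f : DiffIcc ⊤) (hvar : IAsympVarVanishes f.toFun) :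
    IAsympVarVanishes f.symm.toFun := by
  refine hvar.congr fun n => ?_
  congr 2
  set g := fun x => Real.log (derivWithin f.toFun^[n] (Icc 0 1) x) with hg
  have h1 : EqOn (fun x => Real.log (derivWithin f.symm.toFun^[n] (Icc 0 1) x))
      (fun x => -(g ∘ f.symm.toFun^[n]) x) (Icc 0 1) := by
    intro x hx
    have hx' := f.symm.iterate_mem hx n
    have h2 : derivWithin (f.toFun^[n] ∘ f.symm.toFun^[n]) (Icc 0 1) x = 1 :=
      (derivWithin_congr (f₁ := f.toFun^[n] ∘ f.symm.toFun^[n]) (f := id)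
        (fun y hy => f.symm.iterate_left_inv n hy) (f.symm.iterate_left_inv n hx)).trans
        (derivWithin_id _ _ (uniqueDiffOn_unit x hx))
    rw [derivWithin_comp x ((f.contDiffOn_iterate n).differentiableOn (by simp) _ hx')
      ((f.symm.contDiffOn_iterate n).differentiableOn (by simp) _ hx)
      (fun y hy => f.symm.iterate_mem hy n)] at h2
    have p1 := (f.derivWithin_iterate_pos_and n hx').1
    have p2 := (f.symm.derivWithin_iterate_pos_and n hx).1
    have h3 := congrArg Real.log h2
    rw [Real.log_mul p1.ne' p2.ne', Real.log_one] at h3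
    simp only [hg, Function.comp_apply]
    linarith
  have h2 : eVariationOn (fun x => -(g ∘ f.symm.toFun^[n]) x) (Icc 0 1) =
      eVariationOn (g ∘ f.symm.toFun^[n]) (Icc 0 1) := by
    simp only [eVariationOn, edist_neg_neg]
  rw [eVariationOn.eq_of_eqOn h1, h2,
    eVariationOn.comp_eq_of_monotoneOn _ _ (f.symm.iterate_strictMonoOn n).monotoneOn]
  congr 1
  ext x
  constructor
  · exact fun hx => ⟨f.toFun^[n] x, f.iterate_mem hx n, f.iterate_left_inv n hx⟩
  · rintro ⟨y, hy, rfl⟩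
    exact f.symm.iterate_mem hy n

end DiffIcc

/-- Two convergent sequences whose reflected differences are small in mean have the same limit. -/
lemma limits_eq_of_cesaro {A B : ℕ → ℝ} {α β : ℝ} (hA : Tendsto A atTop (nhds α))
    (hB : Tendsto B atTop (nhds β)) {V : ℕ → ℝ} (hV : Tendsto (fun n : ℕ => V n / n) atTop (nhds 0))
    (h : ∀ n, ∑ j ∈ Finset.range n, |A (n - j) - B j| ≤ V n) : α = β := by
  have h1 := ((tendsto_add_atTop_iff_nat 1).2 hA).cesaro.sub hB.cesaro
  have h2 : Tendsto (fun n : ℕ => (n : ℝ)⁻¹ * ∑ i ∈ Finset.range n, A (i + 1) -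
      (n : ℝ)⁻¹ * ∑ i ∈ Finset.range n, B i) atTop (nhds 0) := by
    refine squeeze_zero_norm (fun n => ?_) hV
    rw [← mul_sub, Real.norm_eq_abs, abs_mul, abs_of_nonneg (by positivity : (0:ℝ) ≤ (n:ℝ)⁻¹),
      div_eq_inv_mul]
    refine mul_le_mul_of_nonneg_left ?_ (by positivity)
    have h3 : ∑ i ∈ Finset.range n, A (i + 1) = ∑ j ∈ Finset.range n, A (n - j) := by
      rw [← Finset.sum_range_reflect]
      refine Finset.sum_congr rfl fun i hi => ?_
      rw [Finset.mem_range] at hi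
      congr 1; omega
    rw [h3, ← Finset.sum_sub_distrib]
    exact (Finset.abs_sum_le_sum_abs _ _).trans (h n)
  linarith [tendsto_nhds_unique h1 h2]

lemma sum_even_le_sum {F : ℕ → ℝ} (hF : ∀ i, 0 ≤ F i) (n : ℕ) :
    ∑ j ∈ Finset.range n, F (2 * j) ≤ ∑ i ∈ Finset.range (2 * n), F i := by
  induction n with
  | zero => simp
  | succ n ih =>
    rw [Finset.sum_range_succ, show 2 * (n + 1) = 2 * n + 1 + 1 by ring, Finset.sum_range_succ,
      Finset.sum_range_succ]
    linarith [hF (2 * n + 1)]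

namespace DiffIcc

/-- `f` moves every point of the component `(a, b)` upwards, and fixes its endpoints. -/
structure IsComponent (f : DiffIcc ⊤) (a b : ℝ) : Prop where
  lt : a < b
  left_mem : a ∈ Icc (0:ℝ) 1
  right_mem : b ∈ Icc (0:ℝ) 1
  left_fix : f.toFun a = a
  right_fix : f.toFun b = b
  lt_map : ∀ x ∈ Ioo a b, x < f.toFun x

namespace IsComponent

variable {f : DiffIcc ⊤} {a b : ℝ}

lemma mem_unit (H : IsComponent f a b) {x : ℝ} (hx : x ∈ Ioo a b) : x ∈ Ioo (0:ℝ) 1 :=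
  ⟨H.left_mem.1.trans_lt hx.1, hx.2.trans_le H.right_mem.2⟩

lemma mem_Icc (H : IsComponent f a b) {x : ℝ} (hx : x ∈ Ioo a b) : x ∈ Icc (0:ℝ) 1 :=
  Ioo_subset_Icc_self (H.mem_unit hx)

lemma inv_left (H : IsComponent f a b) : f.invFun a = a := by
  have := f.left_inv a H.left_mem; rwa [H.left_fix] at this

lemma inv_right (H : IsComponent f a b) : f.invFun b = b := by
  have := f.left_inv b H.right_mem; rwa [H.right_fix] at this

lemma mapsTo (H : IsComponent f a b) : MapsTo f.toFun (Ioo a b) (Ioo a b) := fun x hx =>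
  ⟨by simpa [H.left_fix] using f.strictMonoOn H.left_mem (H.mem_Icc hx) hx.1,
    by simpa [H.right_fix] using f.strictMonoOn (H.mem_Icc hx) H.right_mem hx.2⟩

lemma mapsTo_inv (H : IsComponent f a b) : MapsTo f.invFun (Ioo a b) (Ioo a b) := fun x hx =>
  ⟨by simpa [H.inv_left] using f.strictMono_inv H.left_mem (H.mem_Icc hx) hx.1,
    by simpa [H.inv_right] using f.strictMono_inv (H.mem_Icc hx) H.right_mem hx.2⟩

lemma inv_lt (H : IsComponent f a b) {x : ℝ} (hx : x ∈ Ioo a b) : f.invFun x < x := by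
  simpa [f.right_inv x (H.mem_Icc hx)] using H.lt_map _ (H.mapsTo_inv hx)

/-- The logarithmic derivative. -/
abbrev logD (f : DiffIcc ⊤) (x : ℝ) : ℝ := Real.log (derivWithin f.toFun (Icc 0 1) x)

lemma logD_inv (H : IsComponent f a b) {x : ℝ} (hx : x ∈ Ioo a b) :
    logD f.symm x = - logD f (f.invFun x) := by
  have hx' := H.mem_Icc hx
  have h2 : derivWithin (f.toFun ∘ f.invFun) (Icc 0 1) x = 1 :=
      (derivWithin_congr (f₁ := f.toFun ∘ f.invFun) (f := id) (fun y hy => f.right_inv y hy)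
        (f.right_inv x hx')).trans (derivWithin_id _ _ (uniqueDiffOn_unit x hx'))
  rw [derivWithin_comp x (f.differentiableOn _ (f.maps_inv hx'))
    (f.symm.differentiableOn x hx') f.maps_inv] at h2
  have h3 := congrArg Real.log h2
  have h4 : derivWithin f.invFun (Icc 0 1) x ≠ 0 := (f.symm.deriv_pos _ hx').ne'
  rw [Real.log_mul (f.deriv_pos _ (f.maps_inv hx')).ne' h4, Real.log_one] at h3
  simp only [logD, symm_toFun] at h3 ⊢
  linarith

/-- Both ends of a component give a contraction. -/
lemma contraction_right (H : IsComponent f a b) {κ : ℝ} (hκ : κ < 0)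
    (hDb : derivWithin f.toFun (Icc 0 1) b = 1) :
    SmoothContraction ((a - b) / κ) (chartConj f.toFun b κ) := by
  have hB : 0 < (a - b) / κ := div_pos_of_neg_of_neg (by linarith [H.lt]) hκ
  have hin : ∀ y ∈ Ioo 0 ((a - b) / κ), b + κ * y ∈ Ioo a b := fun y hy =>
    ⟨by have := (lt_div_iff_of_neg hκ).1 hy.2; linarith, by nlinarith [hy.1]⟩
  refine f.smoothContraction_chartConj hκ.ne hB H.right_mem hDb
    (fun y hy => H.mem_unit (hin y hy)) (fun y hy => ?_) fun y hy => ?_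
  · have := H.mapsTo (hin y hy)
    exact ⟨div_pos_of_neg_of_neg (by linarith [this.2]) hκ,
      (div_lt_div_right_of_neg hκ).2 (by linarith [this.1])⟩
  · rw [chartConj, div_lt_iff_of_neg hκ]
    linarith [H.lt_map _ (hin y hy)]

lemma contraction_left (H : IsComponent f a b) {κ : ℝ} (hκ : 0 < κ)
    (hDa : derivWithin f.symm.toFun (Icc 0 1) a = 1) :
    SmoothContraction ((b - a) / κ) (chartConj f.symm.toFun a κ) := by
  have hB : 0 < (b - a) / κ := div_pos (by linarith [H.lt]) hκ
  have hin : ∀ y ∈ Ioo 0 ((b - a) / κ), a + κ * y ∈ Ioo a b := fun y hy =>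
    ⟨by nlinarith [hy.1], by have := (lt_div_iff₀ hκ).1 hy.2; linarith⟩
  refine f.symm.smoothContraction_chartConj hκ.ne' hB H.left_mem hDa
    (fun y hy => H.mem_unit (hin y hy)) (fun y hy => ?_) fun y hy => ?_
  · have := H.mapsTo_inv (hin y hy)
    exact ⟨div_pos (by simp; linarith [this.1]) hκ,
      (div_lt_div_iff_of_pos_right hκ).2 (by simp; linarith [this.2])⟩
  · rw [chartConj, div_lt_iff₀ hκ]
    have := H.inv_lt (hin y hy)
    simp
    linarith

lemma exists_cobound_of_chart {e : DiffIcc ⊤} {c κ B x₀ : ℝ} (hκ : κ ≠ 0)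
    (hin : ∀ x, x ∈ Ioo a b ↔ (x - c) / κ ∈ Ioo 0 B) (h01 : ∀ x ∈ Ioo a b, x ∈ Ioo (0:ℝ) 1)
    (hm : MapsTo e.toFun (Ioo a b) (Ioo a b))
    (HT : SmoothContraction B (chartConj e.toFun c κ)) (hx₀ : x₀ ∈ Ioo a b) :
    ∃ P : ℝ → ℝ, ContinuousOn P (Ioo a b) ∧
      (∀ x ∈ Ioo a b, Tendsto (fun n : ℕ => birkhoffSum e.toFun (logD e) n x₀ -
        birkhoffSum e.toFun (logD e) n x) atTop (nhds (P x))) ∧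
      ∀ x ∈ Ioo a b, P (e.toFun x) = P x + logD e x := by
  obtain ⟨P, hPc, hPl, hPe⟩ := HT.exists_cobound ((hin x₀).1 hx₀)
  have hchart : ∀ x, c + κ * ((x - c) / κ) = x := fun x => by field_simp; ring
  have hconj : ∀ x, chartConj e.toFun c κ ((x - c) / κ) = (e.toFun x - c) / κ := fun x => by
    rw [chartConj, hchart]
  have hder : ∀ x ∈ Ioo a b, Real.log (deriv (chartConj e.toFun c κ) ((x - c) / κ)) = logD e x :=
    fun x hx => by
      have := iteratedDeriv_chartConj e.toFun c hκ 0 ((x - c) / κ)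
      rw [hchart] at this
      rw [logD, derivWithin_eq _ (h01 x hx)]
      simpa using congrArg Real.log this
  have hit : ∀ (n : ℕ), ∀ x ∈ Ioo a b, birkhoffSum (chartConj e.toFun c κ)
      (fun x => Real.log (deriv (chartConj e.toFun c κ) x)) n ((x - c) / κ) =
      birkhoffSum e.toFun (logD e) n x := by
    intro n
    induction n with
    | zero => simp
    | succ n ih =>
      intro x hx
      rw [birkhoffSum_succ', birkhoffSum_succ', hconj, ih _ (hm hx), hder x hx]
  refine ⟨fun x => P ((x - c) / κ), ?_, fun x hx => ?_, fun x hx => ?_⟩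
  · exact hPc.comp (by fun_prop) fun x hx => (hin x).1 hx
  · have := hPl _ ((hin x).1 hx)
    simpa only [hit _ x hx, hit _ x₀ hx₀] using this
  · have := hPe _ ((hin x).1 hx)
    rwa [hconj, hder x hx] at this

lemma birkhoff_inv (H : IsComponent f a b) {n j : ℕ} (hj : j ≤ n) {y : ℝ} (hy : y ∈ Ioo a b) :
    birkhoffSum f.toFun (logD f) n (f.invFun^[j] y) =
      birkhoffSum f.toFun (logD f) (n - j) y - birkhoffSum f.invFun (logD f.symm) j y := by
  induction j generalizing n with
  | zero => simp
  | succ j ih =>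
    obtain ⟨m, rfl⟩ : ∃ m, n = m + 1 := ⟨n - 1, by omega⟩
    have hmem : f.invFun^[j] y ∈ Ioo a b := H.mapsTo_inv.iterate j hy
    rw [Function.iterate_succ_apply', birkhoffSum_succ', f.right_inv _ (H.mem_Icc hmem),
      ih (by omega), birkhoffSum_succ, H.logD_inv hmem, show m + 1 - (j + 1) = m - j by omega]
    ring

/-- The distortions at both ends agree when the asymptotic variation vanishes. -/
theorem exists_common_cobound (H : IsComponent f a b) (hvar : IAsympVarVanishes f.toFun) :
    ∃ P : ℝ → ℝ, ContinuousOn P (Ioo a b) ∧ (∀ x ∈ Ioo a b, P (f.toFun x) = P x + logD f x) ∧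
      (∀ x ∈ Ioo a b, ∀ y ∈ Ioo a b, Tendsto (fun n : ℕ => P (f.toFun^[n] x) - P (f.toFun^[n] y))
        atTop (nhds 0)) ∧
      ∀ x ∈ Ioo a b, ∀ y ∈ Ioo a b, Tendsto (fun n : ℕ => P (f.invFun^[n] x) - P (f.invFun^[n] y))
        atTop (nhds 0) := by
  obtain ⟨x₀, hx₀⟩ := nonempty_Ioo.2 H.lt
  have hDa := f.symm.derivWithin_eq_one (f.asympVar_symm hvar) H.left_mem H.inv_left
  have hDb := f.derivWithin_eq_one hvar H.right_mem H.right_fix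
  obtain ⟨P, hPc, hPl, hPe⟩ := exists_cobound_of_chart (e := f) (a := a) (b := b) (c := b)
    (κ := -1) (B := (a - b) / -1) (by norm_num) (fun x => by
      simp only [mem_Ioo]; constructor <;> rintro ⟨h1, h2⟩ <;> constructor <;> linarith)
    (fun x hx => H.mem_unit hx) H.mapsTo (H.contraction_right (by norm_num) hDb) hx₀
  obtain ⟨Q, hQc, hQl, hQe⟩ := exists_cobound_of_chart (e := f.symm) (a := a) (b := b) (c := a)
    (κ := 1) (B := (b - a) / 1) (by norm_num) (fun x => by
      simp only [mem_Ioo]; constructor <;> rintro ⟨h1, h2⟩ <;> constructor <;> linarith)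
    (fun x hx => H.mem_unit hx) H.mapsTo_inv (H.contraction_left one_pos hDa) hx₀
  simp only [symm_toFun] at hQl hQe
  have hnear : ∀ y₁ ∈ Ioo a b, ∀ y₂ ∈ Ioo a b, y₁ < y₂ → y₂ < f.toFun y₁ →
      P y₂ - P y₁ = Q y₂ - Q y₁ := by
    intro y₁ hy₁ y₂ hy₂ h12 h21
    have hA := (hPl y₂ hy₂).sub (hPl y₁ hy₁)
    have hB := (hQl y₂ hy₂).sub (hQl y₁ hy₁)
    simp only [sub_sub_sub_cancel_left] at hA hB
    refine limits_eq_of_cesaro hA hB hvar fun n => ?_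
    set w : ℕ → ℝ := fun i => if Even i then f.invFun^[i / 2] y₂ else f.invFun^[i / 2] y₁ with hw
    have we : ∀ j, w (2 * j) = f.invFun^[j] y₂ := fun j => by simp [hw]
    have wo : ∀ j, w (2 * j + 1) = f.invFun^[j] y₁ := fun j => by
      simp only [hw]
      rw [if_neg (by simp), show (2 * j + 1) / 2 = j by omega]
    have hm1 : ∀ j, f.invFun^[j] y₁ ∈ Ioo a b := fun j => H.mapsTo_inv.iterate j hy₁
    have hm2 : ∀ j, f.invFun^[j] y₂ ∈ Ioo a b := fun j => H.mapsTo_inv.iterate j hy₂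
    have hgy : f.invFun y₂ < y₁ := by
      have := f.strictMono_inv (H.mem_Icc hy₂) (H.mem_Icc (H.mapsTo hy₁)) h21
      rwa [f.left_inv _ (H.mem_Icc hy₁)] at this
    have hanti : Antitone w := by
      refine antitone_nat_of_succ_le fun i => ?_
      rcases Nat.even_or_odd' i with ⟨j, rfl | rfl⟩
      · rw [we, wo]
        exact ((f.symm.iterate_strictMonoOn j) (H.mem_Icc hy₁) (H.mem_Icc hy₂) h12).le
      · rw [wo, show 2 * j + 1 + 1 = 2 * (j + 1) by ring, we, Function.iterate_succ_apply]
        exact ((f.symm.iterate_strictMonoOn j) (H.mem_Icc (H.mapsTo_inv hy₂))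
          (H.mem_Icc hy₁) hgy).le
    have hmem : ∀ i, w i ∈ Icc (0:ℝ) 1 := fun i => by
      simp only [hw]; split_ifs <;> exact H.mem_Icc (by first | exact hm2 _ | exact hm1 _)
    refine le_trans ?_ (f.sum_abs_le_variation n (2 * n) (Or.inr hanti) hmem)
    refine le_trans (le_of_eq (Finset.sum_congr rfl fun j hj => ?_))
      (sum_even_le_sum (fun i => abs_nonneg _) n)
    rw [Finset.mem_range] at hj
    simp only [we, wo]
    rw [(f.derivWithin_iterate_pos_and n (H.mem_Icc (hm1 j))).2,
      (f.derivWithin_iterate_pos_and n (H.mem_Icc (hm2 j))).2]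
    change _ = |birkhoffSum f.toFun (logD f) n _ - birkhoffSum f.toFun (logD f) n _|
    rw [H.birkhoff_inv hj.le hy₁, H.birkhoff_inv hj.le hy₂]
    congr 1
    ring
  have hconst : ∀ x ∈ Ioo a b, HasDerivAt (fun x => P x - Q x) 0 x := by
    intro x hx
    refine (hasDerivAt_const x (P x - Q x)).congr_of_eventuallyEq ?_
    filter_upwards [Ioo_mem_nhds (H.inv_lt hx) (H.lt_map x hx), Ioo_mem_nhds hx.1 hx.2]
      with y hy hy'
    rcases lt_trichotomy x y with h | rfl | h
    · linarith [hnear x hx y hy' h hy.2]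
    · rfl
    · have := f.strictMonoOn (H.mem_Icc (H.mapsTo_inv hx)) (H.mem_Icc hy') hy.1
      rw [f.right_inv x (H.mem_Icc hx)] at this
      linarith [hnear y hy' x hx h this]
  have hPQ : ∀ x ∈ Ioo a b, P x - Q x = P x₀ - Q x₀ := fun x hx =>
    isOpen_Ioo.is_const_of_deriv_eq_zero isPreconnected_Ioo
      (fun x hx => (hconst x hx).differentiableAt.differentiableWithinAt)
      (fun x hx => (hconst x hx).deriv) hx hx₀
  have hPn : ∀ x ∈ Ioo a b, ∀ n, P (f.toFun^[n] x) = P x + birkhoffSum f.toFun (logD f) n x := by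
    intro x hx n
    induction n with
    | zero => simp
    | succ n ih =>
      rw [Function.iterate_succ_apply', hPe _ (H.mapsTo.iterate n hx), ih, birkhoffSum_succ]
      ring
  have hQn : ∀ x ∈ Ioo a b, ∀ n,
      Q (f.invFun^[n] x) = Q x + birkhoffSum f.invFun (logD f.symm) n x := by
    intro x hx n
    induction n with
    | zero => simp
    | succ n ih =>
      rw [Function.iterate_succ_apply', hQe _ (H.mapsTo_inv.iterate n hx), ih, birkhoffSum_succ]
      ring
  refine ⟨P, hPc, hPe, fun x hx y hy => ?_, fun x hx y hy => ?_⟩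
  · have h1 := ((hPl y hy).sub (hPl x hx)).const_add (P x - P y)
    rw [show P x - P y + (P y - P x) = 0 by ring] at h1
    refine h1.congr fun n => ?_
    rw [hPn x hx, hPn y hy]
    ring
  · have h1 := ((hQl y hy).sub (hQl x hx)).const_add (Q x - Q y)
    rw [show Q x - Q y + (Q y - Q x) = 0 by ring] at h1
    refine h1.congr fun n => ?_
    have e1 := hPQ _ (H.mapsTo_inv.iterate n hx)
    have e2 := hPQ _ (H.mapsTo_inv.iterate n hy)
    have e3 := hQn x hx n
    have e4 := hQn y hy n
    linarith

end IsComponent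

/-- A parametrization of the component `(a, b)` on which `f` is the unit shift, with logarithmic
speed `u`. -/
structure FlowCurve (f : DiffIcc ⊤) (a b : ℝ) (ψ u : ℝ → ℝ) : Prop extends IsComponent f a b where
  mem : ∀ t, ψ t ∈ Ioo a b
  hasDerivAt : ∀ t, HasDerivAt ψ (Real.exp (u t)) t
  step : ∀ t, ψ (t + 1) = f.toFun (ψ t)
  top : Tendsto ψ atTop (nhds b)
  bot : Tendsto ψ atBot (nhds a)
  surj : ∀ x ∈ Ioo a b, ∃ t, ψ t = x
  cont : Continuous u
  dist_top : ∀ s t : ℝ, Tendsto (fun n : ℕ => u (t + n) - u (s + n)) atTop (nhds 0)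
  dist_bot : ∀ s t : ℝ, Tendsto (fun n : ℕ => u (t - n) - u (s - n)) atTop (nhds 0)

theorem IsComponent.exists_flowCurve {f : DiffIcc ⊤} {a b : ℝ} (H : IsComponent f a b)
    (hvar : IAsympVarVanishes f.toFun) : ∃ ψ u, FlowCurve f a b ψ u := by
  obtain ⟨P, hPc, hPe, hPt, hPb⟩ := H.exists_common_cobound hvar
  obtain ⟨c, ψ, hmem, hd, hstep, htop, hbot, hsurj⟩ := exists_flow_curve H.lt H.mapsTo H.mapsTo_inv
    (fun x hx => f.right_inv x (H.mem_Icc hx)) H.lt_map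
    (fun x hx => (f.contDiffAt (H.mem_unit hx)).differentiableAt (by simp))
    (fun x hx => by
      rw [← derivWithin_eq _ (H.mem_unit hx)]; exact f.deriv_pos _ (H.mem_Icc hx)) hPc
    (fun x hx => by rw [hPe x hx, IsComponent.logD, derivWithin_eq _ (H.mem_unit hx)])
  have hψc : Continuous ψ := continuous_iff_continuousAt.2 fun t => (hd t).continuousAt
  have hn : ∀ (n : ℕ) t, ψ (t + n) = f.toFun^[n] (ψ t) := by
    intro n t
    induction n with
    | zero => simp
    | succ n ih => rw [Function.iterate_succ_apply', ← ih, ← hstep]; push_cast; ring_nf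
  have hn' : ∀ (n : ℕ) t, ψ (t - n) = f.invFun^[n] (ψ t) := by
    intro n t
    have := hn n (t - n)
    rw [sub_add_cancel] at this
    rw [this, f.iterate_left_inv n (H.mem_Icc (hmem _))]
  refine ⟨ψ, fun t => P (ψ t) + c, ⟨H, hmem, hd, hstep, htop, hbot, hsurj, ?_, ?_, ?_⟩⟩
  · exact (hPc.comp_continuous hψc hmem).add continuous_const
  · intro s t
    refine (hPt _ (hmem t) _ (hmem s)).congr fun n => ?_
    rw [hn, hn]; ring
  · intro s t
    refine (hPb _ (hmem t) _ (hmem s)).congr fun n => ?_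
    rw [hn', hn']; ring

namespace FlowCurve

variable {f : DiffIcc ⊤} {a b : ℝ} {ψ u : ℝ → ℝ}

lemma step_neg (H : FlowCurve f a b ψ u) (t : ℝ) : ψ (t - 1) = f.invFun (ψ t) := by
  have := H.step (t - 1)
  rw [sub_add_cancel] at this
  rw [this, f.left_inv _ (H.mem_Icc (H.mem _))]

lemma curve_right (H : FlowCurve f a b ψ u) {κ : ℝ} (hκ : κ < 0)
    (HT : SmoothContraction ((a - b) / κ) (chartConj f.toFun b κ)) :
    ContractingCurve ((a - b) / κ) (chartConj f.toFun b κ) (fun t => (ψ t - b) / κ)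
      (fun t => u t - Real.log (-κ)) where
  smooth := HT.smooth
  deriv_pos := HT.deriv_pos
  mem t := ⟨div_pos_of_neg_of_neg (by linarith [(H.mem t).2]) hκ,
    (div_lt_div_right_of_neg hκ).2 (by linarith [(H.mem t).1])⟩
  hasDerivAt t := by
    have := ((H.hasDerivAt t).sub_const b).div_const κ
    rw [Real.exp_sub, Real.exp_log (by linarith)]
    exact this.congr_deriv (by rw [div_neg, neg_neg])
  step t := by
    simp only [chartConj, H.step]
    congr 3
    rw [mul_div_cancel₀ _ hκ.ne]
    ring
  tendsto_zero := by
    simpa using (H.top.sub_const b).div_const κ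
  dist s t := by simpa using H.dist_top s t
  cont := H.cont.sub continuous_const

lemma curve_left (H : FlowCurve f a b ψ u) {κ : ℝ} (hκ : 0 < κ)
    (HT : SmoothContraction ((b - a) / κ) (chartConj f.symm.toFun a κ)) :
    ContractingCurve ((b - a) / κ) (chartConj f.symm.toFun a κ) (fun t => (ψ (-t) - a) / κ)
      (fun t => u (-t) - Real.log κ) where
  smooth := HT.smooth
  deriv_pos := HT.deriv_pos
  mem t := ⟨div_pos (by linarith [(H.mem (-t)).1]) hκ,
    (div_lt_div_iff_of_pos_right hκ).2 (by linarith [(H.mem (-t)).2])⟩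
  hasDerivAt t := by
    have := (((H.hasDerivAt (-t)).comp t (hasDerivAt_neg t)).sub_const a).div_const κ
    rw [Real.exp_sub, Real.exp_log hκ]
    exact this.congr_deriv (by ring)
  step t := by
    rw [neg_add', H.step_neg]
    simp only [chartConj, symm_toFun]
    congr 3
    rw [mul_div_cancel₀ _ hκ.ne']
    ring
  tendsto_zero := by
    simpa using ((H.bot.comp tendsto_neg_atTop_atBot).sub_const a).div_const κ
  dist s t := by
    have := H.dist_bot (-s) (-t)
    refine this.congr fun n => ?_
    rw [neg_add', neg_add']
    ring
  cont := (H.cont.comp continuous_neg).sub continuous_const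

lemma contDiff_and_tendsto_of {B : ℝ} {T ψ u : ℝ → ℝ}
    (HT : SmoothContraction B T) (HC : ContractingCurve B T ψ u) :
    ContDiff ℝ ∞ u ∧ ∀ j, 1 ≤ j → Tendsto (iteratedDeriv j u) atTop (nhds 0) := by
  obtain ⟨h0, h1⟩ := HC.mem 0
  obtain ⟨K, hK, hl⟩ := HT.lower _ ⟨h0, h1⟩
  have := HC.contDiff_and_tendsto h0 h1 hK (HT.bdd _ ⟨h0, h1⟩) hl
  exact ⟨contDiff_infty.2 fun k => (this k).1, fun j hj => (this j).2 j hj le_rfl⟩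

/-- The logarithmic speed is smooth and all its derivatives vanish at infinity. -/
theorem contDiff_and_tendsto (H : FlowCurve f a b ψ u) (hvar : IAsympVarVanishes f.toFun) :
    ContDiff ℝ ∞ u ∧ (∀ j, 1 ≤ j → Tendsto (iteratedDeriv j u) atTop (nhds 0)) ∧
      ∀ j, 1 ≤ j → Tendsto (iteratedDeriv j u) atBot (nhds 0) := by
  have hDa := f.symm.derivWithin_eq_one (f.asympVar_symm hvar) H.left_mem H.inv_left
  have hDb := f.derivWithin_eq_one hvar H.right_mem H.right_fix
  have T1 := H.contraction_right (κ := -1) (by norm_num) hDb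
  have T2 := H.contraction_left (κ := 1) one_pos hDa
  obtain ⟨h1, h2⟩ := contDiff_and_tendsto_of T1 (H.curve_right (by norm_num) T1)
  obtain ⟨h3, h4⟩ := contDiff_and_tendsto_of T2 (H.curve_left one_pos T2)
  simp at h1 h2 h4
  refine ⟨h1, h2, fun j hj => ?_⟩
  have h5 := ((h4 j hj).comp tendsto_neg_atBot_atTop).const_mul ((-1 : ℝ) ^ j)
  rw [mul_zero] at h5
  refine h5.congr fun t => ?_
  simp only [Function.comp_apply]
  rw [iteratedDeriv_comp_neg j u (-t), neg_neg, smul_eq_mul, ← mul_assoc, ← mul_pow]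
  simp

end FlowCurve
end DiffIcc

lemma zpowFun_zero (f : DiffIcc ⊤) (x : ℝ) : zpowFun f 0 x = x := by simp [zpowFun]

lemma zpowFun_symm_neg (f : DiffIcc ⊤) (m : ℤ) : zpowFun f.symm (-m) = zpowFun f m := by
  rcases lt_trichotomy m 0 with h | rfl | h
  · rw [zpowFun, zpowFun, if_pos (by omega), if_neg (by omega)]; rfl
  · simp [zpowFun]
  · rw [zpowFun, zpowFun, if_neg (by omega), if_pos (by omega), neg_neg]; rfl

/-- Any map `g` semiconjugated to `f` by `φ` around `x` is close to the identity at `φ x`. -/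
def CloseAt (r : ℕ) (ε : ℝ) (f φ : ℝ → ℝ) (x : ℝ) : Prop :=
  ∀ g : ℝ → ℝ, (∀ᶠ y in nhds x, g (φ y) = φ (f y)) →
    ∀ j ≤ r, |iteratedDeriv j (fun y => g y - y) (φ x)| ≤ ε

/-- `φ` conjugates `f` close to the identity between the fixed points `a` and `b`; it is a dilation
by `la` near `a`, and by `lb` near `b` up to the `m`-th power of `f`. -/
structure ConjOn (r : ℕ) (ε : ℝ) (f : DiffIcc ⊤) (a b la lb : ℝ) (φ : ℝ → ℝ) (m : ℤ) : Prop where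
  smooth : ContDiffOn ℝ ∞ φ (Ioo a b)
  deriv_pos : ∀ x ∈ Ioo a b, 0 < deriv φ x
  left : ∀ᶠ x in nhdsWithin a (Ici a), φ x = a + la * (x - a)
  right : ∀ᶠ x in nhdsWithin b (Iic b), φ x = b + lb * (zpowFun f m x - b)
  close : ∀ x ∈ Ioo a b, f.toFun x ≠ x → CloseAt r ε f.toFun φ x

lemma eventually_of_eventually_curve {Ψ : ℝ → ℝ} {t : ℝ} (h : ContDiffAt ℝ ∞ Ψ t)
    (h0 : deriv Ψ t ≠ 0) {P : ℝ → Prop} (hP : ∀ᶠ τ in nhds t, P (Ψ τ)) :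
    ∀ᶠ y in nhds (Ψ t), P y := by
  have := (h.hasStrictDerivAt (by simp)).map_nhds_eq h0
  rw [← this]
  exact hP

lemma abs_iteratedDeriv_sub_id_eq_of_affine {g S : ℝ → ℝ} {c σ y₀ : ℝ} (hσ : σ * σ = 1)
    (h : ∀ᶠ y in nhds y₀, g (c + σ * y) = c + σ * S y) (j : ℕ) :
    |iteratedDeriv j (fun z => g z - z) (c + σ * y₀)| = |iteratedDeriv j (fun y => S y - y) y₀| := by
  have hy : y₀ = σ * (c + σ * y₀ + -c) := by linear_combination -y₀ * hσ
  have hcont : Tendsto (fun z : ℝ => σ * (z + -c)) (nhds (c + σ * y₀)) (nhds y₀) := by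
    conv_rhs => rw [hy]
    exact Continuous.tendsto (by fun_prop) _
  have h1 : (fun z => g z - z) =ᶠ[nhds (c + σ * y₀)]
      fun z => σ * (fun w => (fun y => S y - y) (σ * w)) (z + -c) := by
    filter_upwards [hcont.eventually h] with z hz
    have h2 : c + σ * (σ * (z + -c)) = z := by linear_combination (z - c) * hσ
    rw [h2] at hz
    simp only [hz]
    linear_combination (z - c) * hσ
  rw [h1.iteratedDeriv_eq, iteratedDeriv_const_mul_field,
    iteratedDeriv_comp_add_const j (fun w => (fun y => S y - y) (σ * w)),
    iteratedDeriv_comp_const_mul' (fun y => S y - y)]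
  simp only [← hy]
  have hσ1 : |σ| = 1 := by
    have := abs_mul_abs_self σ
    rw [hσ] at this
    nlinarith [abs_nonneg σ]
  rw [abs_mul, abs_mul, abs_pow, hσ1]
  simp

namespace DiffIcc
namespace FlowCurve

variable {f : DiffIcc ⊤} {a b : ℝ} {ψ u : ℝ → ℝ}

lemma zpow_eq (H : FlowCurve f a b ψ u) (m : ℤ) (t : ℝ) : zpowFun f m (ψ t) = ψ (t + m) := by
  rw [zpowFun]
  have hn : ∀ (n : ℕ) t, f.toFun^[n] (ψ t) = ψ (t + n) := by
    intro n t
    induction n with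
    | zero => simp
    | succ n ih => rw [Function.iterate_succ_apply', ih, ← H.step]; push_cast; ring_nf
  split_ifs with h
  · lift m to ℕ using h
    simp [hn]
  · obtain ⟨n, hn'⟩ : ∃ n : ℕ, m = -n := ⟨(-m).toNat, by omega⟩
    have := hn n (t - n)
    rw [sub_add_cancel] at this
    rw [hn', ← this]
    simp [f.iterate_left_inv n (H.mem_Icc (H.mem _)), ← sub_eq_add_neg]

lemma strictMono (H : FlowCurve f a b ψ u) : StrictMono ψ := strictMono_of_deriv_pos fun t => by
  rw [(H.hasDerivAt t).deriv]; exact Real.exp_pos _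

lemma contDiff (H : FlowCurve f a b ψ u) (hu : ContDiff ℝ ∞ u) : ContDiff ℝ ∞ ψ := by
  refine contDiff_infty_iff_deriv.2 ⟨fun t => (H.hasDerivAt t).differentiableAt, ?_⟩
  have : deriv ψ = fun t => Real.exp (u t) := funext fun t => (H.hasDerivAt t).deriv
  rw [this]
  exact hu.exp

lemma abs_iteratedDeriv_conj_eq (H : FlowCurve f a b ψ u) (hu : ContDiff ℝ ∞ u) {Ψ g E : ℝ → ℝ}
    {c κ σ μ s t : ℝ} (hκ : κ ≠ 0) (hσ : σ * σ = 1)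
    (h : ∀ᶠ τ in nhds t, Ψ τ = c + σ * ((ψ (τ + μ) - c) / κ))
    (h' : ∀ᶠ τ in nhds t, Ψ (τ + s) = c + σ * ((ψ (τ + s + μ) - c) / κ))
    (hg : ∀ᶠ τ in nhds t, g (Ψ τ) = Ψ (τ + s)) (hE : ∀ τ, ψ (τ + s) = E (ψ τ)) (j : ℕ) :
    |iteratedDeriv j (fun y => g y - y) (Ψ t)| =
      |iteratedDeriv j (fun y => chartConj E c κ y - y) ((ψ (t + μ) - c) / κ)| := by
  rw [h.self_of_nhds]
  refine abs_iteratedDeriv_sub_id_eq_of_affine hσ ?_ j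
  have hc : ContDiff ℝ ∞ fun τ => (ψ (τ + μ) - c) / κ := by
    have := H.contDiff hu
    fun_prop
  have hd : deriv (fun τ => (ψ (τ + μ) - c) / κ) t ≠ 0 := by
    have : deriv (fun τ => (ψ (τ + μ) - c) / κ) t = Real.exp (u (t + μ)) / κ :=
      (((H.hasDerivAt (t + μ)).comp_add_const t μ).sub_const c |>.div_const κ).deriv
    rw [this]
    exact div_ne_zero (Real.exp_pos _).ne' hκ
  refine eventually_of_eventually_curve hc.contDiffAt hd
    (P := fun y => g (c + σ * y) = c + σ * chartConj E c κ y) ?_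
  filter_upwards [h, h', hg] with τ h1 h2 h3
  rw [← h1, h3, h2, chartConj, mul_div_cancel₀ _ hκ, add_sub_cancel, ← hE]
  ring_nf

end FlowCurve

lemma FlowCurve.exists_conjOn {r : ℕ} {ε : ℝ} {e : DiffIcc ⊤} {a b : ℝ} {ψ u : ℝ → ℝ}
    (F : FlowCurve e a b ψ u) (hu : ContDiff ℝ ∞ u) {Ψ : ℝ → ℝ} (hΨ : ContDiff ℝ ∞ Ψ)
    (hΨ0 : ∀ t, 0 < deriv Ψ t) {la lb tl tr : ℝ} {m : ℤ}
    (hl : ∀ t ≤ tl, Ψ t = a + la * (ψ t - a)) (hr : ∀ t ≥ tr, Ψ t = b + lb * (ψ (t - m) - b))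
    (hclose : ∀ (t s : ℝ) (g : ℝ → ℝ), (s = 1 ∨ s = -1) →
      (∀ᶠ τ in nhds t, g (Ψ τ) = Ψ (τ + s)) →
        ∀ j ≤ r, |iteratedDeriv j (fun y => g y - y) (Ψ t)| ≤ ε) :
    ∃ (φ : ℝ → ℝ) (m : ℤ), ConjOn r ε e a b la lb φ m ∧ ConjOn r ε e.symm a b la lb φ (-m) := by
  classical
  choose! ξ hξ using F.surj
  have hξψ : ∀ t, ξ (ψ t) = t := fun t => F.strictMono.injective (hξ _ (F.mem t))
  set φ : ℝ → ℝ := fun x => if x ∈ Ioo a b then Ψ (ξ x) else x with hφdef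
  have hφ : ∀ t, φ (ψ t) = Ψ t := fun t => by simp only [hφdef]; rw [if_pos (F.mem t), hξψ]
  have hψ := F.contDiff hu
  have hψ0 : ∀ t, deriv ψ t ≠ 0 := fun t => by
    rw [(F.hasDerivAt t).deriv]; exact (Real.exp_pos _).ne'
  have hsm : ∀ t, ContDiffAt ℝ ∞ φ (ψ t) := fun t =>
    contDiffAt_of_eventually_comp hψ.contDiffAt (hψ0 t) (Eventually.of_forall hφ) hΨ.contDiffAt
  have hφa : φ a = a := by simp [hφdef]
  have hφb : φ b = b := by simp [hφdef]
  have h1 : ContDiffOn ℝ ∞ φ (Ioo a b) := fun x hx => by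
    rw [← hξ x hx]; exact (hsm _).contDiffWithinAt
  have h2 : ∀ x ∈ Ioo a b, 0 < deriv φ x := by
    intro x hx
    rw [← hξ x hx]
    set t := ξ x
    have h3 : HasDerivAt (fun τ => φ (ψ τ)) (deriv φ (ψ t) * Real.exp (u t)) t :=
      ((hsm t).differentiableAt (by simp)).hasDerivAt.comp t (F.hasDerivAt t)
    have h4 : deriv Ψ t = deriv φ (ψ t) * Real.exp (u t) := by
      rw [← h3.deriv]
      simp only [hφ]
    have := hΨ0 t
    rw [h4] at this
    exact pos_of_mul_pos_left this (Real.exp_pos _).le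
  have hleft : ∀ᶠ x in nhdsWithin a (Ici a), φ x = a + la * (x - a) := by
    filter_upwards [Ico_mem_nhdsGE (F.mem tl).1] with x hx
    rcases eq_or_lt_of_le hx.1 with rfl | h
    · simp [hφa]
    · have hxm : x ∈ Ioo a b := ⟨h, hx.2.trans (F.mem tl).2⟩
      have hlt : ξ x ≤ tl := by
        rw [← F.strictMono.le_iff_le, hξ x hxm]; exact hx.2.le
      conv_lhs => rw [← hξ x hxm, hφ, hl _ hlt, hξ x hxm]
  have hright : ∀ᶠ x in nhdsWithin b (Iic b), φ x = b + lb * (zpowFun e (-m) x - b) := by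
    filter_upwards [Ioc_mem_nhdsLE (F.mem tr).2] with x hx
    rcases eq_or_lt_of_le hx.2 with rfl | h
    · have : zpowFun e (-m) x = x := by
        rw [zpowFun]
        split_ifs
        · exact Function.iterate_fixed F.right_fix _
        · exact Function.iterate_fixed F.inv_right _
      rw [hφb, this]
      ring
    · have hxm : x ∈ Ioo a b := ⟨(F.mem tr).1.trans hx.1, h⟩
      have hlt : tr ≤ ξ x := by
        rw [← F.strictMono.le_iff_le, hξ x hxm]; exact hx.1.le
      rw [← hξ x hxm, hφ, hr _ hlt, F.zpow_eq]
      push_cast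
      rw [← sub_eq_add_neg (ξ x)]
  have hcl : ∀ (s : ℝ) (E : ℝ → ℝ), (s = 1 ∨ s = -1) → (∀ τ, ψ (τ + s) = E (ψ τ)) →
      ∀ x ∈ Ioo a b, CloseAt r ε E φ x := by
    intro s E hs hE x hx g hg j hj
    rw [← hξ x hx] at hg ⊢
    rw [hφ]
    refine hclose _ s g hs ?_ j hj
    filter_upwards [(hψ.continuous.tendsto (ξ x)).eventually hg] with τ hτ
    rw [← hφ, hτ, ← hE, hφ]
  refine ⟨φ, -m, ⟨h1, h2, hleft, hright, fun x hx _ => hcl 1 _ (Or.inl rfl) F.step x hx⟩,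
    ⟨h1, h2, hleft, ?_, fun x hx _ => hcl (-1) _ (Or.inr rfl) (fun τ => ?_) x hx⟩⟩
  · rwa [zpowFun_symm_neg]
  · rw [← sub_eq_add_neg, F.step_neg, symm_toFun]

/-- On a component whose two ends are slow after dilation, the map can be conjugated close to the
identity, together with its inverse. -/
theorem IsComponent.exists_conjOn (r : ℕ) : ∀ ε > 0, ∃ δ₀ > 0, ∀ (e : DiffIcc ⊤) (a b : ℝ),
    IsComponent e a b → IAsympVarVanishes e.toFun → ∀ la lb δa δb xa xb : ℝ, 1 ≤ la → 1 ≤ lb →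
      0 < δa → δa ≤ δ₀ → 0 < δb → δb ≤ δ₀ →
      SlowEnd r δa xa (chartConj e.invFun a la⁻¹) (chartConj e.toFun a la⁻¹) →
      SlowEnd r δb xb (chartConj e.toFun b (-lb⁻¹)) (chartConj e.invFun b (-lb⁻¹)) →
      xa + xb ≤ b - a →
      ∃ (φ : ℝ → ℝ) (m : ℤ), ConjOn r ε e a b la lb φ m ∧ ConjOn r ε e.symm a b la lb φ (-m) := by
  obtain ⟨K, hK, HE⟩ := exists_end_curve r
  obtain ⟨K', hK', HJ⟩ := exists_joined_curve r hK
  obtain ⟨C, hC, HS⟩ := exists_shift_bound r hK'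
  intro ε hε
  have hC0 : 0 < C := by linarith
  have hεC : 0 < ε / C := by positivity
  have hεCε : ε / C ≤ ε := div_le_self hε.le hC
  obtain ⟨δ₀, hδ₀, HE⟩ := HE (ε / C) hεC
  refine ⟨δ₀, hδ₀, ?_⟩
  intro e a b H hvar la lb δa δb xa xb hla hlb hδa hδa' hδb hδb' hA hB hroom
  obtain ⟨ψ, u, F⟩ := H.exists_flowCurve hvar
  have hu := (F.contDiff_and_tendsto hvar).1
  have hDa := e.symm.derivWithin_eq_one (e.asympVar_symm hvar) H.left_mem H.inv_left
  have hDb := e.derivWithin_eq_one hvar H.right_mem H.right_fix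
  have hκa : 0 < la⁻¹ := by positivity
  have hκb : -lb⁻¹ < 0 := neg_lt_zero.2 (by positivity)
  have hκa1 : la⁻¹ ≤ 1 := inv_le_one_of_one_le₀ hla
  have hκb1 : lb⁻¹ ≤ 1 := inv_le_one_of_one_le₀ hlb
  have hκb0 : 0 < lb⁻¹ := by positivity
  have Ta := H.contraction_left hκa hDa
  have Tb := H.contraction_right hκb hDb
  have Ca := F.curve_left hκa Ta
  have Cb := F.curve_right hκb Tb
  obtain ⟨hua, hua'⟩ := FlowCurve.contDiff_and_tendsto_of Ta Ca
  obtain ⟨hub, hub'⟩ := FlowCurve.contDiff_and_tendsto_of Tb Cb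
  have hxa := hA.pos
  have hxb := hB.pos
  obtain ⟨sa, hsa⟩ := F.surj (a + la⁻¹ * xa) ⟨by nlinarith, by nlinarith⟩
  obtain ⟨sb, hsb⟩ := F.surj (b + -lb⁻¹ * xb) ⟨by nlinarith, by nlinarith⟩
  obtain ⟨ca, hca, wa, hwa, HA⟩ := HE δa xa _ (-sa) _ _ _ _ hδa hδa' Ca hua hua'
    (by simp only [neg_neg, hsa]; rw [add_sub_cancel_left, mul_div_cancel_left₀ _ hκa.ne']) hA
  obtain ⟨cb, hcb, wb, hwb, HB⟩ := HE δb xb _ sb _ _ _ _ hδb hδb' Cb hub hub'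
    (by simp only [hsb]; rw [add_sub_cancel_left, mul_div_cancel_left₀ _ hκb.ne]) hB
  obtain ⟨w, hw, hwwa, hwwb, hwroom⟩ : ∃ w : ℝ, 0 < w ∧ w ≤ wa ∧ w ≤ wb ∧
      w * (8 + 1 / w ^ (1 - 2 * lossExp r)) ≤ (xa - ca) + (xb - cb) := by
    have hη := lossExp_pos r
    have hcont : ContinuousAt (fun w : ℝ => 8 * w + w ^ (2 * lossExp r)) 0 :=
      (continuousAt_const.mul continuousAt_id).add
        (Real.continuousAt_rpow_const _ _ (Or.inr (by positivity)))
    have h0 : ∀ᶠ w : ℝ in nhds 0, 8 * w + w ^ (2 * lossExp r) < (xa - ca) + (xb - cb) := by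
      refine hcont.eventually (gt_mem_nhds ?_)
      simp only [Real.zero_rpow (mul_pos two_pos hη).ne']
      linarith
    obtain ⟨w, ⟨⟨h1, h2⟩, h3⟩, h4⟩ := (((h0.and (ge_mem_nhds hwa)).and
      (ge_mem_nhds hwb)).filter_mono nhdsWithin_le_nhds |>.and
      (self_mem_nhdsWithin : Ioi (0:ℝ) ∈ nhdsWithin 0 (Ioi 0))).exists
    have h4' : 0 < w := h4
    refine ⟨w, h4', h2, h3, ?_⟩
    have h5 : w * (1 / w ^ (1 - 2 * lossExp r)) = w ^ (2 * lossExp r) := by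
      rw [mul_one_div, ← Real.rpow_one_sub' h4'.le (by linarith)]
      congr 1
      ring
    rw [mul_add, h5]
    linarith
  obtain ⟨hwε, hw1, Ψa, ta, Ta', hac, ha0, ha1, ha2, ha3, ha4, ha5, ha6⟩ := HA w hw hwwa
  obtain ⟨-, -, Ψb, tb, Tb', hbc, hb0, hb1, hb2, hb3, hb4, hb5, hb6⟩ := HB w hw hwwb
  have dA : deriv (fun t => a + Ψa t) = deriv Ψa := funext fun t => deriv_const_add _
  have dB : deriv (fun t => b - Ψb (-t)) = fun t => deriv Ψb (-t) := funext fun t => by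
    rw [deriv_const_sub, deriv_comp_neg, neg_neg]
  obtain ⟨m, Ψ, hΨ, hΨ0, hm, hΨA, hΨB, hΨs⟩ := HJ (ε / C) w Ta' (-Tb') (ta - 1) (1 - tb)
    (fun t => a + Ψa t) (fun t => b - Ψb (-t)) hεC.le hw hwε hw1 (by fun_prop) (by fun_prop)
    (by rw [dA]; exact ha0) (by rw [dB]; exact fun t => hb0 _) (by rw [dA]; exact ha3)
    (by rw [dB]; exact fun t ht => hb3 _ (by linarith)) (by rw [dA]; exact ha5)
    (by rw [dB]; exact fun t ht => (hb5 _ (by linarith)).comp_neg)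
    (by simp only [neg_neg]; linarith)
  have hl : ∀ t ≤ ta, Ψ t = a + (ψ t - a) / la⁻¹ := fun t ht => by
    rw [hΨA t (ht.trans ha2), ha1 t ht, neg_neg]
  have hr : ∀ t, m - tb ≤ t → Ψ t = b - (ψ (t - m) - b) / (-lb⁻¹) := fun t ht => by
    rw [hΨB t (by linarith), hb1 _ (by linarith), neg_neg]
  refine F.exists_conjOn hu hΨ hΨ0 (tl := ta) (tr := m - tb) (m := m)
    (fun t ht => by rw [hl t ht, div_inv_eq_mul, mul_comm])
    (fun t ht => by rw [hr t ht, div_neg, div_inv_eq_mul, mul_comm]; ring) ?_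
  intro t s g hs hg j hj
  have hs1 : |s| ≤ 1 := by rcases hs with rfl | rfl <;> simp
  have hs2 := abs_le.1 hs1
  obtain ⟨E, hE, hEa, hEb⟩ : ∃ E : ℝ → ℝ, (∀ τ, ψ (τ + s) = E (ψ τ)) ∧
      (t < ta - 1 → |iteratedDeriv j (fun y => chartConj E a la⁻¹ y - y)
        ((ψ (t + 0) - a) / la⁻¹)| ≤ ε / C) ∧
      (m + (1 - tb) < t → |iteratedDeriv j (fun y => chartConj E b (-lb⁻¹) y - y)
        ((ψ (t + -m) - b) / (-lb⁻¹))| ≤ ε / C) := by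
    have hA6 : t < ta - 1 → _ := fun h => ha6 t h j hj
    have hB6 : m + (1 - tb) < t → _ := fun h => hb6 (-(t - m)) (by linarith) j hj
    simp only [neg_neg] at hA6 hB6
    rw [add_zero, ← sub_eq_add_neg]
    rcases hs with rfl | rfl
    · exact ⟨e.toFun, F.step, fun h => (hA6 h).2, fun h => (hB6 h).1⟩
    · exact ⟨e.invFun, fun τ => by rw [← sub_eq_add_neg, F.step_neg], fun h => (hA6 h).1,
        fun h => (hB6 h).2⟩
  rcases lt_or_ge t (ta - 1) with h1 | h1
  · rw [F.abs_iteratedDeriv_conj_eq hu hκa.ne' (c := a) (σ := 1) (μ := 0) (by norm_num) ?_ ?_ hg hE]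
    · exact (hEa h1).trans hεCε
    · filter_upwards [gt_mem_nhds h1] with τ hτ
      rw [hl τ (by linarith), add_zero, one_mul]
    · filter_upwards [gt_mem_nhds h1] with τ hτ
      rw [hl (τ + s) (by linarith), add_zero, one_mul]
  rcases le_or_gt t (m + (1 - tb)) with h2 | h2
  · obtain ⟨v, θ, hv, hθ, hwin, hsm⟩ := hΨs t h1 h2
    refine (HS Ψ g s v θ t hs1 hΨ hΨ0 hg hv hθ hwin j hj).trans ?_
    calc C * (v * (θ / v) ^ j) ≤ C * (ε / C) := by gcongr; exact hsm j hj
      _ = ε := by field_simp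
  · rw [F.abs_iteratedDeriv_conj_eq hu hκb.ne (c := b) (σ := -1) (μ := -m) (by norm_num) ?_ ?_ hg hE]
    · exact (hEb h2).trans hεCε
    · filter_upwards [lt_mem_nhds h2] with τ hτ
      rw [hr τ (by linarith), sub_eq_add_neg τ]
      ring
    · filter_upwards [lt_mem_nhds h2] with τ hτ
      rw [hr (τ + s) (by linarith), sub_eq_add_neg (τ + s)]
      ring

end DiffIcc

lemma exists_abs_iteratedDeriv_le_div (j : ℕ) : ∃ C : ℝ, 0 ≤ C ∧ ∀ (Δ : ℝ → ℝ) (α β δ : ℝ), α < β →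
    (∀ x ∈ Icc α β, ContDiffAt ℝ ∞ Δ x) → (∀ x ∈ Icc α β, |Δ x| ≤ δ) →
    ∃ ξ ∈ Icc α β, |iteratedDeriv j Δ ξ| ≤ C * (δ / (β - α) ^ j) := by
  induction j with
  | zero =>
    refine ⟨1, zero_le_one, fun Δ α β δ h _ hδ => ⟨α, left_mem_Icc.2 h.le, ?_⟩⟩
    simpa using hδ α (left_mem_Icc.2 h.le)
  | succ j ih =>
    obtain ⟨C, hC, ih⟩ := ih
    refine ⟨C * 2 * 3 ^ (j + 1), by positivity, fun Δ α β δ h hs hδ => ?_⟩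
    set ρ := β - α with hρ
    have hρ0 : 0 < ρ := sub_pos.2 h
    have hsub1 : Icc α (α + ρ / 3) ⊆ Icc α β := Icc_subset_Icc le_rfl (by linarith)
    have hsub2 : Icc (β - ρ / 3) β ⊆ Icc α β := Icc_subset_Icc (by linarith) le_rfl
    obtain ⟨ξ₁, h1, h1'⟩ := ih Δ α (α + ρ / 3) δ (by linarith) (fun x hx => hs x (hsub1 hx))
      (fun x hx => hδ x (hsub1 hx))
    obtain ⟨ξ₂, h2, h2'⟩ := ih Δ (β - ρ / 3) β δ (by linarith) (fun x hx => hs x (hsub2 hx))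
      (fun x hx => hδ x (hsub2 hx))
    rw [add_sub_cancel_left] at h1'
    rw [sub_sub_cancel] at h2'
    have hlt : ρ / 3 ≤ ξ₂ - ξ₁ := by linarith [h1.2, h2.1]
    have hlt' : ξ₁ < ξ₂ := by linarith
    have hd : ∀ x ∈ Icc α β, HasDerivAt (iteratedDeriv j Δ) (iteratedDeriv (j + 1) Δ x) x := by
      intro x hx
      rw [iteratedDeriv_succ]
      exact (((hs x hx).of_le (natCast_le_infty (1 + j))).iteratedDeriv_nat j
        (k := 1)).differentiableAt (by simp) |>.hasDerivAt
    obtain ⟨ξ, hξ, hξ'⟩ := exists_hasDerivAt_eq_slope (iteratedDeriv j Δ)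
      (iteratedDeriv (j + 1) Δ) hlt'
      (fun x hx => (hd x ⟨h1.1.trans hx.1, hx.2.trans h2.2⟩).continuousAt.continuousWithinAt)
      (fun x hx => hd x ⟨h1.1.trans hx.1.le, hx.2.le.trans h2.2⟩)
    refine ⟨ξ, ⟨h1.1.trans hξ.1.le, hξ.2.le.trans h2.2⟩, ?_⟩
    rw [hξ', abs_div, abs_of_pos (sub_pos.2 hlt'), div_le_iff₀ (by linarith)]
    have hδ0 : 0 ≤ δ := (abs_nonneg _).trans (hδ α (left_mem_Icc.2 h.le))
    calc |iteratedDeriv j Δ ξ₂ - iteratedDeriv j Δ ξ₁|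
        ≤ C * (δ / (ρ / 3) ^ j) + C * (δ / (ρ / 3) ^ j) := (abs_sub _ _).trans (add_le_add h2' h1')
      _ = C * 2 * 3 ^ (j + 1) * (δ / ρ ^ (j + 1)) * (ρ / 3) := by
          rw [div_pow]; field_simp; ring
      _ ≤ _ := by gcongr

/-- Landau's inequalities between the derivatives of a function on an interval. -/
lemma exists_landau_bound (N : ℕ) : ∃ C : ℝ, 0 ≤ C ∧ ∀ (Δ : ℝ → ℝ) (α β δ K : ℝ), α < β →
    (∀ x ∈ Icc α β, ContDiffAt ℝ ∞ Δ x) → (∀ x ∈ Icc α β, |Δ x| ≤ δ) →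
    (∀ x ∈ Icc α β, |iteratedDeriv N Δ x| ≤ K) → ∀ i ≤ N, ∀ x ∈ Icc α β,
    |iteratedDeriv (N - i) Δ x| ≤ C * (δ / (β - α) ^ (N - i)) + K * (β - α) ^ i := by
  choose C hC H using exists_abs_iteratedDeriv_le_div
  set c := ∑ j ∈ Finset.range N, C j with hc
  have hc0 : 0 ≤ c := Finset.sum_nonneg fun j _ => hC j
  refine ⟨N * c, by positivity, fun Δ α β δ K h hs hδ hK => ?_⟩
  set ρ := β - α with hρ
  have hρ0 : 0 < ρ := sub_pos.2 h
  have hδ0 : 0 ≤ δ := (abs_nonneg _).trans (hδ α (left_mem_Icc.2 h.le))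
  have key : ∀ i ≤ N, ∀ x ∈ Icc α β,
      |iteratedDeriv (N - i) Δ x| ≤ i * c * (δ / ρ ^ (N - i)) + K * ρ ^ i := by
    intro i
    induction i with
    | zero => intro _ x hx; simpa using hK x hx
    | succ i ih =>
      intro hi x hx
      obtain ⟨j, hj⟩ : ∃ j, j = N - (i + 1) := ⟨_, rfl⟩
      have hj' : N - i = j + 1 := by omega
      rw [← hj]
      rw [hj'] at ih
      obtain ⟨ξ, hξ, hξ'⟩ := H j Δ α β δ h hs hδ
      rw [← hρ] at hξ'
      have hcj : C j ≤ c := Finset.single_le_sum (fun j _ => hC j) (Finset.mem_range.2 (by omega))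
      have hd : ∀ x ∈ Icc α β, HasDerivAt (iteratedDeriv j Δ) (iteratedDeriv (j + 1) Δ x) x := by
        intro x hx
        rw [iteratedDeriv_succ]
        exact (((hs x hx).of_le (natCast_le_infty (1 + j))).iteratedDeriv_nat j
          (k := 1)).differentiableAt (by simp) |>.hasDerivAt
      have hmv := (convex_Icc α β).norm_image_sub_le_of_norm_hasDerivWithin_le
        (fun y hy => (hd y hy).hasDerivWithinAt) (fun y hy => ih (by omega) y hy) hξ hx
      have hdist : ‖x - ξ‖ ≤ ρ := by
        rw [Real.norm_eq_abs, abs_le]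
        constructor <;> linarith [hx.1, hx.2, hξ.1, hξ.2]
      have h0 : 0 ≤ i * c * (δ / ρ ^ (j + 1)) + K * ρ ^ i :=
        (abs_nonneg _).trans (ih (by omega) x hx)
      have h1 : |iteratedDeriv j Δ x| ≤ |iteratedDeriv j Δ ξ| +
          (i * c * (δ / ρ ^ (j + 1)) + K * ρ ^ i) * ρ := by
        have h2 := abs_sub_abs_le_abs_sub (iteratedDeriv j Δ x) (iteratedDeriv j Δ ξ)
        have h3 := hmv.trans (mul_le_mul_of_nonneg_left hdist h0)
        rw [Real.norm_eq_abs] at h3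
        linarith
      refine h1.trans ((add_le_add_left (hξ'.trans (mul_le_mul_of_nonneg_right hcj
        (by positivity))) _).trans_eq ?_)
      push_cast
      field_simp
      ring
  intro i hi x hx
  refine (key i hi x hx).trans ?_
  gcongr

/-- The order of differentiability used for slow ends. -/
def slowOrder (r : ℕ) : ℕ := 4 * (r + 1) * (r + 3)

lemma exists_landau_rpow (r : ℕ) {K : ℝ} (hK : 0 ≤ K) : ∃ δ₁ > 0, δ₁ ≤ 1 ∧
    ∀ (Δ : ℝ → ℝ) (α δ : ℝ), 0 < δ → δ ≤ δ₁ →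
    (∀ x ∈ Icc α (α + δ ^ (1 / (slowOrder r : ℝ))), ContDiffAt ℝ ∞ Δ x) →
    (∀ x ∈ Icc α (α + δ ^ (1 / (slowOrder r : ℝ))), |Δ x| ≤ δ) →
    (∀ x ∈ Icc α (α + δ ^ (1 / (slowOrder r : ℝ))), |iteratedDeriv (slowOrder r) Δ x| ≤ K) →
    ∀ j ≤ r + 2, ∀ x ∈ Icc α (α + δ ^ (1 / (slowOrder r : ℝ))),
      |iteratedDeriv j Δ x| ≤ δ ^ (1 - lossExp r) := by
  set N := slowOrder r with hN
  obtain ⟨C, hC, H⟩ := exists_landau_bound N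
  have hN0 : 0 < N := by rw [hN, slowOrder]; positivity
  have hNr : r + 3 ≤ N := by rw [hN, slowOrder]; nlinarith
  have hNR : (N : ℝ) = 4 * (r + 1) * (r + 3) := by rw [hN, slowOrder]; push_cast; ring
  refine ⟨(1 / (C + K + 1)) ^ N, by positivity, pow_le_one₀ (by positivity) ?_, ?_⟩
  · rw [div_le_one (by positivity)]; linarith
  intro Δ α δ hδ hδ₁ hs hΔ hD j hj x hx
  set ρ := δ ^ (1 / (N : ℝ)) with hρ
  have hρ0 : 0 < ρ := Real.rpow_pos_of_pos hδ _
  have hρN : ρ ^ N = δ := by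
    rw [hρ, ← Real.rpow_mul_natCast hδ.le, one_div_mul_cancel (by positivity), Real.rpow_one]
  have hρ1 : ρ ≤ 1 / (C + K + 1) := by
    rw [← hρN] at hδ₁
    exact le_of_pow_le_pow_left₀ hN0.ne' (by positivity) hδ₁
  have hρ2 : (C + K) * ρ ≤ 1 := by
    rw [le_div_iff₀ (by positivity)] at hρ1
    nlinarith
  have hρle : ρ ≤ 1 := hρ1.trans (by rw [div_le_one (by positivity)]; linarith)
  have hexp : δ ^ (1 - lossExp r) = ρ ^ (N - (r + 3)) := by
    rw [hρ, ← Real.rpow_mul_natCast hδ.le]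
    congr 1
    rw [Nat.cast_sub hNr, lossExp]
    have : (N : ℝ) ≠ 0 := by positivity
    field_simp
    rw [hNR]
    push_cast
    ring
  have h := H Δ α (α + ρ) δ K (by linarith) hs hΔ hD (N - j) (by omega) x hx
  rw [Nat.sub_sub_self (by omega), add_sub_cancel_left] at h
  have h1 : δ / ρ ^ j = ρ ^ (N - j) := by
    rw [div_eq_iff (by positivity), ← pow_add, Nat.sub_add_cancel (by omega), hρN]
  rw [h1, ← add_mul, show N - j = (N - (r + 3)) + 1 + (r + 2 - j) by omega, pow_add, pow_succ] at h
  rw [hexp]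
  calc |iteratedDeriv j Δ x| ≤ (C + K) * (ρ ^ (N - (r + 3)) * ρ * ρ ^ (r + 2 - j)) := h
    _ = ((C + K) * ρ) * (ρ ^ (N - (r + 3)) * ρ ^ (r + 2 - j)) := by ring
    _ ≤ 1 * (ρ ^ (N - (r + 3)) * 1) := by
        gcongr
        exact pow_le_one₀ hρ0.le hρle
    _ = _ := by ring

lemma chart_mem {c κ x y : ℝ} (hc : c ∈ Icc (0:ℝ) 1) (hx : c + κ * x ∈ Ioo (0:ℝ) 1)
    (hy : y ∈ Ioc 0 x) (hκ : κ ≠ 0) : c + κ * y ∈ Ioo (0:ℝ) 1 := by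
  rcases lt_or_gt_of_ne hκ with h | h
  · have h1 : κ * y < 0 := mul_neg_of_neg_of_pos h hy.1
    have h2 : κ * x ≤ κ * y := mul_le_mul_of_nonpos_left hy.2 h.le
    exact ⟨by linarith [hx.1], by linarith [hc.2]⟩
  · have h1 : 0 < κ * y := mul_pos h hy.1
    have h2 : κ * y ≤ κ * x := mul_le_mul_of_nonneg_left hy.2 h.le
    exact ⟨by linarith [hc.1], by linarith [hx.2]⟩

lemma chart_chartConj (g : ℝ → ℝ) (c : ℝ) {κ : ℝ} (hκ : κ ≠ 0) (y : ℝ) :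
    c + κ * chartConj g c κ y = g (c + κ * y) := by
  rw [chartConj, mul_div_cancel₀ _ hκ]; ring

namespace DiffIcc

lemma mapsTo_Ioo (f : DiffIcc ⊤) : MapsTo f.toFun (Ioo 0 1) (Ioo 0 1) := fun x hx =>
  ⟨by simpa [f.fix0] using f.strictMonoOn (by simp) (Ioo_subset_Icc_self hx) hx.1,
    by simpa [f.fix1] using f.strictMonoOn (Ioo_subset_Icc_self hx) (by simp) hx.2⟩

lemma chartConj_strictMono (f : DiffIcc ⊤) {c κ x y : ℝ} (hκ : κ ≠ 0)
    (hx : c + κ * x ∈ Icc (0:ℝ) 1) (hy : c + κ * y ∈ Icc (0:ℝ) 1) (h : x < y) :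
    chartConj f.toFun c κ x < chartConj f.toFun c κ y := by
  rcases lt_or_gt_of_ne hκ with h1 | h1
  · have := f.strictMonoOn hy hx (by nlinarith)
    exact (div_lt_div_right_of_neg h1).2 (by linarith)
  · have := f.strictMonoOn hx hy (by nlinarith)
    exact (div_lt_div_iff_of_pos_right h1).2 (by linarith)

lemma chartConj_symm_chartConj (f : DiffIcc ⊤) {c κ x : ℝ} (hκ : κ ≠ 0)
    (hx : c + κ * x ∈ Icc (0:ℝ) 1) : chartConj f.invFun c κ (chartConj f.toFun c κ x) = x := by
  rw [chartConj, chart_chartConj _ _ hκ, f.left_inv _ hx, add_sub_cancel_left,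
    mul_div_cancel_left₀ _ hκ]

lemma chartConj_zero {f : ℝ → ℝ} {c κ : ℝ} (hfc : f c = c) : chartConj f c κ 0 = 0 := by
  simp [chartConj, hfc]

lemma nearId_chartConj (f : DiffIcc ⊤) (r : ℕ) : ∃ δ₁ > 0, δ₁ ≤ 1 ∧ ∀ c κ δ X : ℝ, κ ≠ 0 → |κ| ≤ 1 →
    (∀ y ∈ Ioc 0 X, c + κ * y ∈ Ioo (0:ℝ) 1) → 0 < δ → δ ≤ δ₁ →
    2 * δ ^ (1 / (slowOrder r : ℝ)) ≤ X → (∀ y ∈ Ioc 0 X, |chartConj f.toFun c κ y - y| ≤ δ) →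
    ∀ y ∈ Ioc 0 X, NearId (r + 2) δ (δ ^ (1 - lossExp r)) (chartConj f.toFun c κ) y := by
  obtain ⟨K, hK, hKb⟩ := f.exists_bound (slowOrder r)
  obtain ⟨δ₁, hδ₁, hδ₁', H⟩ := exists_landau_rpow r hK
  refine ⟨δ₁, hδ₁, hδ₁', fun c κ δ X hκ hκ1 hmem hδ hδδ hX hΔ y hy => ⟨hΔ y hy, fun j _ hjr => ?_⟩⟩
  set N := slowOrder r with hN
  have hN2 : 2 ≤ N := by rw [hN, slowOrder]; nlinarith
  set ρ := δ ^ (1 / (N : ℝ)) with hρ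
  have hρ0 : 0 < ρ := Real.rpow_pos_of_pos hδ _
  obtain ⟨α, hα, hαy⟩ : ∃ α, Icc α (α + ρ) ⊆ Ioc 0 X ∧ y ∈ Icc α (α + ρ) := by
    rcases le_or_gt (y + ρ) X with h | h
    · exact ⟨y, fun z hz => ⟨hy.1.trans_le hz.1, hz.2.trans h⟩, ⟨le_rfl, by linarith⟩⟩
    · exact ⟨y - ρ, fun z hz => ⟨by linarith [hz.1], by linarith [hz.2, hy.2]⟩,
        ⟨by linarith, by linarith⟩⟩
  have hT : ∀ z ∈ Ioc 0 X, ContDiffAt ℝ ∞ (chartConj f.toFun c κ) z := by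
    intro z hz
    have h1 : ContDiffAt ℝ ∞ (fun y => f.toFun (c + κ * y)) z :=
      (f.contDiffAt (hmem z hz)).comp z (by fun_prop)
    exact (h1.sub contDiffAt_const).div_const κ
  refine H (fun y => chartConj f.toFun c κ y - y) α δ hδ hδδ
    (fun z hz => (hT z (hα hz)).sub contDiffAt_id) (fun z hz => hΔ z (hα hz)) (fun z hz => ?_) j hjr
    y hαy
  rw [iteratedDeriv_sub_id ((hT z (hα hz)).of_le (natCast_le_infty _)),
    iteratedDeriv_id_of_two_le hN2, sub_zero]
  obtain ⟨M, hM⟩ : ∃ M, N = M + 1 := ⟨N - 1, by omega⟩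
  have h2 := hKb _ (Ioo_subset_Icc_self (hmem z (hα hz)))
  rw [f.iteratedDerivWithin_eq _ (hmem z (hα hz)), hM] at h2
  rw [hM, iteratedDeriv_chartConj _ _ hκ, abs_mul, abs_pow]
  calc |κ| ^ M * _ ≤ 1 * K := by
        gcongr
        exact pow_le_one₀ (abs_nonneg _) hκ1
    _ = K := one_mul K

/-- A point realizing the maximal displacement in a chart gives a slow end. -/
lemma exists_slowEnd_of_max (f : DiffIcc ⊤) (r : ℕ) : ∃ δ₁ > 0, ∀ c κ δ x₁ : ℝ, c ∈ Icc (0:ℝ) 1 →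
    f.toFun c = c → κ ≠ 0 → |κ| ≤ 1 → c + κ * x₁ ∈ Ioo (0:ℝ) 1 → 0 < x₁ → x₁ ≤ 1 → 0 < δ → δ ≤ δ₁ →
    3 ^ slowOrder r * δ ≤ x₁ ^ slowOrder r → |chartConj f.toFun c κ x₁ - x₁| = δ →
    (∀ y ∈ Ioc 0 x₁, |chartConj f.toFun c κ y - y| ≤ δ) →
    SlowEnd r δ x₁ (chartConj f.toFun c κ) (chartConj f.invFun c κ) := by
  obtain ⟨δ₁, hδ₁, hle, H⟩ := f.nearId_chartConj r
  obtain ⟨δ₂, hδ₂, -, H'⟩ := f.symm.nearId_chartConj r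
  refine ⟨min δ₁ δ₂, lt_min hδ₁ hδ₂, ?_⟩
  intro c κ δ x₁ hc hfc hκ hκ1 hx hx0 hx1 hδ hδ' hN hhit hmax
  set N := slowOrder r with hNdef
  have hN1 : 1 ≤ N := by rw [hNdef, slowOrder]; nlinarith
  have hδ1 : δ ≤ 1 := hδ'.trans ((min_le_left _ _).trans hle)
  set ρ := δ ^ (1 / (N : ℝ)) with hρ
  have hρ0 : 0 < ρ := Real.rpow_pos_of_pos hδ _
  have hρN : ρ ^ N = δ := by
    rw [hρ, ← Real.rpow_mul_natCast hδ.le, one_div_mul_cancel (by positivity), Real.rpow_one]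
  have h3 : 3 * ρ ≤ x₁ := by
    refine le_of_pow_le_pow_left₀ (n := N) (by omega) hx0.le ?_
    rwa [mul_pow, hρN]
  have hδρ : δ ≤ ρ := by
    calc δ = δ ^ (1 : ℝ) := (Real.rpow_one δ).symm
      _ ≤ ρ := Real.rpow_le_rpow_of_exponent_ge hδ hδ1 (by
        rw [div_le_one (by positivity)]; exact_mod_cast hN1)
  set S := chartConj f.toFun c κ with hS
  have hmem : ∀ y ∈ Ioc 0 x₁, c + κ * y ∈ Ioo (0:ℝ) 1 := fun y hy => chart_mem hc hx hy hκ
  have hx' : c + κ * S x₁ ∈ Ioo (0:ℝ) 1 := by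
    rw [hS, chart_chartConj _ _ hκ]; exact f.mapsTo_Ioo hx
  have hmem' : ∀ y ∈ Ioc 0 (S x₁), c + κ * y ∈ Ioo (0:ℝ) 1 := fun y hy => chart_mem hc hx' hy hκ
  have hfc' : f.symm.toFun c = c := by
    have := f.left_inv c hc
    rwa [hfc] at this
  have hback : ∀ z ∈ Ioc 0 (S x₁), chartConj f.invFun c κ z ∈ Ioc 0 x₁ ∧
      S (chartConj f.invFun c κ z) = z := by
    intro z hz
    have hz' := Ioo_subset_Icc_self (hmem' z hz)
    refine ⟨⟨?_, ?_⟩, f.symm.chartConj_symm_chartConj hκ hz'⟩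
    · have := f.symm.chartConj_strictMono hκ (x := 0) (by simpa using hc) hz' hz.1
      rwa [chartConj_zero hfc'] at this
    · rcases hz.2.eq_or_lt with h | h
      · rw [h, hS, f.chartConj_symm_chartConj hκ (Ioo_subset_Icc_self hx)]
      · have := f.symm.chartConj_strictMono hκ hz' (Ioo_subset_Icc_self hx') h
        rw [symm_toFun, hS, f.chartConj_symm_chartConj hκ (Ioo_subset_Icc_self hx)] at this
        exact this.le
  refine ⟨hx0, hx1, hhit, H c κ δ x₁ hκ hκ1 hmem hδ (hδ'.trans (min_le_left _ _))
    (by linarith) hmax, ?_⟩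
  refine H' c κ δ (S x₁) hκ hκ1 hmem' hδ (hδ'.trans (min_le_right _ _)) ?_ fun z hz => ?_
  · have := (abs_le.1 hhit.le).1
    linarith
  · obtain ⟨h1, h2⟩ := hback z hz
    have := hmax _ h1
    rw [h2, abs_sub_comm] at this
    exact this

/-- The first nonlinear Taylor term at a parabolic fixed point. -/
lemma sub_id_isLittleO (f : DiffIcc ⊤) {c : ℝ} (hc : c ∈ Icc (0:ℝ) 1) (hfc : f.toFun c = c)
    (hD : derivWithin f.toFun (Icc 0 1) c = 1) {k : ℕ} (hk : 2 ≤ k)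
    (h0 : ∀ j, 2 ≤ j → j < k → iteratedDerivWithin j f.toFun (Icc 0 1) c = 0) :
    (fun x => f.toFun x - x - iteratedDerivWithin k f.toFun (Icc 0 1) c / k.factorial * (x - c) ^ k)
      =o[nhdsWithin c (Icc 0 1)] fun x => (x - c) ^ k := by
  have h := taylor_isLittleO (convex_Icc (0:ℝ) 1) hc (n := k)
    (f.smooth'.of_le (natCast_le_infty k))
  refine h.congr_left fun x => ?_
  obtain ⟨i, rfl⟩ : ∃ i, k = i + 2 := ⟨k - 2, by omega⟩
  rw [taylor_within_apply, Finset.sum_range_succ, Finset.sum_range_succ', Finset.sum_range_succ',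
    Finset.sum_eq_zero]
  · simp [hfc, iteratedDerivWithin_one, hD]
    ring
  · intro j hj
    rw [h0 (j + 1 + 1) (by omega) (by have := Finset.mem_range.1 hj; omega), smul_zero]

lemma exists_ball_abs_sub_le {f : ℝ → ℝ} {c a s : ℝ} {k : ℕ} (hs : 0 < s)
    (h : (fun x => f x - x - a * (x - c) ^ k) =o[nhdsWithin c (Icc 0 1)] fun x => (x - c) ^ k) :
    ∃ η > 0, ∀ x ∈ Icc (0:ℝ) 1, |x - c| < η → |f x - x - a * (x - c) ^ k| ≤ s * |x - c| ^ k := by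
  have h1 := h.def hs
  obtain ⟨η, hη, h1⟩ := Metric.mem_nhdsWithin_iff.1 h1
  refine ⟨η, hη, fun x hx hxc => ?_⟩
  have := h1 ⟨by rwa [Metric.mem_ball, Real.dist_eq], hx⟩
  rwa [mem_ofPred_eq, Real.norm_eq_abs, Real.norm_eq_abs, abs_pow] at this

/-- An ITI fixed point is flat to every order. -/
lemma abs_sub_le_of_ITIat (f : DiffIcc ⊤) {c : ℝ} (hc : c ∈ Icc (0:ℝ) 1) (hfc : f.toFun c = c)
    (h : ITIat f.toFun c) {k : ℕ} (hk : 2 ≤ k) :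
    ∃ η > 0, ∀ x ∈ Icc (0:ℝ) 1, |x - c| < η → |f.toFun x - x| ≤ |x - c| ^ k := by
  have h1 := f.sub_id_isLittleO hc hfc h.1 hk fun j hj _ => h.2 j hj
  obtain ⟨η, hη, H⟩ := exists_ball_abs_sub_le one_pos h1
  refine ⟨η, hη, fun x hx hxc => ?_⟩
  have := H x hx hxc
  rw [h.2 k hk] at this
  simpa using this

/-- A parabolic fixed point which is not ITI has finite order of contact with the identity. -/
lemma exists_order_of_not_ITIat (f : DiffIcc ⊤) {c : ℝ} (hc : c ∈ Icc (0:ℝ) 1)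
    (hfc : f.toFun c = c) (hD : derivWithin f.toFun (Icc 0 1) c = 1) (h : ¬ ITIat f.toFun c) :
    ∃ k ≥ 2, ∃ A > 0, ∃ η > 0, ∀ x ∈ Icc (0:ℝ) 1, |x - c| < η →
      A * |x - c| ^ k ≤ |f.toFun x - x| ∧ |f.toFun x - x| ≤ 4 * A * |x - c| ^ k := by
  have h1 : ∃ k, 2 ≤ k ∧ iteratedDerivWithin k f.toFun (Icc 0 1) c ≠ 0 := by
    by_contra! hne
    exact h ⟨hD, hne⟩
  classical
  obtain ⟨hk, hk0⟩ := Nat.find_spec h1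
  set k := Nat.find h1
  have h2 := f.sub_id_isLittleO hc hfc hD hk fun j hj hjk => by
    by_contra hne
    exact Nat.find_min h1 hjk ⟨hj, hne⟩
  set a := iteratedDerivWithin k f.toFun (Icc 0 1) c / k.factorial with ha
  have ha0 : 0 < |a| := abs_pos.2 (div_ne_zero hk0 (by positivity))
  obtain ⟨η, hη, H⟩ := exists_ball_abs_sub_le (half_pos ha0) h2
  refine ⟨k, hk, |a| / 2, by positivity, η, hη, fun x hx hxc => ?_⟩
  have h3 := H x hx hxc
  have h4 : |a * (x - c) ^ k| = |a| * |x - c| ^ k := by rw [abs_mul, abs_pow]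
  have h5 := abs_sub_abs_le_abs_sub (f.toFun x - x) (a * (x - c) ^ k)
  have h6 := abs_sub_abs_le_abs_sub (a * (x - c) ^ k) (f.toFun x - x)
  rw [abs_sub_comm (a * (x - c) ^ k)] at h6
  have h7 : 0 ≤ |a| * |x - c| ^ k := by positivity
  constructor <;> nlinarith

lemma exists_isolated_of_not_ITIat (f : DiffIcc ⊤) {c : ℝ} (hc : c ∈ Icc (0:ℝ) 1)
    (hfc : f.toFun c = c) (hD : derivWithin f.toFun (Icc 0 1) c = 1) (h : ¬ ITIat f.toFun c) :
    ∃ η > 0, ∀ x ∈ Icc (0:ℝ) 1, |x - c| < η → f.toFun x = x → x = c := by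
  obtain ⟨k, hk, A, hA, η, hη, H⟩ := f.exists_order_of_not_ITIat hc hfc hD h
  refine ⟨η, hη, fun x hx hxc hfx => ?_⟩
  have h1 := (H x hx hxc).1
  rw [hfx, sub_self, abs_zero] at h1
  have h2 : |x - c| ^ k ≤ 0 := by by_contra! h2; nlinarith
  have h3 : |x - c| = 0 := eq_zero_of_pow_eq_zero (le_antisymm h2 (by positivity))
  exact sub_eq_zero.1 (abs_eq_zero.1 h3)

lemma ITIat_of_eventually_eq (f : DiffIcc ⊤) {x : ℝ} (hx : x ∈ Ioo (0:ℝ) 1)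
    (h : ∀ᶠ y in nhds x, f.toFun y = y) : ITIat f.toFun x := by
  have h1 : f.toFun =ᶠ[nhds x] id := h
  refine ⟨?_, fun k hk => ?_⟩
  · rw [derivWithin_eq _ hx, h1.deriv_eq, deriv_id]
  · rw [f.iteratedDerivWithin_eq k hx, h1.iteratedDeriv_eq, iteratedDeriv_id_of_two_le hk]

lemma chartConj_sub (g : ℝ → ℝ) {c κ : ℝ} (hκ : κ ≠ 0) (y : ℝ) :
    chartConj g c κ y - y = (g (c + κ * y) - (c + κ * y)) / κ := by
  rw [chartConj]; field_simp; ring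

/-- The point of maximal displacement gives a slow end as soon as this displacement is small. -/
lemma exists_slowEnd_of_small (f : DiffIcc ⊤) (r : ℕ) : ∃ δ₁ > 0, ∀ c κ X : ℝ, c ∈ Icc (0:ℝ) 1 →
    f.toFun c = c → κ ≠ 0 → |κ| ≤ 1 → c + κ * X ∈ Ioo (0:ℝ) 1 → 0 < X → X ≤ 1 →
    (∃ y ∈ Ioc 0 X, chartConj f.toFun c κ y ≠ y) →
    (∀ y ∈ Ioc 0 X, (∀ z ∈ Ioc 0 X, |chartConj f.toFun c κ z - z| ≤ |chartConj f.toFun c κ y - y|) →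
      |chartConj f.toFun c κ y - y| ≤ δ₁ ∧
        3 ^ slowOrder r * |chartConj f.toFun c κ y - y| ≤ y ^ slowOrder r) →
    ∃ x₁ ∈ Ioc 0 X, ∃ δ > 0,
      (∀ y ∈ Ioc 0 X, |chartConj f.toFun c κ y - y| ≤ δ) ∧
      SlowEnd r δ x₁ (chartConj f.toFun c κ) (chartConj f.invFun c κ) := by
  obtain ⟨δ₁, hδ₁, H⟩ := f.exists_slowEnd_of_max r
  refine ⟨δ₁, hδ₁, fun c κ X hc hfc hκ hκ1 hcX hX hX1 ⟨y₀, hy₀, hne⟩ hsmall => ?_⟩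
  set S := chartConj f.toFun c κ with hS
  have hmem : ∀ y ∈ Icc 0 X, c + κ * y ∈ Icc (0:ℝ) 1 := by
    intro y hy
    rcases hy.1.eq_or_lt with h | h
    · rw [← h]; simpa using hc
    · exact Ioo_subset_Icc_self (chart_mem hc hcX ⟨h, hy.2⟩ hκ)
  have hcont : ContinuousOn (fun y => |S y - y|) (Icc 0 X) := by
    have h1 : ContinuousOn (fun y => f.toFun (c + κ * y)) (Icc 0 X) :=
      f.smooth'.continuousOn.comp (by fun_prop) hmem
    exact (((h1.sub continuousOn_const).div_const κ).sub continuousOn_id).abs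
  obtain ⟨x₁, hx₁, hmax⟩ := isCompact_Icc.exists_isMaxOn (nonempty_Icc.2 hX.le) hcont
  have hpos : 0 < |S x₁ - x₁| :=
    (abs_pos.2 (sub_ne_zero.2 hne)).trans_le (hmax (Ioc_subset_Icc_self hy₀))
  have hx₁0 : 0 < x₁ := by
    refine hx₁.1.lt_of_ne fun h => ?_
    rw [← h, hS, chartConj_zero hfc] at hpos
    simp at hpos
  have hmax' : ∀ z ∈ Ioc 0 X, |S z - z| ≤ |S x₁ - x₁| := fun z hz => hmax (Ioc_subset_Icc_self hz)
  obtain ⟨h1, h2⟩ := hsmall x₁ ⟨hx₁0, hx₁.2⟩ hmax'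
  exact ⟨x₁, ⟨hx₁0, hx₁.2⟩, _, hpos, hmax', H c κ _ x₁ hc hfc hκ hκ1
    (chart_mem hc hcX ⟨hx₁0, hx₁.2⟩ hκ) hx₁0 (hx₁.2.trans hX1) hpos h1 h2 rfl
    fun y hy => hmax' y ⟨hy.1, hy.2.trans hx₁.2⟩⟩

/-- Slow ends exist at ITI endpoints. -/
lemma exists_slowEnd_of_ITIat (f : DiffIcc ⊤) (r : ℕ)
    (hITI : ∀ x ∈ Ioo (0:ℝ) 1, f.toFun x = x → ¬ ITIat f.toFun x) {c κ : ℝ}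
    (hc : c ∈ Icc (0:ℝ) 1) (hfc : f.toFun c = c) (h : ITIat f.toFun c) (hκ : |κ| = 1)
    (hmem : ∀ y ∈ Ioo (0:ℝ) 1, c + κ * y ∈ Ioo (0:ℝ) 1) {X δ₀ : ℝ} (hX : 0 < X) (hδ₀ : 0 < δ₀) :
    ∃ δ x₁, 0 < δ ∧ δ ≤ δ₀ ∧ x₁ + δ ≤ X ∧
      (∀ y ∈ Ioc 0 x₁, |chartConj f.toFun c κ y - y| ≤ δ) ∧
      SlowEnd r δ x₁ (chartConj f.toFun c κ) (chartConj f.invFun c κ) := by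
  obtain ⟨δ₁, hδ₁, H⟩ := f.exists_slowEnd_of_small r
  set N := slowOrder r with hN
  have hN2 : 2 ≤ N := by rw [hN, slowOrder]; nlinarith
  obtain ⟨η, hη, hflat⟩ := f.abs_sub_le_of_ITIat hc hfc h (k := N + 1) (by omega)
  have hκ0 : κ ≠ 0 := by rintro rfl; simp at hκ
  obtain ⟨Y, hY0, hYX, hYη, hY3, hYδ₁, hYδ₀, hY1⟩ : ∃ Y : ℝ, 0 < Y ∧ 2 * Y ≤ X ∧ Y < η ∧
      3 ^ N * Y ≤ 1 ∧ Y ≤ δ₁ ∧ Y ≤ δ₀ ∧ Y < 1 := by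
    refine ⟨min (X / 2) (min (η / 2) (min (1 / 3 ^ N) (min δ₁ (min δ₀ (1 / 2))))),
      by positivity, ?_, ?_, ?_, ?_, ?_, ?_⟩
    · linarith [min_le_left (X / 2) (min (η / 2) (min (1 / 3 ^ N) (min δ₁ (min δ₀ (1 / 2)))))]
    · refine lt_of_le_of_lt ?_ (half_lt_self hη)
      simp
    · rw [← le_div_iff₀' (by positivity)]
      simp
    · simp
    · simp
    · refine lt_of_le_of_lt ?_ (one_half_lt_one)
      simp
  set S := chartConj f.toFun c κ with hS
  have hE : ∀ y ∈ Ioc 0 Y, |S y - y| ≤ y ^ (N + 1) := by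
    intro y hy
    have h1 := hmem y ⟨hy.1, hy.2.trans_lt hY1⟩
    have h2 : |c + κ * y - c| = y := by rw [add_sub_cancel_left, abs_mul, hκ, one_mul, abs_of_pos hy.1]
    have h3 := hflat _ (Ioo_subset_Icc_self h1) (by rw [h2]; linarith [hy.2])
    rw [h2] at h3
    rwa [hS, chartConj_sub _ hκ0, abs_div, hκ, div_one]
  have hsmall : ∀ y ∈ Ioc 0 Y, |S y - y| ≤ Y ∧ 3 ^ N * |S y - y| ≤ y ^ N := by
    intro y hy
    have h1 : y ^ N ≤ 1 := pow_le_one₀ hy.1.le (hy.2.trans hY1.le)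
    have h2 := hE y hy
    rw [pow_succ] at h2
    have h3 : 0 < y ^ N := pow_pos hy.1 _
    constructor
    · nlinarith [hy.1, hy.2]
    · calc 3 ^ N * |S y - y| ≤ 3 ^ N * (y ^ N * Y) := by
            gcongr
            exact h2.trans (by gcongr; exact hy.2)
        _ = (3 ^ N * Y) * y ^ N := by ring
        _ ≤ y ^ N := mul_le_of_le_one_left h3.le hY3
  obtain ⟨x₁, hx₁, δ, hδ, hmax, hslow⟩ := H c κ Y hc hfc hκ0 hκ.le (hmem Y ⟨hY0, hY1⟩) hY0 hY1.le
    (by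
      by_contra! hid
      have h1 := hmem (Y / 2) ⟨by linarith, by linarith⟩
      have h2 : ∀ᶠ z in nhds (c + κ * (Y / 2)), f.toFun z = z := by
        have hcont : Tendsto (fun z : ℝ => (z - c) / κ) (nhds (c + κ * (Y / 2))) (nhds (Y / 2)) := by
          have : (c + κ * (Y / 2) - c) / κ = Y / 2 := by field_simp; ring
          conv_rhs => rw [← this]
          exact Continuous.tendsto (by fun_prop) _
        filter_upwards [hcont.eventually (Ioo_mem_nhds (by linarith : 0 < Y / 2)
          (by linarith : Y / 2 < Y))] with z hz
        have h3 := hid _ (Ioo_subset_Ioc_self hz)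
        have h4 := chart_chartConj f.toFun c hκ0 ((z - c) / κ)
        rw [h3, mul_div_cancel₀ _ hκ0, add_sub_cancel] at h4
        exact h4.symm
      exact hITI _ h1 h2.self_of_nhds (f.ITIat_of_eventually_eq h1 h2))
    (fun y hy _ => ⟨(hsmall y hy).1.trans hYδ₁, (hsmall y hy).2⟩)
  have hδY : δ ≤ Y := by rw [← hslow.hit]; exact (hsmall x₁ hx₁).1
  exact ⟨δ, x₁, hδ, hδY.trans hYδ₀, by linarith [hx₁.2], fun y hy => hmax y ⟨hy.1, hy.2.trans hx₁.2⟩,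
    hslow⟩

/-- Slow ends exist, after a large dilation, at parabolic fixed points which are not ITI. -/
lemma exists_slowEnd_of_not_ITIat (f : DiffIcc ⊤) (r : ℕ) {c σ : ℝ} (hc : c ∈ Icc (0:ℝ) 1)
    (hfc : f.toFun c = c) (hD : derivWithin f.toFun (Icc 0 1) c = 1) (h : ¬ ITIat f.toFun c)
    (hσ : |σ| = 1) (hmem : ∃ η > 0, ∀ y ∈ Ioo (0:ℝ) η, c + σ * y ∈ Ioo (0:ℝ) 1) {X δ₀ : ℝ}
    (hX : 0 < X) (hδ₀ : 0 < δ₀) :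
    ∃ L ≥ 1, ∀ l ≥ L, ∃ δ x₁, 0 < δ ∧ δ ≤ δ₀ ∧ x₁ + δ ≤ X ∧
      SlowEnd r δ x₁ (chartConj f.toFun c (σ / l)) (chartConj f.invFun c (σ / l)) := by
  obtain ⟨δ₁, hδ₁, H⟩ := f.exists_slowEnd_of_small r
  set N := slowOrder r with hN
  have hN2 : 2 ≤ N := by rw [hN, slowOrder]; nlinarith
  obtain ⟨k, hk, A, hA, η, hη, hord⟩ := f.exists_order_of_not_ITIat hc hfc hD h
  obtain ⟨η', hη', hmem⟩ := hmem
  obtain ⟨Y, hY0, hYX, hY1⟩ : ∃ Y : ℝ, 0 < Y ∧ 2 * Y ≤ X ∧ Y < 1 := by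
    refine ⟨min (X / 2) (1 / 2), by positivity, ?_, ?_⟩
    · linarith [min_le_left (X / 2) (1 / 2)]
    · linarith [min_le_right (X / 2) (1 / 2)]
  obtain ⟨q, hq, hqY, hqδ₁, hqδ₀, hq3⟩ : ∃ q : ℝ, 0 < q ∧ q ≤ Y ∧ q ≤ δ₁ ∧ q ≤ δ₀ ∧
      3 ^ N * q ≤ (Y ^ k / 4) ^ N := by
    refine ⟨min Y (min δ₁ (min δ₀ ((Y ^ k / 4) ^ N / 3 ^ N))), by positivity, ?_, ?_, ?_, ?_⟩
    · simp
    · simp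
    · simp
    · rw [← le_div_iff₀' (by positivity)]
      simp
  refine ⟨max 1 (max (1 / η') (max (1 / η) (4 * A / q))), le_max_left _ _, fun l hl => ?_⟩
  simp only [ge_iff_le, max_le_iff] at hl
  obtain ⟨hl1, hlη', hlη, hlq⟩ := hl
  have hl0 : 0 < l := by linarith
  rw [div_le_iff₀ hη'] at hlη'
  rw [div_le_iff₀ hη] at hlη
  rw [div_le_iff₀ hq] at hlq
  have hσ0 : σ ≠ 0 := by rintro rfl; simp at hσ
  set κ := σ / l with hκ
  have hκ0 : κ ≠ 0 := div_ne_zero hσ0 hl0.ne'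
  have hκl : |κ| = 1 / l := by rw [hκ, abs_div, hσ, abs_of_pos hl0]
  have hκ1 : |κ| ≤ 1 := by rw [hκl, div_le_one hl0]; exact hl1
  set S := chartConj f.toFun c κ with hS
  have hmemY : ∀ y ∈ Ioc 0 Y, c + κ * y ∈ Ioo (0:ℝ) 1 := by
    intro y hy
    have : c + κ * y = c + σ * (y / l) := by rw [hκ]; ring
    rw [this]
    exact hmem _ ⟨div_pos hy.1 hl0, by rw [div_lt_iff₀ hl0]; linarith [hy.2]⟩
  set p := A / l ^ (k - 1) with hp
  have hp0 : 0 < p := by positivity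
  have hpq : 4 * p ≤ q := by
    have h1 : l ≤ l ^ (k - 1) := le_self_pow₀ hl1 (by omega)
    rw [hp, ← mul_div_assoc, div_le_iff₀ (by positivity)]
    nlinarith
  have hE : ∀ y ∈ Ioc 0 Y, p * y ^ k ≤ |S y - y| ∧ |S y - y| ≤ 4 * p * y ^ k := by
    intro y hy
    have h2 : |c + κ * y - c| = y / l := by
      rw [add_sub_cancel_left, abs_mul, hκl, abs_of_pos hy.1]; ring
    have h3 := hord _ (Ioo_subset_Icc_self (hmemY y hy)) (by
      rw [h2, div_lt_iff₀ hl0]; linarith [hy.2])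
    have h4 : |S y - y| = |f.toFun (c + κ * y) - (c + κ * y)| * l := by
      rw [hS, chartConj_sub _ hκ0, abs_div, hκl]; field_simp
    have h5 : A * (y / l) ^ k * l = p * y ^ k := by
      obtain ⟨i, rfl⟩ : ∃ i, k = i + 1 := ⟨k - 1, by omega⟩
      rw [hp, add_tsub_cancel_right, div_pow]
      field_simp
      ring
    rw [h2] at h3
    rw [h4]
    constructor
    · rw [← h5]; gcongr; exact h3.1
    · calc _ ≤ 4 * A * (y / l) ^ k * l := by gcongr; exact h3.2
        _ = 4 * (A * (y / l) ^ k * l) := by ring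
        _ = _ := by rw [h5]; ring
  have hEq : ∀ y ∈ Ioc 0 Y, |S y - y| ≤ q := by
    intro y hy
    have h1 : y ^ k ≤ 1 := pow_le_one₀ hy.1.le (hy.2.trans hY1.le)
    have := (hE y hy).2
    nlinarith
  obtain ⟨x₁, hx₁, δ, hδ, hmax, hslow⟩ := H c κ Y hc hfc hκ0 hκ1 (hmemY Y ⟨hY0, le_rfl⟩) hY0 hY1.le
    ⟨Y, ⟨hY0, le_rfl⟩, fun hid => by
      have h1 := (hE Y ⟨hY0, le_rfl⟩).1
      rw [show S Y = Y from hid, sub_self, abs_zero] at h1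
      have : 0 < p * Y ^ k := by positivity
      linarith⟩
    (fun y hy hmax => by
      refine ⟨(hEq y hy).trans hqδ₁, ?_⟩
      have h1 := (hE Y ⟨hY0, le_rfl⟩).1.trans (hmax Y ⟨hY0, le_rfl⟩) |>.trans (hE y hy).2
      have h2 : Y ^ k ≤ 4 * y ^ k := le_of_mul_le_mul_left (by linarith) hp0
      have h3 : y ^ k ≤ y := pow_le_of_le_one hy.1.le (hy.2.trans hY1.le) (by omega)
      calc 3 ^ N * |S y - y| ≤ 3 ^ N * q := by gcongr; exact hEq y hy
        _ ≤ (Y ^ k / 4) ^ N := hq3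
        _ ≤ y ^ N := by gcongr; linarith)
  have hδq : δ ≤ q := by rw [← hslow.hit]; exact hEq x₁ hx₁
  exact ⟨δ, x₁, hδ, hδq.trans hqδ₀, by linarith [hx₁.2], hslow⟩

/-- The iterates of `f`. -/
def iter (f : DiffIcc ⊤) (n : ℕ) : DiffIcc ⊤ where
  toFun := f.toFun^[n]
  invFun := f.invFun^[n]
  smooth := f.contDiffOn_iterate n
  smooth_inv := f.symm.contDiffOn_iterate n
  maps := f.maps.iterate n
  maps_inv := f.maps_inv.iterate n
  left_inv _ hx := f.iterate_left_inv n hx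
  right_inv _ hx := f.symm.iterate_left_inv n hx
  fix0 := Function.iterate_fixed f.fix0 n
  fix1 := Function.iterate_fixed f.fix1 n
  deriv_pos _ hx := (f.derivWithin_iterate_pos_and n hx).1

/-- The integer powers of `f`. -/
def power (f : DiffIcc ⊤) (m : ℤ) : DiffIcc ⊤ :=
  if 0 ≤ m then f.iter m.toNat else (f.iter (-m).toNat).symm

lemma power_toFun (f : DiffIcc ⊤) (m : ℤ) : (f.power m).toFun = zpowFun f m := by
  rw [power, zpowFun]
  split_ifs <;> rfl

/-- The permutation of the interval given by `f`. -/
def perm (f : DiffIcc ⊤) : Equiv.Perm (Icc (0:ℝ) 1) where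
  toFun x := ⟨f.toFun x, f.maps x.2⟩
  invFun x := ⟨f.invFun x, f.maps_inv x.2⟩
  left_inv x := Subtype.ext (f.left_inv x x.2)
  right_inv x := Subtype.ext (f.right_inv x x.2)

lemma coe_perm (f : DiffIcc ⊤) (x : Icc (0:ℝ) 1) : (f.perm x : ℝ) = f.toFun x := rfl

lemma coe_perm_pow (f : DiffIcc ⊤) (n : ℕ) (x : Icc (0:ℝ) 1) :
    ((f.perm ^ n) x : ℝ) = f.toFun^[n] x := by
  induction n with
  | zero => rfl
  | succ n ih => rw [pow_succ', Equiv.Perm.mul_apply, coe_perm, ih, Function.iterate_succ_apply']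

lemma perm_inv (f : DiffIcc ⊤) : f.perm⁻¹ = f.symm.perm := rfl

lemma coe_perm_zpow (f : DiffIcc ⊤) (m : ℤ) (x : Icc (0:ℝ) 1) :
    ((f.perm ^ m) x : ℝ) = zpowFun f m x := by
  rw [zpowFun]
  split_ifs with h
  · lift m to ℕ using h
    rw [zpow_natCast, coe_perm_pow, Int.toNat_natCast]
  · obtain ⟨n, rfl⟩ : ∃ n : ℕ, m = -n := ⟨(-m).toNat, by omega⟩
    rw [zpow_neg, zpow_natCast, ← inv_pow, perm_inv, coe_perm_pow, neg_neg, Int.toNat_natCast]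
    rfl

lemma zpowFun_add (f : DiffIcc ⊤) (m n : ℤ) {x : ℝ} (hx : x ∈ Icc (0:ℝ) 1) :
    zpowFun f (m + n) x = zpowFun f m (zpowFun f n x) := by
  rw [← f.coe_perm_zpow (m + n) ⟨x, hx⟩, zpow_add, Equiv.Perm.mul_apply, coe_perm_zpow,
    coe_perm_zpow]

lemma zpowFun_comm (f : DiffIcc ⊤) (m : ℤ) {x : ℝ} (hx : x ∈ Icc (0:ℝ) 1) :
    zpowFun f m (f.toFun x) = f.toFun (zpowFun f m x) := by
  have := congrArg (fun σ : Equiv.Perm (Icc (0:ℝ) 1) => (σ ⟨x, hx⟩ : ℝ))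
    (Commute.zpow_self f.perm m).eq
  simpa [coe_perm_zpow, coe_perm] using this

lemma zpowFun_eq_self (f : DiffIcc ⊤) (m : ℤ) {x : ℝ} (hx : x ∈ Icc (0:ℝ) 1)
    (h : f.toFun x = x) : zpowFun f m x = x := by
  have h1 : f.perm ⟨x, hx⟩ = ⟨x, hx⟩ := Subtype.ext h
  have := congrArg Subtype.val (Equiv.Perm.zpow_apply_eq_self_of_apply_eq_self h1 m)
  rwa [coe_perm_zpow] at this

lemma mapsTo_Ioo_of_fixed (f : DiffIcc ⊤) {a b : ℝ} (ha : a ∈ Icc (0:ℝ) 1) (hb : b ∈ Icc (0:ℝ) 1)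
    (hfa : f.toFun a = a) (hfb : f.toFun b = b) : MapsTo f.toFun (Ioo a b) (Ioo a b) := by
  intro x hx
  have hx' : x ∈ Icc (0:ℝ) 1 := ⟨ha.1.trans hx.1.le, hx.2.le.trans hb.2⟩
  exact ⟨hfa ▸ f.strictMonoOn ha hx' hx.1, hfb ▸ f.strictMonoOn hx' hb hx.2⟩

lemma deriv_pos_of_mem_Ioo (f : DiffIcc ⊤) {x : ℝ} (hx : x ∈ Ioo (0:ℝ) 1) : 0 < deriv f.toFun x := by
  rw [← derivWithin_eq _ hx]
  exact f.deriv_pos x (Ioo_subset_Icc_self hx)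

end DiffIcc

lemma CloseAt.congr {r : ℕ} {ε : ℝ} {f φ φ' : ℝ → ℝ} {x : ℝ} (h : CloseAt r ε f φ x)
    (h1 : φ =ᶠ[nhds x] φ') (h2 : (φ ∘ f) =ᶠ[nhds x] (φ' ∘ f)) : CloseAt r ε f φ' x := by
  intro g hg
  rw [← h1.self_of_nhds]
  refine h g ?_
  filter_upwards [hg, h1, h2] with y h3 h4 h5
  rw [h4, h3]
  exact h5.symm

lemma CloseAt.comp {r : ℕ} {ε : ℝ} {f φ h : ℝ → ℝ} {x : ℝ} (H : CloseAt r ε f φ (h x))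
    (hh : ContDiffAt ℝ ∞ h x) (h0 : deriv h x ≠ 0) (hcomm : ∀ᶠ y in nhds x, h (f y) = f (h y)) :
    CloseAt r ε f (φ ∘ h) x := by
  intro g hg
  refine H g (eventually_of_eventually_curve hh h0 (P := fun z => g (φ z) = φ (f z)) ?_)
  filter_upwards [hg, hcomm] with y h1 h2
  rw [← h2]
  exact h1

namespace ConjOn

variable {r : ℕ} {ε a b c la lb lc : ℝ} {f : DiffIcc ⊤} {φ₁ φ₂ : ℝ → ℝ} {m₁ m₂ : ℤ}

/-- Two conjugacies with the same dilation at a common endpoint can be glued. -/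
theorem glue (H₁ : ConjOn r ε f a c la lc φ₁ m₁) (H₂ : ConjOn r ε f c b lc lb φ₂ m₂)
    (ha : 0 ≤ a) (hac : a < c) (hcb : c < b) (hb : b ≤ 1) (hlc : 0 < lc)
    (hfc : f.toFun c = c) (hfb : f.toFun b = b) :
    ∃ φ, ConjOn r ε f a b la lb φ (m₂ + m₁) := by
  classical
  have hc : c ∈ Ioo (0:ℝ) 1 := ⟨by linarith, by linarith⟩
  have hc' := Ioo_subset_Icc_self hc
  have hb' : b ∈ Icc (0:ℝ) 1 := ⟨by linarith, hb⟩
  set h := f.power m₁ with hh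
  have hfun : h.toFun = zpowFun f m₁ := f.power_toFun m₁
  have hhc : h.toFun c = c := by rw [hfun]; exact f.zpowFun_eq_self m₁ hc' hfc
  have hhb : h.toFun b = b := by rw [hfun]; exact f.zpowFun_eq_self m₁ hb' hfb
  have hhm : MapsTo h.toFun (Ioo c b) (Ioo c b) := h.mapsTo_Ioo_of_fixed hc' hb' hhc hhb
  have hcomm : ∀ x ∈ Icc (0:ℝ) 1, h.toFun (f.toFun x) = f.toFun (h.toFun x) := by
    intro x hx
    rw [hfun]
    exact f.zpowFun_comm m₁ hx
  set φ : ℝ → ℝ := fun x => if x ≤ c then φ₁ x else φ₂ (h.toFun x) with hφ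
  have hlt : ∀ x, x < c → φ =ᶠ[nhds x] φ₁ := fun x hx => by
    filter_upwards [gt_mem_nhds hx] with y hy
    exact if_pos hy.le
  have hgt : ∀ x, c < x → φ =ᶠ[nhds x] φ₂ ∘ h.toFun := fun x hx => by
    filter_upwards [lt_mem_nhds hx] with y hy
    exact if_neg hy.not_ge
  have hmid : φ =ᶠ[nhds c] fun x => c + lc * (h.toFun x - c) := by
    have h1 : ∀ᶠ x in nhdsWithin c (Iic c), φ x = c + lc * (h.toFun x - c) := by
      filter_upwards [H₁.right, self_mem_nhdsWithin] with x h1 h2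
      rw [hfun, ← h1]
      exact if_pos h2
    have h2 : ∀ᶠ x in nhdsWithin c (Ioi c), φ x = c + lc * (h.toFun x - c) := by
      have h3 : Tendsto h.toFun (nhdsWithin c (Ioi c)) (nhdsWithin c (Ici c)) := by
        refine tendsto_nhdsWithin_of_tendsto_nhds_of_eventually_within _ ?_ ?_
        · have := (h.contDiffAt hc).continuousAt.tendsto
          rw [hhc] at this
          exact this.mono_left nhdsWithin_le_nhds
        · filter_upwards [Ioo_mem_nhdsGT hcb] with x hx
          exact (hhm hx).1.le
      filter_upwards [h3.eventually H₂.left, self_mem_nhdsWithin] with x h4 h5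
      rw [← h4]
      exact if_neg (not_le.2 h5)
    have := eventually_sup.2 ⟨h1, h2⟩
    rwa [← nhdsWithin_union, Iic_union_Ioi, nhdsWithin_univ] at this
  have hmem : ∀ x ∈ Ioo c b, x ∈ Ioo (0:ℝ) 1 := fun x hx => ⟨hc.1.trans hx.1, hx.2.trans_le hb⟩
  have hcomp : ∀ x ∈ Ioo c b, ContDiffAt ℝ ∞ φ₂ (h.toFun x) := fun x hx =>
    H₂.smooth.contDiffAt (isOpen_Ioo.mem_nhds (hhm hx))
  have hpos := fun x hx => h.deriv_pos_of_mem_Ioo (hmem x hx)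
  refine ⟨φ, ⟨fun x hx => ContDiffAt.contDiffWithinAt ?_, fun x hx => ?_, ?_, ?_, fun x hx hne => ?_⟩⟩
  · rcases lt_trichotomy x c with h1 | rfl | h1
    · exact (H₁.smooth.contDiffAt (isOpen_Ioo.mem_nhds ⟨hx.1, h1⟩)).congr_of_eventuallyEq (hlt x h1)
    · refine ContDiffAt.congr_of_eventuallyEq ?_ hmid
      exact contDiffAt_const.add (contDiffAt_const.mul ((h.contDiffAt hc).sub contDiffAt_const))
    · exact ((hcomp x ⟨h1, hx.2⟩).comp x (h.contDiffAt (hmem x ⟨h1, hx.2⟩))).congr_of_eventuallyEq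
        (hgt x h1)
  · rcases lt_trichotomy x c with h1 | rfl | h1
    · rw [(hlt x h1).deriv_eq]
      exact H₁.deriv_pos x ⟨hx.1, h1⟩
    · rw [hmid.deriv_eq]
      have h2 := (h.contDiffAt hc).differentiableAt (by simp)
      have : deriv (fun y => x + lc * (h.toFun y - x)) x = lc * deriv h.toFun x :=
        (((h2.hasDerivAt.sub_const x).const_mul lc).const_add x).deriv
      rw [this]
      exact mul_pos hlc (h.deriv_pos_of_mem_Ioo hc)
    · have h2 := hcomp x ⟨h1, hx.2⟩
      rw [(hgt x h1).deriv_eq, deriv_comp x (h2.differentiableAt (by simp))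
        ((h.contDiffAt (hmem x ⟨h1, hx.2⟩)).differentiableAt (by simp))]
      exact mul_pos (H₂.deriv_pos _ (hhm ⟨h1, hx.2⟩)) (hpos x ⟨h1, hx.2⟩)
  · filter_upwards [H₁.left, Ico_mem_nhdsGE hac] with x h1 h2
    rw [← h1]
    exact if_pos h2.2.le
  · have h3 : Tendsto h.toFun (nhdsWithin b (Iic b)) (nhdsWithin b (Iic b)) := by
      refine tendsto_nhdsWithin_of_tendsto_nhds_of_eventually_within _ ?_ ?_
      · have h4 : Tendsto h.toFun (nhdsWithin b (Icc 0 1)) (nhds b) := by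
          have := h.smooth'.continuousOn b hb'
          rwa [ContinuousWithinAt, hhb] at this
        refine h4.mono_left ?_
        rw [nhdsWithin_le_iff]
        filter_upwards [Ioc_mem_nhdsLE (hc.1.trans hcb)] with x hx
        exact ⟨hx.1.le, hx.2.trans hb⟩
      · filter_upwards [Ioc_mem_nhdsLE hcb] with x hx
        rcases hx.2.eq_or_lt with h1 | h1
        · rw [h1]; exact hhb.le
        · exact (hhm ⟨hx.1, h1⟩).2.le
    filter_upwards [h3.eventually H₂.right, Ioc_mem_nhdsLE hcb] with x h4 h5
    rw [f.zpowFun_add m₂ m₁ ⟨hc.1.le.trans h5.1.le, h5.2.trans hb⟩, ← hfun, ← h4]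
    exact if_neg h5.1.not_ge
  · rcases lt_trichotomy x c with h1 | rfl | h1
    · have hx' : x ∈ Ioo (0:ℝ) 1 := ⟨ha.trans_lt hx.1, h1.trans hc.2⟩
      have hfx := f.strictMonoOn (Ioo_subset_Icc_self hx') hc' h1
      rw [hfc] at hfx
      refine (H₁.close x ⟨hx.1, h1⟩ hne).congr (hlt x h1).symm ?_
      exact (f.contDiffAt hx').continuousAt.tendsto.eventually (hlt _ hfx).symm
    · exact absurd hfc hne
    · have hxcb : x ∈ Ioo c b := ⟨h1, hx.2⟩
      have hx' := hmem x hxcb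
      have hfx := f.strictMonoOn hc' (Ioo_subset_Icc_self hx') h1
      rw [hfc] at hfx
      have hne' : f.toFun (h.toFun x) ≠ h.toFun x := by
        rw [← hcomm x (Ioo_subset_Icc_self hx')]
        exact fun h2 => hne (h.strictMonoOn.injOn (f.maps (Ioo_subset_Icc_self hx'))
          (Ioo_subset_Icc_self hx') h2)
      refine ((H₂.close _ (hhm hxcb) hne').comp (h.contDiffAt hx') (hpos x hxcb).ne' ?_).congr
        (hgt x h1).symm ?_
      · filter_upwards [Ioo_mem_nhds hx'.1 hx'.2] with y hy
        exact hcomm y (Ioo_subset_Icc_self hy)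
      · exact (f.contDiffAt hx').continuousAt.tendsto.eventually (hgt _ hfx).symm

end ConjOn

namespace DiffIcc

/-- In the chart `y ↦ c + κ y`, the map `f` has a slow end contained in `(0, X]`. -/
def HasSlowEnd (f : DiffIcc ⊤) (r : ℕ) (δ₀ c κ X : ℝ) : Prop :=
  ∃ δ x₁, 0 < δ ∧ δ ≤ δ₀ ∧ x₁ ≤ X ∧ chartConj f.toFun c κ x₁ ≤ X ∧
    SlowEnd r δ x₁ (chartConj f.toFun c κ) (chartConj f.invFun c κ)

lemma HasSlowEnd.of_add_le {f : DiffIcc ⊤} {r : ℕ} {δ₀ δ x₁ c κ X : ℝ} (hδ : 0 < δ) (hδ₀ : δ ≤ δ₀)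
    (hX : x₁ + δ ≤ X)
    (h : SlowEnd r δ x₁ (chartConj f.toFun c κ) (chartConj f.invFun c κ)) :
    f.HasSlowEnd r δ₀ c κ X := by
  refine ⟨δ, x₁, hδ, hδ₀, by linarith, ?_, h⟩
  have := (abs_le.1 h.hit.le).2
  linarith

lemma HasSlowEnd.pos {f : DiffIcc ⊤} {r : ℕ} {δ₀ c κ X : ℝ} (h : f.HasSlowEnd r δ₀ c κ X) :
    0 < X := by
  obtain ⟨δ, x₁, -, -, h1, -, h2⟩ := h
  exact h2.pos.trans_le h1

lemma HasSlowEnd.exists_slowEnd_symm {f : DiffIcc ⊤} {r : ℕ} {δ₀ c κ X : ℝ}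
    (h : f.HasSlowEnd r δ₀ c κ X) (hc : c ∈ Icc (0:ℝ) 1) (hfc : f.toFun c = c) (hκ : κ ≠ 0)
    (hX : c + κ * X ∈ Icc (0:ℝ) 1) (hX1 : X ≤ 1) :
    ∃ δ x₁, 0 < δ ∧ δ ≤ δ₀ ∧ x₁ ≤ X ∧
      SlowEnd r δ x₁ (chartConj f.invFun c κ) (chartConj f.toFun c κ) := by
  obtain ⟨δ, x₁, hδ, hδ₀, h1, h2, hs⟩ := h
  have hX0 : 0 < X := hs.pos.trans_le h1
  have hmem : c + κ * x₁ ∈ Icc (0:ℝ) 1 := by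
    have hconv := (convex_Icc (0:ℝ) 1).add_smul_sub_mem hc hX
      (t := x₁ / X) ⟨by have := hs.pos; positivity, (div_le_one hX0).2 h1⟩
    have : c + (x₁ / X) • (c + κ * X - c) = c + κ * x₁ := by
      rw [smul_eq_mul]; field_simp; ring
    rwa [this] at hconv
  have hpos := f.chartConj_strictMono hκ (x := 0) (by simpa using hc) hmem hs.pos
  rw [chartConj_zero hfc] at hpos
  have hinv := f.chartConj_symm_chartConj hκ hmem
  refine ⟨δ, chartConj f.toFun c κ x₁, hδ, hδ₀, h2, hpos, h2.trans hX1, ?_, hs.near_inv, ?_⟩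
  · rw [hinv, abs_sub_comm]; exact hs.hit
  · rw [hinv]; exact hs.near

lemma HasSlowEnd.exists_slowEnd {f : DiffIcc ⊤} {r : ℕ} {δ₀ c κ X : ℝ}
    (h : f.HasSlowEnd r δ₀ c κ X) : ∃ δ x₁, 0 < δ ∧ δ ≤ δ₀ ∧ x₁ ≤ X ∧
      SlowEnd r δ x₁ (chartConj f.toFun c κ) (chartConj f.invFun c κ) := by
  obtain ⟨δ, x₁, hδ, hδ₀, h1, -, hs⟩ := h
  exact ⟨δ, x₁, hδ, hδ₀, h1, hs⟩

lemma forall_lt_or_forall_gt (f : DiffIcc ⊤) {a b : ℝ} (ha : 0 ≤ a) (hb : b ≤ 1)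
    (hne : ∀ x ∈ Ioo a b, f.toFun x ≠ x) :
    (∀ x ∈ Ioo a b, x < f.toFun x) ∨ ∀ x ∈ Ioo a b, f.toFun x < x := by
  by_contra! h
  obtain ⟨⟨x, hx, hx'⟩, y, hy, hy'⟩ := h
  have hcont : ContinuousOn (fun z => f.toFun z - z) (Ioo a b) :=
    (f.smooth'.continuousOn.mono fun z hz => ⟨ha.trans hz.1.le, hz.2.le.trans hb⟩).sub continuousOn_id
  obtain ⟨z, hz, hz'⟩ := isPreconnected_Ioo.intermediate_value hx hy hcont
    (show (0:ℝ) ∈ Icc _ _ from ⟨sub_nonpos.2 hx', sub_nonneg.2 hy'⟩)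
  exact hne z hz (sub_eq_zero.1 hz')

/-- Conjugacies exist between consecutive fixed points having slow ends. -/
theorem exists_conjOn_of_hasSlowEnd (r : ℕ) : ∀ ε > 0, ∃ δ₀ > 0, ∀ (f : DiffIcc ⊤),
    IAsympVarVanishes f.toFun → ∀ a b la lb Xa Xb : ℝ, a < b → a ∈ Icc (0:ℝ) 1 → b ∈ Icc (0:ℝ) 1 →
      f.toFun a = a → f.toFun b = b → (∀ x ∈ Ioo a b, f.toFun x ≠ x) → 1 ≤ la → 1 ≤ lb →
      f.HasSlowEnd r δ₀ a la⁻¹ Xa → f.HasSlowEnd r δ₀ b (-lb⁻¹) Xb → Xa + Xb ≤ b - a →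
      ∃ (φ : ℝ → ℝ) (m : ℤ), ConjOn r ε f a b la lb φ m := by
  intro ε hε
  obtain ⟨δ₀, hδ₀, H⟩ := IsComponent.exists_conjOn r ε hε
  refine ⟨δ₀, hδ₀, ?_⟩
  intro f hvar a b la lb Xa Xb hab ha hb hfa hfb hne hla hlb hSa hSb hX
  have hXa := hSa.pos
  have hXb := hSb.pos
  have hla' : 0 < la⁻¹ := by positivity
  have hlb' : 0 < lb⁻¹ := by positivity
  have h1 : la⁻¹ * Xa ≤ b - a :=
    (mul_le_of_le_one_left hXa.le (inv_le_one_of_one_le₀ hla)).trans (by linarith)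
  have h2 : lb⁻¹ * Xb ≤ b - a :=
    (mul_le_of_le_one_left hXb.le (inv_le_one_of_one_le₀ hlb)).trans (by linarith)
  have h3 : 0 < la⁻¹ * Xa := mul_pos hla' hXa
  have h4 : 0 < lb⁻¹ * Xb := mul_pos hlb' hXb
  rcases f.forall_lt_or_forall_gt ha.1 hb.2 hne with h | h
  · obtain ⟨δa, xa, hδa, hδa', hxa, hsa⟩ := hSa.exists_slowEnd_symm ha hfa hla'.ne'
      ⟨by linarith [ha.1], by linarith [hb.2]⟩ (by linarith [ha.1, hb.2])
    obtain ⟨δb, xb, hδb, hδb', hxb, hsb⟩ := hSb.exists_slowEnd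
    obtain ⟨φ, m, hφ, -⟩ := H f a b ⟨hab, ha, hb, hfa, hfb, h⟩ hvar la lb δa δb xa xb hla hlb hδa
      hδa' hδb hδb' hsa hsb (by linarith)
    exact ⟨φ, m, hφ⟩
  · obtain ⟨δa, xa, hδa, hδa', hxa, hsa⟩ := hSa.exists_slowEnd
    obtain ⟨δb, xb, hδb, hδb', hxb, hsb⟩ := hSb.exists_slowEnd_symm hb hfb (neg_ne_zero.2 hlb'.ne')
      ⟨by linarith [ha.1], by linarith [hb.2]⟩ (by linarith [ha.1, hb.2])
    have hfa' : f.invFun a = a := by have := f.left_inv a ha; rwa [hfa] at this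
    have hfb' : f.invFun b = b := by have := f.left_inv b hb; rwa [hfb] at this
    obtain ⟨φ, m, -, hφ⟩ := H f.symm a b ⟨hab, ha, hb, hfa', hfb', fun x hx => by
      have h5 := f.symm.mapsTo_Ioo_of_fixed ha hb hfa' hfb' hx
      have h6 := h _ h5
      rwa [symm_toFun, f.right_inv x ⟨ha.1.trans hx.1.le, hx.2.le.trans hb.2⟩] at h6⟩
      (f.asympVar_symm hvar) la lb δa δb xa xb hla hlb hδa hδa' hδb hδb' hsa hsb (by linarith)
    exact ⟨φ, -m, hφ⟩

/-- Conjugacies exist along a finite chain of fixed points having slow ends. -/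
theorem exists_conjOn_of_finite (r : ℕ) : ∀ ε > 0, ∃ δ₀ > 0, ∀ (f : DiffIcc ⊤),
    IAsympVarVanishes f.toFun → ∀ (l XL XR : ℝ → ℝ) (p q : ℝ), 0 ≤ p → q ≤ 1 →
      {x ∈ Icc p q | f.toFun x = x}.Finite →
      (∀ c ∈ Icc p q, f.toFun c = c → 1 ≤ l c) →
      (∀ c ∈ Ico p q, f.toFun c = c → f.HasSlowEnd r δ₀ c (l c)⁻¹ (XR c)) →
      (∀ c ∈ Ioc p q, f.toFun c = c → f.HasSlowEnd r δ₀ c (-(l c)⁻¹) (XL c)) →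
      (∀ a b, p ≤ a → a < b → b ≤ q → f.toFun a = a → f.toFun b = b → XR a + XL b ≤ b - a) →
      p < q → f.toFun p = p → f.toFun q = q →
      ∃ (φ : ℝ → ℝ) (m : ℤ), ConjOn r ε f p q (l p) (l q) φ m := by
  intro ε hε
  obtain ⟨δ₀, hδ₀, H⟩ := exists_conjOn_of_hasSlowEnd r ε hε
  refine ⟨δ₀, hδ₀, ?_⟩
  intro f hvar l XL XR p q hp hq hfin hl hR hL hX hpq hfp hfq
  suffices h : ∀ n (a b : ℝ), p ≤ a → a < b → b ≤ q → f.toFun a = a → f.toFun b = b →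
      {x ∈ Ioo a b | f.toFun x = x}.ncard = n →
      ∃ (φ : ℝ → ℝ) (m : ℤ), ConjOn r ε f a b (l a) (l b) φ m from
    h _ p q le_rfl hpq le_rfl hfp hfq rfl
  intro n
  induction n using Nat.strong_induction_on with
  | _ n ih =>
    intro a b hpa hab hbq hfa hfb hn
    have hfin' : {x ∈ Ioo a b | f.toFun x = x}.Finite :=
      hfin.subset fun x hx => ⟨⟨hpa.trans hx.1.1.le, hx.1.2.le.trans hbq⟩, hx.2⟩
    by_cases hc : ∃ c ∈ Ioo a b, f.toFun c = c
    · obtain ⟨c, hc, hfc⟩ := hc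
      have hlt : ∀ s : Set ℝ, s ⊆ {x ∈ Ioo a b | f.toFun x = x} → c ∉ s → s.ncard < n := by
        intro s hs hcs
        rw [← hn]
        exact ncard_lt_ncard ⟨hs, fun h => hcs (h ⟨hc, hfc⟩)⟩ hfin'
      obtain ⟨φ₁, m₁, h₁⟩ := ih _ (hlt {x ∈ Ioo a c | f.toFun x = x}
        (fun x hx => ⟨⟨hx.1.1, hx.1.2.trans hc.2⟩, hx.2⟩) fun h => lt_irrefl _ h.1.2) a c hpa hc.1
        (hc.2.le.trans hbq) hfa hfc rfl
      obtain ⟨φ₂, m₂, h₂⟩ := ih _ (hlt {x ∈ Ioo c b | f.toFun x = x}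
        (fun x hx => ⟨⟨hc.1.trans hx.1.1, hx.1.2⟩, hx.2⟩) fun h => lt_irrefl _ h.1.1) c b
        (hpa.trans hc.1.le) hc.2 hbq hfc hfb rfl
      have hlc := hl c ⟨hpa.trans hc.1.le, hc.2.le.trans hbq⟩ hfc
      obtain ⟨φ, hφ⟩ := h₁.glue h₂ (hp.trans hpa) hc.1 hc.2 (hbq.trans hq) (by linarith) hfc hfb
      exact ⟨φ, _, hφ⟩
    · push Not at hc
      exact H f hvar a b (l a) (l b) (XR a) (XL b) hab ⟨hp.trans hpa, by linarith⟩
        ⟨by linarith, hbq.trans hq⟩ hfa hfb hc (hl a ⟨hpa, by linarith⟩ hfa)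
        (hl b ⟨by linarith, hbq⟩ hfb) (hR a ⟨hpa, by linarith⟩ hfa)
        (hL b ⟨by linarith, hbq⟩ hfb) (hX a b hpa hab hbq hfa hfb)

end DiffIcc

lemma NearId.translate {k : ℕ} {δ θ y₀ y : ℝ} {T : ℝ → ℝ} (h : NearId k δ θ T (y₀ + y)) :
    NearId k δ θ (fun y => T (y₀ + y) - y₀) y := by
  have h0 : ∀ y, T (y₀ + y) - y₀ - y = (fun z => T z - z) (y + y₀) := fun y => by
    simp only [add_comm y y₀]; ring
  refine ⟨?_, fun j h1 h2 => ?_⟩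
  · have := h.1
    rw [← sub_sub] at this
    convert this using 2
  · simp only [h0]
    rw [iteratedDeriv_comp_add_const j (fun z => T z - z)]
    simp only [add_comm y y₀]
    exact h.2 j h1 h2

lemma CloseAt.id_of_nearId {r : ℕ} {ε δ θ c κ y : ℝ} {f : ℝ → ℝ} (hκ : κ * κ = 1)
    (h : NearId (r + 2) δ θ (chartConj f c κ) y) (hδ : δ ≤ ε) (hθ : θ ≤ ε) :
    CloseAt r ε f id (c + κ * y) := by
  intro g hg j hj
  have hκ0 : κ ≠ 0 := by rintro rfl; simp at hκ
  have hcont : Tendsto (fun z : ℝ => c + κ * z) (nhds y) (nhds (c + κ * y)) :=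
    Continuous.tendsto (by fun_prop) _
  have h1 : ∀ᶠ z in nhds y, g (c + κ * z) = c + κ * chartConj f c κ z := by
    filter_upwards [hcont.eventually hg] with z hz
    rw [chart_chartConj _ _ hκ0]
    exact hz
  rw [id, abs_iteratedDeriv_sub_id_eq_of_affine hκ h1]
  rcases Nat.eq_zero_or_pos j with rfl | hj0
  · simpa using h.1.trans hδ
  · exact (h.2 j hj0 (by omega)).trans hθ

lemma ConjOn.id {r : ℕ} {ε a b : ℝ} {f : DiffIcc ⊤}
    (h : ∀ x ∈ Ioo a b, CloseAt r ε f.toFun id x) : ConjOn r ε f a b 1 1 id 0 where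
  smooth := contDiffOn_id
  deriv_pos x _ := by simp
  left := by simp
  right := by simp [zpowFun_zero]
  close x hx _ := h x hx

namespace DiffIcc

lemma chartConj_translate (g : ℝ → ℝ) {c κ : ℝ} (hκ : κ ≠ 0) (y₀ : ℝ) :
    chartConj g (c + κ * y₀) κ = fun y => chartConj g c κ (y₀ + y) - y₀ := by
  ext y
  simp only [chartConj, mul_add, ← add_assoc]
  field_simp
  ring

lemma chartConj_eq_self_iff {g : ℝ → ℝ} {c κ y : ℝ} (hκ : κ ≠ 0) :
    chartConj g c κ y = y ↔ g (c + κ * y) = c + κ * y := by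
  rw [← chart_chartConj g c hκ]
  simp [hκ]

/-- Near an ITI endpoint there is a fixed point with a slow end, such that the diffeomorphism is
close to the identity between the endpoint and this fixed point. -/
lemma exists_hasSlowEnd_of_ITIat (f : DiffIcc ⊤) (r : ℕ)
    (hITI : ∀ x ∈ Ioo (0:ℝ) 1, f.toFun x = x → ¬ ITIat f.toFun x) {c κ : ℝ}
    (hc : c ∈ Icc (0:ℝ) 1) (hfc : f.toFun c = c) (h : ITIat f.toFun c) (hκ : κ * κ = 1)
    (hmem : ∀ y ∈ Ioo (0:ℝ) 1, c + κ * y ∈ Ioo (0:ℝ) 1)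
    (hmem' : ∀ y ∈ Icc (0:ℝ) 1, c + κ * y ∈ Icc (0:ℝ) 1) {X δ₀ ε : ℝ} (hX : 0 < X) (hX1 : X ≤ 1)
    (hδ₀ : 0 < δ₀) (hε : 0 < ε) :
    ∃ y₀ Y, 0 ≤ y₀ ∧ y₀ < Y ∧ Y ≤ X ∧ f.toFun (c + κ * y₀) = c + κ * y₀ ∧
      (∀ y, y₀ < y → y ≤ 1 → f.toFun (c + κ * y) = c + κ * y → Y < y) ∧
      f.HasSlowEnd r δ₀ (c + κ * y₀) κ (Y - y₀) ∧
      ∀ y ∈ Ioo 0 y₀, CloseAt r ε f.toFun id (c + κ * y) := by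
  have hκ0 : κ ≠ 0 := by rintro rfl; simp at hκ
  have hκ1 : |κ| = 1 := by
    have := abs_mul_abs_self κ
    rw [hκ] at this
    nlinarith [abs_nonneg κ]
  obtain ⟨δ, x₁, hδ, hδ', hx₁X, -, hs⟩ := f.exists_slowEnd_of_ITIat r hITI hc hfc h hκ1 hmem hX
    (lt_min hδ₀ (lt_min hε (lt_min one_pos (pow_pos hε 2))))
  simp only [le_min_iff] at hδ'
  obtain ⟨hδδ₀, hδε, hδ1, hδε2⟩ := hδ'
  have hθ : δ ^ (1 - lossExp r) ≤ ε := by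
    have hη := lossExp_le r
    calc δ ^ (1 - lossExp r) ≤ Real.sqrt δ := by
          rw [Real.sqrt_eq_rpow]
          exact Real.rpow_le_rpow_of_exponent_ge hδ hδ1 (by linarith)
      _ ≤ ε := by rwa [Real.sqrt_le_left hε.le]
  have hx₁1 : x₁ ≤ 1 := hs.le_one
  have hsub : Icc 0 x₁ ⊆ Icc (0:ℝ) 1 := Icc_subset_Icc_right hx₁1
  have hcpt : IsCompact {y ∈ Icc 0 x₁ | f.toFun (c + κ * y) = c + κ * y} := by
    have h1 : ContinuousOn (fun y => f.toFun (c + κ * y) - (c + κ * y)) (Icc 0 x₁) :=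
      (f.smooth'.continuousOn.comp (by fun_prop) fun y hy => hmem' y (hsub hy)).sub (by fun_prop)
    have h2 := h1.preimage_isClosed_of_isClosed isClosed_Icc (isClosed_singleton (x := (0:ℝ)))
    simpa only [inter_def, mem_preimage, mem_singleton_iff, sub_eq_zero] using
      isCompact_Icc.of_isClosed_subset h2 inter_subset_left
  obtain ⟨y₀, ⟨hy₀, hfy₀⟩, hmax⟩ := hcpt.exists_isGreatest ⟨0, ⟨le_rfl, hs.pos.le⟩, by simpa using hfc⟩
  have hy₀lt : y₀ < x₁ := by
    refine hy₀.2.lt_of_ne fun h1 => ?_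
    have h2 := hs.hit
    rw [h1, ← chartConj_eq_self_iff hκ0] at hfy₀
    rw [hfy₀, sub_self, abs_zero] at h2
    exact hδ.ne h2
  have hhit := (abs_le.1 hs.hit.le).2
  refine ⟨y₀, max x₁ (chartConj f.toFun c κ x₁), hy₀.1, hy₀lt.trans_le (le_max_left _ _),
    max_le (by linarith) (by linarith), hfy₀, fun y hy hy1 hfy => ?_, ?_, fun y hy => ?_⟩
  · have hlt : x₁ < y := by
      by_contra! h1
      exact (hmax ⟨⟨hy₀.1.trans hy.le, h1⟩, hfy⟩).not_gt hy
    refine max_lt hlt ?_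
    have := f.chartConj_strictMono hκ0 (hmem' x₁ ⟨hs.pos.le, hx₁1⟩)
      (hmem' y ⟨hs.pos.le.trans hlt.le, hy1⟩) hlt
    rwa [(chartConj_eq_self_iff hκ0).2 hfy] at this
  · refine ⟨δ, x₁ - y₀, hδ, hδδ₀, sub_le_sub_right (le_max_left _ _) _, ?_, by linarith,
      by linarith [hy₀.1], ?_, fun y hy => ?_, fun y hy => ?_⟩
    · simp only [chartConj_translate _ hκ0, add_sub_cancel]
      exact sub_le_sub_right (le_max_right _ _) _
    · simp only [chartConj_translate _ hκ0, add_sub_cancel]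
      rw [sub_sub_sub_cancel_right]
      exact hs.hit
    · rw [chartConj_translate _ hκ0]
      exact (hs.near _ ⟨by linarith [hy.1, hy₀.1], by linarith [hy.2]⟩).translate
    · rw [chartConj_translate _ hκ0]
      simp only [chartConj_translate _ hκ0, add_sub_cancel] at hy
      exact (hs.near_inv _ ⟨by linarith [hy.1, hy₀.1], by linarith [hy.2]⟩).translate
  · exact CloseAt.id_of_nearId hκ (hs.near y ⟨hy.1, hy.2.le.trans hy₀lt.le⟩) hδε hθ

/-- A dilation giving slow ends on both sides of a fixed point which is not ITI. -/
lemma exists_dilation_of_not_ITIat (f : DiffIcc ⊤) (r : ℕ) {c : ℝ} (hc : c ∈ Icc (0:ℝ) 1)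
    (hfc : f.toFun c = c) (hD : derivWithin f.toFun (Icc 0 1) c = 1) (h : ¬ ITIat f.toFun c)
    {X δ₀ : ℝ} (hX : 0 < X) (hδ₀ : 0 < δ₀) :
    ∃ l ≥ 1, (c < 1 → f.HasSlowEnd r δ₀ c l⁻¹ X) ∧ (0 < c → f.HasSlowEnd r δ₀ c (-l⁻¹) X) := by
  obtain ⟨l₁, -, h1⟩ : ∃ L ≥ (1:ℝ), ∀ l ≥ L, c < 1 → f.HasSlowEnd r δ₀ c l⁻¹ X := by
    by_cases hc1 : c < 1
    · obtain ⟨L, hL, H⟩ := f.exists_slowEnd_of_not_ITIat r hc hfc hD h (σ := 1) (by simp)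
        ⟨1 - c, by linarith, fun y hy => ⟨by linarith [hy.1, hc.1], by linarith [hy.2]⟩⟩ hX hδ₀
      refine ⟨L, hL, fun l hl _ => ?_⟩
      obtain ⟨δ, x₁, hδ, hδ', hx, hs⟩ := H l hl
      rw [one_div] at hs
      exact .of_add_le hδ hδ' hx hs
    · exact ⟨1, le_rfl, fun l _ h => absurd h hc1⟩
  obtain ⟨l₂, hl₂, h2⟩ : ∃ L ≥ (1:ℝ), ∀ l ≥ L, 0 < c → f.HasSlowEnd r δ₀ c (-l⁻¹) X := by
    by_cases hc1 : 0 < c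
    · obtain ⟨L, hL, H⟩ := f.exists_slowEnd_of_not_ITIat r hc hfc hD h (σ := -1) (by simp)
        ⟨c, hc1, fun y hy => ⟨by linarith [hy.2], by linarith [hy.1, hc.2]⟩⟩ hX hδ₀
      refine ⟨L, hL, fun l hl _ => ?_⟩
      obtain ⟨δ, x₁, hδ, hδ', hx, hs⟩ := H l hl
      rw [neg_div, one_div] at hs
      exact .of_add_le hδ hδ' hx hs
    · exact ⟨1, le_rfl, fun l _ h => absurd h hc1⟩
  exact ⟨max l₁ l₂, hl₂.trans (le_max_right _ _), h1 _ (le_max_left _ _), h2 _ (le_max_right _ _)⟩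

lemma isCompact_fixed (f : DiffIcc ⊤) {a b : ℝ} (ha : 0 ≤ a) (hb : b ≤ 1) :
    IsCompact {x ∈ Icc a b | f.toFun x = x} := by
  have h1 : ContinuousOn (fun x => f.toFun x - x) (Icc a b) :=
    (f.smooth'.continuousOn.mono (Icc_subset_Icc ha hb)).sub continuousOn_id
  have h2 := h1.preimage_isClosed_of_isClosed isClosed_Icc (isClosed_singleton (x := (0:ℝ)))
  simpa only [inter_def, mem_preimage, mem_singleton_iff, sub_eq_zero] using
    isCompact_Icc.of_isClosed_subset h2 inter_subset_left

lemma finite_fixed (f : DiffIcc ⊤) (hvar : IAsympVarVanishes f.toFun) {a b : ℝ} (ha : 0 ≤ a)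
    (hb : b ≤ 1) (h : ∀ x ∈ Icc a b, f.toFun x = x → ¬ ITIat f.toFun x) :
    {x ∈ Icc a b | f.toFun x = x}.Finite := by
  by_contra hinf
  obtain ⟨c, ⟨hc, hfc⟩, hacc⟩ := Set.Infinite.exists_accPt_of_subset_isCompact hinf
    (f.isCompact_fixed ha hb) Subset.rfl
  have hc' : c ∈ Icc (0:ℝ) 1 := ⟨ha.trans hc.1, hc.2.trans hb⟩
  obtain ⟨η, hη, H⟩ := f.exists_isolated_of_not_ITIat hc' hfc (f.derivWithin_eq_one hvar hc' hfc)
    (h c hc hfc)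
  obtain ⟨x, ⟨hx, hx'⟩, hne⟩ := accPt_iff_nhds.1 hacc _ (Metric.ball_mem_nhds c hη)
  exact hne (H x ⟨ha.trans hx'.1.1, hx'.1.2.trans hb⟩ (by rwa [Metric.mem_ball, Real.dist_eq] at hx)
    hx'.2)

end DiffIcc

lemma Set.Finite.exists_gap {M : Set ℝ} (hM : M.Finite) (R Q : ℝ) :
    ∃ ρ > 0, (∀ a ∈ M, ∀ b ∈ M, a < b → ρ + ρ ≤ b - a) ∧ (∀ a ∈ M, R < a → ρ ≤ a - R) ∧
      ∀ a ∈ M, a < Q → ρ ≤ Q - a := by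
  have key : ∀ s : ℝ, ∀ᶠ ρ in nhdsWithin (0:ℝ) (Ioi 0), 0 < s → ρ + ρ ≤ s := by
    intro s
    by_cases hs : 0 < s
    · filter_upwards [Ioo_mem_nhdsGT (half_pos hs)] with ρ hρ _
      linarith [hρ.2]
    · exact Eventually.of_forall fun _ h => absurd h hs
  have h1 : ∀ᶠ ρ in nhdsWithin (0:ℝ) (Ioi 0), ∀ a ∈ M, ∀ b ∈ M, 0 < b - a → ρ + ρ ≤ b - a :=
    (eventually_all_finite hM).2 fun a _ => (eventually_all_finite hM).2 fun b _ => key _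
  have h2 : ∀ᶠ ρ in nhdsWithin (0:ℝ) (Ioi 0), ∀ a ∈ M, 0 < a - R → ρ + ρ ≤ a - R :=
    (eventually_all_finite hM).2 fun a _ => key _
  have h3 : ∀ᶠ ρ in nhdsWithin (0:ℝ) (Ioi 0), ∀ a ∈ M, 0 < Q - a → ρ + ρ ≤ Q - a :=
    (eventually_all_finite hM).2 fun a _ => key _
  obtain ⟨ρ, h1, h2, h3, hρ⟩ := (h1.and (h2.and (h3.and self_mem_nhdsWithin))).exists
  have hρ : 0 < ρ := hρ
  exact ⟨ρ, hρ, fun a ha b hb hab => h1 a ha b hb (sub_pos.2 hab),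
    fun a ha h => by linarith [h2 a ha (sub_pos.2 h)],
    fun a ha h => by linarith [h3 a ha (sub_pos.2 h)]⟩

namespace DiffIcc

/-- The conjugacy on the whole interval. -/
theorem exists_conjOn_unit (f : DiffIcc ⊤)
    (hITI : ∀ x ∈ Ioo (0:ℝ) 1, f.toFun x = x → ¬ ITIat f.toFun x)
    (hvar : IAsympVarVanishes f.toFun) (r : ℕ) {ε : ℝ} (hε : 0 < ε) :
    ∃ (φ : ℝ → ℝ) (m : ℤ) (l₀ l₁ : ℝ), 0 < l₀ ∧ 0 < l₁ ∧ (ITIat f.toFun 0 → l₀ = 1) ∧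
      (ITIat f.toFun 1 → l₁ = 1) ∧ ConjOn r ε f 0 1 l₀ l₁ φ m := by
  classical
  obtain ⟨δ₀, hδ₀, H⟩ := exists_conjOn_of_finite r ε hε
  obtain ⟨p, R, hp0, hpR, hR, hfp, hRmin, hpcase⟩ : ∃ p R : ℝ, 0 ≤ p ∧ p ≤ R ∧ R ≤ 1 / 3 ∧
      f.toFun p = p ∧ (∀ x ∈ Icc (0:ℝ) 1, f.toFun x = x → p < x → R < x) ∧
      ((ITIat f.toFun 0 ∧ p < R ∧ f.HasSlowEnd r δ₀ p 1 (R - p) ∧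
        ∀ x ∈ Ioo 0 p, CloseAt r ε f.toFun id x) ∨ (¬ ITIat f.toFun 0 ∧ p = 0 ∧ R = 0)) := by
    by_cases h : ITIat f.toFun 0
    · obtain ⟨y₀, Y, h1, h2, h3, h4, h5, h6, h7⟩ := f.exists_hasSlowEnd_of_ITIat r hITI (c := 0)
        (κ := 1) (by simp) f.fix0 h (by norm_num) (by simp) (by simp) (X := 1 / 3) (by norm_num)
        (by norm_num) hδ₀ hε
      simp only [zero_add, one_mul] at h4 h5 h6 h7
      exact ⟨y₀, Y, h1, h2.le, h3, h4, fun x hx hfx hlt => h5 x hlt hx.2 hfx, .inl ⟨h, h2, h6, h7⟩⟩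
    · exact ⟨0, 0, le_rfl, le_rfl, by norm_num, f.fix0, fun _ _ _ h => h, .inr ⟨h, rfl, rfl⟩⟩
  obtain ⟨q, Q, hq1, hqQ, hQ, hfq, hQmax, hqcase⟩ : ∃ q Q : ℝ, q ≤ 1 ∧ Q ≤ q ∧ 2 / 3 ≤ Q ∧
      f.toFun q = q ∧ (∀ x ∈ Icc (0:ℝ) 1, f.toFun x = x → x < q → x < Q) ∧
      ((ITIat f.toFun 1 ∧ Q < q ∧ f.HasSlowEnd r δ₀ q (-1) (q - Q) ∧
        ∀ x ∈ Ioo q 1, CloseAt r ε f.toFun id x) ∨ (¬ ITIat f.toFun 1 ∧ q = 1 ∧ Q = 1)) := by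
    by_cases h : ITIat f.toFun 1
    · obtain ⟨y₀, Y, h1, h2, h3, h4, h5, h6, h7⟩ := f.exists_hasSlowEnd_of_ITIat r hITI (c := 1)
        (κ := -1) (by simp) f.fix1 h (by norm_num) (fun y hy => ⟨by linarith [hy.2],
        by linarith [hy.1]⟩) (fun y hy => ⟨by linarith [hy.2], by linarith [hy.1]⟩) (X := 1 / 3)
        (by norm_num) (by norm_num) hδ₀ hε
      simp only [neg_mul, one_mul, ← sub_eq_add_neg] at h4 h5 h6 h7
      refine ⟨1 - y₀, 1 - Y, by linarith, by linarith, by linarith, h4, fun x hx hfx hlt => ?_,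
        .inl ⟨h, by linarith, by rwa [sub_sub_sub_cancel_left], fun x hx => ?_⟩⟩
      · have := h5 (1 - x) (by linarith) (by linarith [hx.1]) (by rw [sub_sub_cancel, hfx])
        linarith
      · have := h7 (1 - x) ⟨by linarith [hx.2], by linarith [hx.1]⟩
        rwa [sub_sub_cancel] at this
    · exact ⟨1, 1, le_rfl, le_rfl, by norm_num, f.fix1, fun _ _ _ h => h, .inr ⟨h, rfl, rfl⟩⟩
  set M := {x ∈ Icc R Q | f.toFun x = x} with hM
  have hMmem : ∀ c ∈ M, c ∈ Icc (0:ℝ) 1 := fun c hc =>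
    ⟨hp0.trans (hpR.trans hc.1.1), hc.1.2.trans (hqQ.trans hq1)⟩
  have hMITI : ∀ c ∈ Icc R Q, f.toFun c = c → ¬ ITIat f.toFun c := by
    intro c hc hfc
    have hc' := hMmem c ⟨hc, hfc⟩
    rcases hc'.1.eq_or_lt with h0 | h0
    · rcases hpcase with ⟨-, h, -⟩ | ⟨h, -⟩
      · exact absurd hc.1 (by linarith)
      · rwa [← h0]
    · rcases hc'.2.eq_or_lt with h1 | h1
      · rcases hqcase with ⟨-, h, -⟩ | ⟨h, -⟩
        · exact absurd hc.2 (by linarith)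
        · rwa [h1]
      · exact hITI c ⟨h0, h1⟩ hfc
  have hMfin : M.Finite := f.finite_fixed hvar (hp0.trans hpR) (hqQ.trans hq1) hMITI
  obtain ⟨ρ, hρ, hgap, hgapR, hgapQ⟩ := hMfin.exists_gap R Q
  have hdil : ∀ c ∈ M, ∃ l ≥ 1, (c < 1 → f.HasSlowEnd r δ₀ c l⁻¹ ρ) ∧
      (0 < c → f.HasSlowEnd r δ₀ c (-l⁻¹) ρ) := fun c hc =>
    f.exists_dilation_of_not_ITIat r (hMmem c hc) hc.2 (f.derivWithin_eq_one hvar (hMmem c hc) hc.2)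
      (hMITI c hc.1 hc.2) hρ hδ₀
  choose! lM hlM hlM₁ hlM₂ using hdil
  have hpq : p < q := by linarith
  have hp1 : p ∈ Icc (0:ℝ) 1 := ⟨hp0, by linarith⟩
  have hq0 : q ∈ Icc (0:ℝ) 1 := ⟨by linarith, hq1⟩
  have hunit : ∀ {c}, c ∈ Icc p q → c ∈ Icc (0:ℝ) 1 := fun hc => ⟨hp0.trans hc.1, hc.2.trans hq1⟩
  have hcases : ∀ c ∈ Icc p q, f.toFun c = c → c ∉ M →
      (c = p ∧ ITIat f.toFun 0) ∨ (c = q ∧ ITIat f.toFun 1) := by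
    intro c hc hfc hcM
    by_contra! hcon
    have h1 : R ≤ c := by
      rcases hc.1.eq_or_lt with h | h
      · rcases hpcase with ⟨hI, -⟩ | ⟨-, h1, h2⟩
        · exact absurd hI (hcon.1 h.symm)
        · linarith
      · exact (hRmin c (hunit hc) hfc h).le
    have h2 : c ≤ Q := by
      rcases hc.2.eq_or_lt with h | h
      · rcases hqcase with ⟨hI, -⟩ | ⟨-, h1, h2⟩
        · exact absurd hI (hcon.2 h)
        · linarith
      · exact (hQmax c (hunit hc) hfc h).le
    exact hcM ⟨⟨h1, h2⟩, hfc⟩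
  set l : ℝ → ℝ := fun c => if c ∈ M then lM c else 1 with hl
  have hl1 : ∀ c, 1 ≤ l c := fun c => by
    simp only [hl]
    split_ifs with h
    · exact hlM c h
    · exact le_rfl
  have hlp : ITIat f.toFun 0 → l p = 1 := fun h => if_neg fun hpM => by
    rcases hpcase with ⟨-, h1, -⟩ | ⟨h1, -⟩
    · exact absurd hpM.1.1 (by linarith)
    · exact h1 h
  have hlq : ITIat f.toFun 1 → l q = 1 := fun h => if_neg fun hqM => by
    rcases hqcase with ⟨-, h1, -⟩ | ⟨h1, -⟩
    · exact absurd hqM.1.2 (by linarith)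
    · exact h1 h
  obtain ⟨φ, m, hφ⟩ := H f hvar l (fun c => if c ∈ M then ρ else q - Q)
    (fun c => if c ∈ M then ρ else R - p) p q hp0 hq1
    ((hMfin.union (Set.toFinite {p, q})).subset fun c hc => by
      by_cases hcM : c ∈ M
      · exact .inl hcM
      · right
        rcases hcases c hc.1 hc.2 hcM with ⟨h, -⟩ | ⟨h, -⟩ <;> simp [h])
    (fun c _ _ => hl1 c)
    (fun c hc hfc => by
      by_cases hcM : c ∈ M
      · simp only [hl, if_pos hcM]
        exact hlM₁ c hcM (hc.2.trans_le hq1)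
      · rcases hcases c ⟨hc.1, hc.2.le⟩ hfc hcM with ⟨rfl, hI⟩ | ⟨rfl, -⟩
        · rcases hpcase with ⟨-, -, h, -⟩ | ⟨h, -⟩
          · simp only [hl, if_neg hcM, inv_one]
            exact h
          · exact absurd hI h
        · exact absurd hc.2 (lt_irrefl _))
    (fun c hc hfc => by
      by_cases hcM : c ∈ M
      · simp only [hl, if_pos hcM]
        exact hlM₂ c hcM (hp0.trans_lt hc.1)
      · rcases hcases c ⟨hc.1.le, hc.2⟩ hfc hcM with ⟨rfl, -⟩ | ⟨rfl, hI⟩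
        · exact absurd hc.1 (lt_irrefl _)
        · rcases hqcase with ⟨-, -, h, -⟩ | ⟨h, -⟩
          · simp only [hl, if_neg hcM, inv_one]
            exact h
          · exact absurd hI h)
    (fun a b hpa hab hbq hfa hfb => by
      have ha : a ∈ Icc p q := ⟨hpa, hab.le.trans hbq⟩
      have hb : b ∈ Icc p q := ⟨hpa.trans hab.le, hbq⟩
      have haM : a ∉ M → a = p := fun h => by
        rcases hcases a ha hfa h with ⟨h, -⟩ | ⟨h, -⟩
        · exact h
        · linarith
      have hbM : b ∉ M → b = q := fun h => by
        rcases hcases b hb hfb h with ⟨h, -⟩ | ⟨h, -⟩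
        · linarith
        · exact h
      have hRb := hRmin b (hunit hb) hfb (hpa.trans_lt hab)
      have hQa := hQmax a (hunit ha) hfa (hab.trans_le hbq)
      by_cases h1 : a ∈ M <;> by_cases h2 : b ∈ M
      · simpa only [if_pos h1, if_pos h2] using hgap a h1 b h2 hab
      · simp only [if_pos h1, if_neg h2]
        linarith [hgapQ a h1 hQa, hbM h2]
      · simp only [if_neg h1, if_pos h2]
        linarith [hgapR b h2 hRb, haM h1]
      · simp only [if_neg h1, if_neg h2]
        linarith [haM h1, hbM h2])
    hpq hfp hfq
  have hlpos : ∀ c, 0 < l c := fun c => one_pos.trans_le (hl1 c)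
  obtain ⟨φ₁, m₁, l₀, hl₀, hl₀', h₁⟩ : ∃ (φ : ℝ → ℝ) (m : ℤ) (l₀ : ℝ), 0 < l₀ ∧
      (ITIat f.toFun 0 → l₀ = 1) ∧ ConjOn r ε f 0 q l₀ (l q) φ m := by
    rcases hp0.eq_or_lt with h0 | h0
    · subst h0
      exact ⟨φ, m, l 0, hlpos 0, hlp, hφ⟩
    · rcases hpcase with ⟨hI, -, -, hclose⟩ | ⟨-, h, -⟩
      · obtain ⟨φ', hφ'⟩ := ((hlp hI).symm ▸ ConjOn.id hclose : ConjOn r ε f 0 p 1 (l p) id 0).glue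
          hφ le_rfl h0 hpq hq1 (hlpos p) hfp hfq
        exact ⟨φ', _, 1, one_pos, fun _ => rfl, hφ'⟩
      · exact absurd h h0.ne'
  rcases hq1.eq_or_lt with h0 | h0
  · subst h0
    exact ⟨φ₁, m₁, l₀, l 1, hl₀, hlpos 1, hl₀', hlq, h₁⟩
  · rcases hqcase with ⟨hI, -, -, hclose⟩ | ⟨-, h, -⟩
    · obtain ⟨φ', hφ'⟩ := h₁.glue ((hlq hI).symm ▸ ConjOn.id hclose : ConjOn r ε f q 1 (l q) 1 id 0)
        le_rfl (by linarith) h0 le_rfl (hlpos q) hfq f.fix1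
      exact ⟨φ', _, l₀, 1, hl₀, one_pos, hl₀', fun _ => rfl, hφ'⟩
    · exact absurd h h0.ne

end DiffIcc

lemma tendsto_dilation_of_endpoint {c l : ℝ} (hc : c = 0 ∨ c = 1) (hl : 0 < l) :
    Tendsto (fun y => c + l * (y - c)) (nhdsWithin c (Icc 0 1)) (nhdsWithin c (Icc 0 1)) := by
  have h1 : Tendsto (fun y => c + l * (y - c)) (nhds c) (nhds c) := by
    have : Continuous fun y => c + l * (y - c) := by fun_prop
    simpa using this.tendsto c
  refine tendsto_nhdsWithin_of_tendsto_nhds_of_eventually_within _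
    (h1.mono_left nhdsWithin_le_nhds) ?_
  rcases hc with rfl | rfl
  · filter_upwards [(h1.eventually (gt_mem_nhds zero_lt_one)).filter_mono nhdsWithin_le_nhds,
      self_mem_nhdsWithin] with y hy hy'
    exact ⟨by nlinarith [hy'.1], hy.le⟩
  · filter_upwards [(h1.eventually (lt_mem_nhds zero_lt_one)).filter_mono nhdsWithin_le_nhds,
      self_mem_nhdsWithin] with y hy hy'
    exact ⟨hy.le, by nlinarith [hy'.2]⟩

namespace DiffIcc

section Endpoint

variable (F : DiffIcc ⊤) {c l : ℝ} {φ : ℝ → ℝ}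

lemma contDiffWithinAt_of_dilation (hc : c ∈ Icc (0:ℝ) 1)
    (hφ : ∀ᶠ x in nhdsWithin c (Icc 0 1), φ x = c + l * (F.toFun x - c)) :
    ContDiffWithinAt ℝ ∞ φ (Icc 0 1) c := by
  have h1 : ContDiffWithinAt ℝ ∞ (fun x => c + l * (F.toFun x - c)) (Icc 0 1) c :=
    contDiffWithinAt_const.add
      (contDiffWithinAt_const.mul ((F.smooth' c hc).sub contDiffWithinAt_const))
  exact h1.congr_of_eventuallyEq hφ (hφ.self_of_nhdsWithin hc)

lemma derivWithin_pos_of_dilation (hc : c ∈ Icc (0:ℝ) 1) (hl : 0 < l)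
    (hφ : ∀ᶠ x in nhdsWithin c (Icc 0 1), φ x = c + l * (F.toFun x - c)) :
    0 < derivWithin φ (Icc 0 1) c := by
  have h1 : HasDerivWithinAt (fun x => c + l * (F.toFun x - c))
      (l * derivWithin F.toFun (Icc 0 1) c) (Icc 0 1) c :=
    (((F.differentiableOn c hc).hasDerivWithinAt.sub_const c).const_mul l).const_add c
  rw [Filter.EventuallyEq.derivWithin_eq_of_mem hφ hc, h1.derivWithin (uniqueDiffOn_unit c hc)]
  exact mul_pos hl (F.deriv_pos c hc)

lemma contDiffWithinAt_inv_of_dilation {G : ℝ → ℝ} (hc : c = 0 ∨ c = 1) (hl : 0 < l)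
    (hφ : ∀ᶠ x in nhdsWithin c (Icc 0 1), φ x = c + l * (F.toFun x - c))
    (hG : ∀ x ∈ Icc (0:ℝ) 1, G (φ x) = x) : ContDiffWithinAt ℝ ∞ G (Icc 0 1) c := by
  have hcI : c ∈ Icc (0:ℝ) 1 := by rcases hc with rfl | rfl <;> simp
  have hFc : F.invFun c = c := by
    rcases hc with rfl | rfl
    · exact F.symm.fix0
    · exact F.symm.fix1
  have h1 := tendsto_dilation_of_endpoint hc (inv_pos.2 hl)
  have h2 : Tendsto F.invFun (nhdsWithin c (Icc 0 1)) (nhdsWithin c (Icc 0 1)) := by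
    refine tendsto_nhdsWithin_of_tendsto_nhds_of_eventually_within _ ?_
      (eventually_mem_nhdsWithin.mono fun y hy => F.maps_inv hy)
    have := (F.symm.smooth'.continuousOn c hcI).tendsto
    rwa [symm_toFun, hFc] at this
  have h3 : ∀ᶠ y in nhdsWithin c (Icc 0 1), G y = F.invFun (c + l⁻¹ * (y - c)) := by
    filter_upwards [(h2.comp h1).eventually hφ, h1.eventually eventually_mem_nhdsWithin]
      with y hy hyI
    rw [Function.comp, F.right_inv _ hyI, add_sub_cancel_left, mul_inv_cancel_left₀ hl.ne',
      add_sub_cancel] at hy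
    conv_lhs => rw [← hy]
    exact hG _ (F.maps_inv hyI)
  have h4 : ContDiffWithinAt ℝ ∞ (fun y => F.invFun (c + l⁻¹ * (y - c))) (Icc 0 1) c := by
    refine ContDiffWithinAt.comp_of_preimage_mem_nhdsWithin (g := F.invFun) c ?_
      (by fun_prop) (h1 self_mem_nhdsWithin)
    have := F.symm.smooth' c hcI
    simpa using this
  exact h4.congr_of_eventuallyEq h3 (h3.self_of_nhdsWithin hcI)

end Endpoint

variable {f : DiffIcc ⊤} {r : ℕ} {ε l₀ l₁ : ℝ} {φ : ℝ → ℝ} {m : ℤ}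

/-- A conjugating map on the unit interval is a diffeomorphism. -/
lemma _root_.ConjOn.exists_toFun_eq (H : ConjOn r ε f 0 1 l₀ l₁ φ m) (hl₀ : 0 < l₀)
    (hl₁ : 0 < l₁) : ∃ Φ : DiffIcc ⊤, Φ.toFun = φ := by
  have hleft : ∀ᶠ x in nhdsWithin 0 (Icc 0 1), φ x = 0 + l₀ * ((f.power 0).toFun x - 0) := by
    simp only [power_toFun, zpowFun_zero]
    exact H.left.filter_mono (nhdsWithin_mono _ Icc_subset_Ici_self)
  have hright : ∀ᶠ x in nhdsWithin 1 (Icc 0 1), φ x = 1 + l₁ * ((f.power m).toFun x - 1) := by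
    simp only [power_toFun]
    exact H.right.filter_mono (nhdsWithin_mono _ Icc_subset_Iic_self)
  have h0 : φ 0 = 0 := by
    rw [hleft.self_of_nhdsWithin (by simp), fix0]; simp
  have h1 : φ 1 = 1 := by
    rw [hright.self_of_nhdsWithin (by simp), fix1]; simp
  have hcases : ∀ x ∈ Icc (0:ℝ) 1, x = 0 ∨ x = 1 ∨ x ∈ Ioo (0:ℝ) 1 := fun x hx => by
    rcases hx.1.eq_or_lt with h | h
    · exact Or.inl h.symm
    · rcases hx.2.eq_or_lt with h' | h'
      · exact Or.inr (Or.inl h')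
      · exact Or.inr (Or.inr ⟨h, h'⟩)
  have hcdiff : ∀ x ∈ Ioo (0:ℝ) 1, ContDiffAt ℝ ∞ φ x := fun x hx =>
    H.smooth.contDiffAt (Ioo_mem_nhds hx.1 hx.2)
  have hsmooth : ContDiffOn ℝ ∞ φ (Icc 0 1) := fun x hx => by
    rcases hcases x hx with rfl | rfl | h
    · exact contDiffWithinAt_of_dilation _ (by simp) hleft
    · exact contDiffWithinAt_of_dilation _ (by simp) hright
    · exact (hcdiff x h).contDiffWithinAt
  have hmono : StrictMonoOn φ (Icc 0 1) :=
    strictMonoOn_of_deriv_pos (convex_Icc 0 1) hsmooth.continuousOn fun x hx => by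
      rw [interior_Icc] at hx
      exact H.deriv_pos x hx
  have hmaps : MapsTo φ (Icc 0 1) (Icc 0 1) := fun x hx =>
    ⟨h0 ▸ hmono.monotoneOn (by simp) hx hx.1, h1 ▸ hmono.monotoneOn hx (by simp) hx.2⟩
  have hsurj : SurjOn φ (Icc 0 1) (Icc 0 1) := fun y hy =>
    intermediate_value_Icc zero_le_one hsmooth.continuousOn (by rwa [h0, h1])
  have hG : ∀ x ∈ Icc (0:ℝ) 1, Function.invFunOn φ (Icc 0 1) (φ x) = x :=
    hmono.injOn.leftInvOn_invFunOn
  refine ⟨⟨φ, Function.invFunOn φ (Icc 0 1), hsmooth, fun y hy => ?_, hmaps,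
    hsurj.mapsTo_invFunOn, hG, hsurj.rightInvOn_invFunOn, h0, h1, fun x hx => ?_⟩, rfl⟩
  · rcases hcases y hy with rfl | rfl | h
    · exact contDiffWithinAt_inv_of_dilation _ (Or.inl rfl) hl₀ hleft hG
    · exact contDiffWithinAt_inv_of_dilation _ (Or.inr rfl) hl₁ hright hG
    · obtain ⟨x, hx, rfl⟩ := hsurj hy
      have hx' : x ∈ Ioo (0:ℝ) 1 := by
        rcases hcases x hx with rfl | rfl | hx'
        · exact absurd h0 h.1.ne'
        · exact absurd h1 h.2.ne
        · exact hx'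
      exact (contDiffAt_of_eventually_comp (hcdiff x hx') (H.deriv_pos x hx').ne'
        (by filter_upwards [Icc_mem_nhds hx'.1 hx'.2] with s hs using hG s hs)
        contDiffAt_id).contDiffWithinAt
  · rcases hcases x hx with rfl | rfl | h
    · exact derivWithin_pos_of_dilation _ (by simp) hl₀ hleft
    · exact derivWithin_pos_of_dilation _ (by simp) hl₁ hright
    · rw [derivWithin_eq φ h]
      exact H.deriv_pos x h

lemma iDistLt_of_closeAt (f Φ : DiffIcc ⊤)
    (hITI : ∀ x ∈ Ioo (0:ℝ) 1, f.toFun x = x → ¬ ITIat f.toFun x) {ε ε' : ℝ} (hε : ε < ε')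
    (hclose : ∀ x ∈ Ioo (0:ℝ) 1, f.toFun x ≠ x → CloseAt r ε f.toFun Φ.toFun x) :
    IDistLt r ε' (Φ.toFun ∘ f.toFun ∘ Φ.invFun) id := by
  intro k hk
  set g := Φ.toFun ∘ f.toFun ∘ Φ.invFun with hg
  have hgs : ContDiffOn ℝ ∞ g (Icc 0 1) :=
    Φ.smooth'.comp (f.smooth'.comp Φ.symm.smooth' Φ.maps_inv) (f.maps.comp Φ.maps_inv)
  have hcont : ∀ h : ℝ → ℝ, ContDiffOn ℝ ∞ h (Icc 0 1) →
      ContinuousOn (iteratedDerivWithin k h (Icc 0 1)) (Icc 0 1) := fun h hh =>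
    hh.continuousOn_iteratedDerivWithin (natCast_le_infty _) uniqueDiffOn_unit
  have hD := ((hcont g hgs).sub (hcont id contDiffOn_id)).abs
  set S := Φ.toFun '' {x | x ∈ Ioo (0:ℝ) 1 ∧ f.toFun x ≠ x} with hS
  have hSI : S ⊆ Ioo 0 1 := by
    rintro _ ⟨x, hx, rfl⟩
    exact Φ.mapsTo_Ioo hx.1
  have hbound : ∀ z ∈ S, |iteratedDerivWithin k g (Icc 0 1) z -
      iteratedDerivWithin k id (Icc 0 1) z| ≤ ε := by
    rintro _ ⟨x, ⟨hx, hfx⟩, rfl⟩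
    have hz := Φ.mapsTo_Ioo hx
    have hga : ContDiffAt ℝ k g (Φ.toFun x) :=
      (hgs.contDiffAt (Icc_mem_nhds hz.1 hz.2)).of_le (natCast_le_infty _)
    rw [iteratedDerivWithin_eq_iteratedDeriv uniqueDiffOn_unit hga (Ioo_subset_Icc_self hz),
      iteratedDerivWithin_eq_iteratedDeriv uniqueDiffOn_unit contDiffAt_id
        (Ioo_subset_Icc_self hz), ← iteratedDeriv_fun_sub hga contDiffAt_id]
    refine hclose x hx hfx g ?_ k hk
    filter_upwards [Icc_mem_nhds hx.1 hx.2] with y hy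
    simp only [hg, Function.comp, Φ.left_inv y hy]
  have hdense : Icc (0:ℝ) 1 ⊆ closure S := by
    rw [← closure_Ioo zero_ne_one]
    refine closure_minimal (fun z hz => ?_) isClosed_closure
    by_contra hzS
    have hx := Φ.symm.mapsTo_Ioo hz
    rw [symm_toFun] at hx
    have h1 : ∀ᶠ y in nhds (Φ.invFun z), f.toFun y = y := by
      have h2 : Tendsto Φ.toFun (nhds (Φ.invFun z)) (nhds z) := by
        have := (Φ.contDiffAt hx).continuousAt.tendsto
        rwa [Φ.right_inv z (Ioo_subset_Icc_self hz)] at this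
      filter_upwards [h2 (isClosed_closure.isOpen_compl.mem_nhds hzS), Ioo_mem_nhds hx.1 hx.2]
        with y hy hyI
      by_contra hfy
      exact hy (subset_closure ⟨y, ⟨hyI, hfy⟩, rfl⟩)
    exact hITI _ hx h1.self_of_nhds (f.ITIat_of_eventually_eq hx h1)
  intro x hx
  exact (ContinuousWithinAt.closure_le (hdense hx)
    ((hD x hx).mono (hSI.trans Ioo_subset_Icc_self)) continuousWithinAt_const hbound).trans_lt hε

end DiffIcc

/-- Any smooth diffeomorphism of `[0,1]` without interior ITI fixed point and with
vanishing asymptotic variation is almost reducible, by conjugacies coinciding with an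
integer power of `f` near the ITI endpoints. -/
theorem almostReducible_no_interior_ITI (f : DiffIcc ⊤)
    (hITI : ∀ x ∈ Set.Ioo (0:ℝ) 1, f.toFun x = x → ¬ ITIat f.toFun x)
    (hvar : IAsympVarVanishes f.toFun) :
    ∀ r : ℕ, ∀ ε > (0 : ℝ), ∃ φ : DiffIcc ⊤,
      IDistLt r ε (φ.toFun ∘ f.toFun ∘ φ.invFun) id ∧
      (ITIat f.toFun 0 → ∃ (m : ℤ) (δ : ℝ), 0 < δ ∧
        ∀ x ∈ Set.Icc (0:ℝ) δ, φ.toFun x = zpowFun f m x) ∧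
      (ITIat f.toFun 1 → ∃ (m : ℤ) (δ : ℝ), 0 < δ ∧
        ∀ x ∈ Set.Icc (1 - δ) 1, φ.toFun x = zpowFun f m x) := by
  intro r ε hε
  obtain ⟨φ, m, l₀, l₁, hl₀, hl₁, h0, h1, H⟩ := f.exists_conjOn_unit hITI hvar r (half_pos hε)
  obtain ⟨Φ, rfl⟩ := H.exists_toFun_eq hl₀ hl₁
  refine ⟨Φ, DiffIcc.iDistLt_of_closeAt f Φ hITI (half_lt_self hε) H.close, fun h => ?_,
    fun h => ?_⟩
  · obtain ⟨δ, hδ, hδ'⟩ := Metric.mem_nhdsWithin_iff.1 H.left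
    refine ⟨0, δ / 2, half_pos hδ, fun x hx => ?_⟩
    have : Φ.toFun x = 0 + l₀ * (x - 0) := hδ' ⟨by
      rw [Metric.mem_ball, Real.dist_eq, abs_lt]; constructor <;> linarith [hx.1, hx.2], hx.1⟩
    rw [this, h0 h, zpowFun_zero]
    ring
  · obtain ⟨δ, hδ, hδ'⟩ := Metric.mem_nhdsWithin_iff.1 H.right
    refine ⟨m, δ / 2, half_pos hδ, fun x hx => ?_⟩
    have : Φ.toFun x = 1 + l₁ * (zpowFun f m x - 1) := hδ' ⟨by
      rw [Metric.mem_ball, Real.dist_eq, abs_lt]; constructor <;> linarith [hx.1, hx.2], hx.2⟩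
    rw [this, h1 h]
    ring
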